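/- Let g ∈ ℚ[y] be the degree 48 polynomial g(y) = y^48 - 22y^44 + 495y^40 - 4774y^36 + 51997y^32 - 214038y^28 + 64152y^26 + 2194852y^24 - 705672y^22 - 4044304y^20 - 30696732y^18 + 61713630y^16 + 149602464y^14 - 9212940y^12 + 569477304y^10 + 138870369y^8 - 484796664y^6 + 1029399030y^4 + 39870468y^2 + 793881. Then g is irreducible over ℚ, the Galois group of g over ℚ has cardinality 380160 (the order of the group 2.M₁₂.2), and the number field K = ℚ[y]/(g) has discriminant of absolute value 11^2·(2^12·3^24·11^22)^2 = 2^24·3^48·11^46. -/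

import Mathlib

open Polynomial NumberField

/-- Value at `x` of the polynomial with the integer coefficients `l`, constant term first. -/
def evalCoeffs {K : Type*} [CommRing K] (l : List ℤ) (x : K) : K :=
  l.foldr (fun (c : ℤ) (r : K) => (c : K) + x * r) 0

namespace CoeffList

def add : List ℤ → List ℤ → List ℤ
  | [], b => b
  | a :: as, [] => a :: as
  | a :: as, b :: bs => (a + b) :: add as bs

def smul (c : ℤ) (l : List ℤ) : List ℤ := l.map (c * ·)

def mul : List ℤ → List ℤ → List ℤ
  | [], _ => []
  | a :: as, b => add (smul a b) (0 :: mul as b)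

/-- Reduction of all coefficients modulo `N`; nothing happens for `N = 0`. -/
def red (N : ℤ) (l : List ℤ) : List ℤ := l.map (· % N)

/-- Remainder modulo `X ^ n + t` and modulo `N`. -/
def rem (N : ℤ) (n : ℕ) (t : List ℤ) : List ℤ → List ℤ
  | [] => []
  | c :: as => red N (add ((c :: rem N n t as).take n)
      (smul (-1) (mul ((c :: rem N n t as).drop n) t)))

def mulMod (N : ℤ) (n : ℕ) (t a b : List ℤ) : List ℤ := rem N n t (mul a b)

/-- `a ^ e` modulo `X ^ n + t` and `N`, computed by squaring (for `e < 2 ^ k`). -/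
def powMod (N : ℤ) (n : ℕ) (t a : List ℤ) : ℕ → ℕ → List ℤ
  | 0, _ => [1]
  | k + 1, e => (fun r => if e % 2 = 1 then mulMod N n t a (mulMod N n t r r)
      else mulMod N n t r r) (powMod N n t a k (e / 2))

/-- The value of the polynomial `l` at the polynomial `a`, modulo `X ^ n + t` and `N`. -/
def compMod (N : ℤ) (n : ℕ) (t l a : List ℤ) : List ℤ :=
  l.foldr (fun c r => add [c] (mulMod N n t a r)) []

def isZero (l : List ℤ) : Bool := l.all (· == 0)

section
variable {K : Type*} [CommRing K]

@[simp] theorem eval_nil (x : K) : evalCoeffs [] x = 0 := rfl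

@[simp] theorem eval_cons (c : ℤ) (l : List ℤ) (x : K) :
    evalCoeffs (c :: l) x = c + x * evalCoeffs l x := rfl

@[simp] theorem eval_add (a b : List ℤ) (x : K) :
    evalCoeffs (add a b) x = evalCoeffs a x + evalCoeffs b x := by
  induction a generalizing b with
  | nil => simp [add]
  | cons a as ih =>
    cases b with
    | nil => simp [add]
    | cons b bs => simp [add, ih]; ring

@[simp] theorem eval_smul (c : ℤ) (l : List ℤ) (x : K) :
    evalCoeffs (smul c l) x = c * evalCoeffs l x := by
  induction l with
  | nil => simp [smul]
  | cons a as ih =>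
    have : smul c (a :: as) = (c * a) :: smul c as := rfl
    simp [this, ih]; ring

@[simp] theorem eval_mul (a b : List ℤ) (x : K) :
    evalCoeffs (mul a b) x = evalCoeffs a x * evalCoeffs b x := by
  induction a with
  | nil => simp [mul]
  | cons a as ih => simp [mul, ih]; ring

theorem eval_red {N : ℤ} (hN : (N : K) = 0) (l : List ℤ) (x : K) :
    evalCoeffs (red N l) x = evalCoeffs l x := by
  induction l with
  | nil => rfl
  | cons a as ih =>
    have h1 : red N (a :: as) = (a % N) :: red N as := rfl
    have h2 : ((a % N : ℤ) : K) = (a : K) := by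
      have := congrArg (fun z : ℤ => (z : K)) (Int.emod_add_mul_ediv a N)
      simpa [hN] using this
    simp [h1, ih, h2]

theorem eval_take_drop (n : ℕ) (l : List ℤ) (x : K) :
    evalCoeffs (l.take n) x + x ^ n * evalCoeffs (l.drop n) x = evalCoeffs l x := by
  induction n generalizing l with
  | zero => simp
  | succ n ih =>
    cases l with
    | nil => simp
    | cons a as => simp [← ih as, pow_succ]; ring

theorem eval_rem {N : ℤ} (hN : (N : K) = 0) {n : ℕ} {t : List ℤ} {x : K}
    (hx : x ^ n + evalCoeffs t x = 0) (l : List ℤ) :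
    evalCoeffs (rem N n t l) x = evalCoeffs l x := by
  induction l with
  | nil => rfl
  | cons a as ih =>
    rw [rem, eval_red hN, eval_add, eval_smul, eval_mul, eval_cons, ← ih, ← eval_cons,
      ← eval_take_drop n (a :: rem N n t as) x, eq_neg_of_add_eq_zero_left hx]
    push_cast; ring

theorem eval_mulMod {N : ℤ} (hN : (N : K) = 0) {n : ℕ} {t : List ℤ} {x : K}
    (hx : x ^ n + evalCoeffs t x = 0) (a b : List ℤ) :
    evalCoeffs (mulMod N n t a b) x = evalCoeffs a x * evalCoeffs b x := by
  rw [mulMod, eval_rem hN hx, eval_mul]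

theorem eval_powMod {N : ℤ} (hN : (N : K) = 0) {n : ℕ} {t : List ℤ} {x : K}
    (hx : x ^ n + evalCoeffs t x = 0) (a : List ℤ) {k e : ℕ} (he : e < 2 ^ k) :
    evalCoeffs (powMod N n t a k e) x = evalCoeffs a x ^ e := by
  induction k generalizing e with
  | zero => obtain rfl : e = 0 := by simpa using he
            simp [powMod]
  | succ k ih =>
    have h2 : e / 2 < 2 ^ k := by omega
    simp only [powMod]
    split_ifs with h
    · simp only [eval_mulMod hN hx, ih h2]
      rw [← pow_add, ← pow_succ']
      congr 1; omega
    · rw [eval_mulMod hN hx, ih h2, ← pow_add]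
      congr 1; omega

theorem eval_compMod {N : ℤ} (hN : (N : K) = 0) {n : ℕ} {t : List ℤ} {x : K}
    (hx : x ^ n + evalCoeffs t x = 0) (l a : List ℤ) :
    evalCoeffs (compMod N n t l a) x = evalCoeffs l (evalCoeffs a x) := by
  induction l with
  | nil => rfl
  | cons c l ih =>
    have : compMod N n t (c :: l) a = add [c] (mulMod N n t a (compMod N n t l a)) := rfl
    rw [this, eval_add, eval_mulMod hN hx, ih]; simp

theorem eval_eq_zero_of_isZero {l : List ℤ} (h : isZero l = true) (x : K) :
    evalCoeffs l x = 0 := by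
  induction l with
  | nil => rfl
  | cons a as ih =>
    simp only [isZero, List.all_cons, Bool.and_eq_true, beq_iff_eq] at h
    simp [h.1, ih h.2]

theorem map_eval {L : Type*} [CommRing L] (φ : K →+* L) (l : List ℤ) (x : K) :
    φ (evalCoeffs l x) = evalCoeffs l (φ x) := by
  induction l with
  | nil => simp
  | cons a as ih => simp [ih]

end

end CoeffList

universe u

/-- Reduction of algebraic integers modulo a prime above `ℓ`, with a Frobenius element. -/
theorem exists_frobenius (E : Type u) [Field E] [NumberField E] [IsGalois ℚ E]
    (ℓ : ℕ) [hℓ : Fact ℓ.Prime] :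
    ∃ (k : Type u) (_ : Field k) (π : 𝓞 E →+* k) (σ : E ≃ₐ[ℚ] E),
      ((ℓ : ℤ) : k) = 0 ∧ ∀ r : 𝓞 E, π (σ • r) = π r ^ ℓ := by
  have hp : (Ideal.span {(ℓ : ℤ)}).IsMaximal := Int.ideal_span_isMaximal_of_prime ℓ
  obtain ⟨Q, hQ, hQℓ⟩ := Ideal.exists_maximal_ideal_liesOver_of_isIntegral (S := 𝓞 E)
    (Ideal.span {(ℓ : ℤ)})
  obtain ⟨σ, hσ⟩ := IsArithFrobAt.exists_of_isInvariant ℤ (E ≃ₐ[ℚ] E) Q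
  have hu : Q.under ℤ = Ideal.span {(ℓ : ℤ)} := hQℓ.over.symm
  have hcard : Nat.card (ℤ ⧸ Q.under ℤ) = ℓ := by
    rw [hu]; exact Int.card_ideal_quot ℓ
  refine ⟨𝓞 E ⧸ Q, Ideal.Quotient.field Q, Ideal.Quotient.mk Q, σ, ?_, fun r => ?_⟩
  · have h1 : (ℓ : ℤ) ∈ Q.under ℤ := by rw [hu]; exact Ideal.mem_span_singleton_self _
    have h2 : ((ℓ : ℤ) : 𝓞 E) ∈ Q := by simpa [Ideal.mem_comap] using h1
    simpa using Ideal.Quotient.eq_zero_iff_mem.mpr h2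
  · have := hσ.mk_apply r
    rw [hcard] at this
    simpa using this

theorem intCast_ne_zero_of_isCoprime {k : Type*} [Field k] {n ℓ : ℤ} (hℓ : (ℓ : k) = 0)
    (h : Int.gcd n ℓ = 1) : (n : k) ≠ 0 := by
  intro h0
  obtain ⟨a, b, hab⟩ := Int.isCoprime_iff_gcd_eq_one.mpr h
  have := congrArg (fun z : ℤ => (z : k)) hab
  simp [h0, hℓ] at this

/-- The size of the class of `v` when points are told apart by their `c`-colours seen from the
points of `L`, multiplied up along a list. -/
def chainProd {n : ℕ} {β : Type*} [DecidableEq β] (c : Fin n → Fin n → β) :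
    List (Fin n) → List (Fin n) → ℕ
  | _, [] => 1
  | L, v :: vs => (List.finRange n).countP (fun w => L.all fun u => c u w == c u v) *
      chainProd c (v :: L) vs

theorem card_eq_card_orbit_mul_card_stabilizer (G : Type*) [Group G] {β : Type*} [MulAction G β]
    (b : β) : Nat.card G = Nat.card (MulAction.orbit G b) * Nat.card (MulAction.stabilizer G b) := by
  rw [← Nat.card_prod]
  exact Nat.card_congr (MulAction.orbitProdStabilizerEquivGroup G b).symm

theorem card_le_chainProd {n : ℕ} {β : Type*} [DecidableEq β] (c : Fin n → Fin n → β)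
    (vs : List (Fin n)) (L : List (Fin n)) (H : Subgroup (Equiv.Perm (Fin n)))
    (hc : ∀ σ ∈ H, ∀ i j, c (σ i) (σ j) = c i j) (hL : ∀ σ ∈ H, ∀ u ∈ L, σ u = u)
    (hall : ∀ i, i ∈ vs ∨ i ∈ L) :
    Nat.card H ≤ chainProd c L vs := by
  induction vs generalizing L H with
  | nil =>
    have : H = ⊥ := by
      rw [Subgroup.eq_bot_iff_forall]
      intro σ hσ
      ext i
      have := hL σ hσ i (by simpa using hall i)
      simp [this]
    simp [this, chainProd]
  | cons v vs ih =>
    have h2 : Nat.card ((H ⊓ MulAction.stabilizer (Equiv.Perm (Fin n)) v : Subgroup _))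
        ≤ chainProd c (v :: L) vs := by
      refine ih _ _ (fun σ hσ => hc σ hσ.1) (fun σ hσ u hu => ?_) (fun i => ?_)
      · rcases List.mem_cons.mp hu with rfl | hu
        · exact hσ.2
        · exact hL σ hσ.1 u hu
      · have := hall i
        simp only [List.mem_cons] at this ⊢
        tauto
    have h3 : Nat.card (MulAction.stabilizer H v) =
        Nat.card ((H ⊓ MulAction.stabilizer (Equiv.Perm (Fin n)) v : Subgroup _)) := by
      refine Nat.card_congr
        { toFun := fun s => ⟨s.1.1, s.1.2, s.2⟩
          invFun := fun s => ⟨⟨s.1, s.2.1⟩, s.2.2⟩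
          left_inv := fun s => rfl
          right_inv := fun s => rfl }
    have h4 : Nat.card (MulAction.orbit H v) ≤
        (List.finRange n).countP (fun w => L.all fun u => c u w == c u v) := by
      rw [List.countP_eq_length_filter, ← List.toFinset_card_of_nodup
        ((List.nodup_finRange n).filter _), Nat.card_coe_set_eq, ← Set.ncard_coe_finset]
      refine Set.ncard_le_ncard ?_
      rintro _ ⟨σ, rfl⟩
      simp only [List.coe_toFinset, List.mem_filter, List.mem_finRange, true_and,
        List.all_eq_true, beq_iff_eq, Set.mem_ofPred_eq]
      intro u hu
      have := hc σ.1 σ.2 u v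
      rwa [hL σ.1 σ.2 u hu] at this
    have h5 := card_eq_card_orbit_mul_card_stabilizer H v
    rw [chainProd, h5, h3]
    exact Nat.mul_le_mul h4 h2

theorem dvd_card_of_minimalPeriod_eq {α : Type*} [DecidableEq α] (f : α → α)
    (hf : Function.Injective f) {n : ℕ} (hn : 0 < n) (S : Finset α) (hS : ∀ x ∈ S, f x ∈ S)
    (hp : ∀ x ∈ S, Function.minimalPeriod f x = n) : n ∣ S.card := by
  induction hm : S.card using Nat.strong_induction_on generalizing S with
  | _ m ih =>
    obtain rfl | ⟨x, hx⟩ := S.eq_empty_or_nonempty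
    · simp [← hm]
    have hmem : ∀ z, z ∈ (Finset.range n).image (f^[·] x) ↔ ∃ k, f^[k] x = z := fun z => by
      simp only [Finset.mem_image, Finset.mem_range]
      refine ⟨fun ⟨k, _, h⟩ => ⟨k, h⟩, fun ⟨k, h⟩ => ⟨k % n, Nat.mod_lt _ hn, ?_⟩⟩
      rw [← hp x hx, Function.iterate_mod_minimalPeriod_eq, h]
    set P := (Finset.range n).image (f^[·] x) with hP
    have hPc : P.card = n := by
      rw [hP, Finset.card_image_of_injOn, Finset.card_range]
      rw [Finset.coe_range, ← hp x hx]
      exact Function.iterate_injOn_Iio_minimalPeriod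
    have hPS : P ⊆ S := by
      intro z hz
      obtain ⟨k, rfl⟩ := (hmem z).1 hz
      clear hz
      induction k with
      | zero => exact hx
      | succ k ihk => rw [Function.iterate_succ_apply']; exact hS _ ihk
    have hcard : (S \ P).card = m - n := by rw [Finset.card_sdiff_of_subset hPS, hm, hPc]
    have hle : n ≤ m := by rw [← hm, ← hPc]; exact Finset.card_le_card hPS
    have := ih (m - n) (by omega) (S \ P) (fun z hz => by
      rw [Finset.mem_sdiff] at hz ⊢
      refine ⟨hS z hz.1, fun hPz => hz.2 ?_⟩
      obtain ⟨k, hk⟩ := (hmem _).1 hPz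
      refine (hmem _).2 ⟨k + n - 1, hf ?_⟩
      rw [← Function.iterate_succ_apply' f, ← hk, show (k + n - 1).succ = k + n by omega,
        Function.iterate_add_apply, ← hp x hx, Function.iterate_minimalPeriod])
      (fun z hz => hp z (Finset.mem_sdiff.1 hz).1) hcard
    simpa [Nat.sub_add_cancel hle] using Nat.dvd_add this dvd_rfl

section
variable {G α : Type*} [Group G] [DecidableEq α] [MulAction G α]

/-- `e ∈ H` has `c` fixed points on `Ω` and all its other points there have period `n`. -/
def HasType (H : Subgroup G) (Ω : Finset α) (e : G) (n c : ℕ) : Prop :=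
  e ∈ H ∧ (Ω.filter (fun x => e • x = x)).card = c ∧
    ∀ x ∈ Ω, e • x = x ∨ Function.minimalPeriod (e • · : α → α) x = n

theorem HasType.conj {H : Subgroup G} {Ω : Finset α} {e g : G} {n c : ℕ}
    (h : HasType H Ω e n c) (hΩ : ∀ g ∈ H, ∀ x ∈ Ω, g • x ∈ Ω) (hg : g ∈ H) :
    HasType H Ω (g * e * g⁻¹) n c := by
  obtain ⟨he, hc, hp⟩ := h
  refine ⟨H.mul_mem (H.mul_mem hg he) (H.inv_mem hg), ?_, fun x hx => ?_⟩
  · rw [← hc]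
    refine Finset.card_bij' (fun x _ => g⁻¹ • x) (fun x _ => g • x) ?_ ?_ ?_ ?_
    · intro x hx
      rw [Finset.mem_filter] at hx ⊢
      refine ⟨hΩ _ (H.inv_mem hg) _ hx.1, ?_⟩
      have := congrArg (g⁻¹ • ·) hx.2
      simpa [mul_smul] using this
    · intro x hx
      rw [Finset.mem_filter] at hx ⊢
      refine ⟨hΩ _ hg _ hx.1, ?_⟩
      simp [mul_smul, hx.2]
    · simp
    · simp
  · have hkey : ∀ m : ℕ, (g * e * g⁻¹) ^ m • x = x ↔ e ^ m • (g⁻¹ • x) = g⁻¹ • x := fun m => by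
      rw [conj_pow, mul_smul, mul_smul, smul_eq_iff_eq_inv_smul]
    rcases hp (g⁻¹ • x) (hΩ _ (H.inv_mem hg) _ hx) with h | h
    · left; simpa using (hkey 1).2 (by simpa using h)
    · right
      rw [← h, Function.minimalPeriod_eq_minimalPeriod_iff]
      intro m
      simp only [Function.IsPeriodicPt, Function.IsFixedPt, smul_iterate]
      exact hkey m

/-- Transitivity of `H` on the injective `k`-tuples of points of `Ω`. -/
def KTrans (H : Subgroup G) (Ω : Finset α) (k : ℕ) : Prop :=
  ∀ u v : Fin k → α, Function.Injective u → Function.Injective v → (∀ i, u i ∈ Ω) →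
    (∀ i, v i ∈ Ω) → ∃ g ∈ H, ∀ i, g • u i = v i

variable {H : Subgroup G} {Ω : Finset α}

theorem card_sdiff_image {k : ℕ} {u : Fin k → α} (hu : Function.Injective u)
    (hΩ : ∀ i, u i ∈ Ω) : (Ω \ Finset.univ.image u).card = Ω.card - k := by
  rw [Finset.card_sdiff_of_subset, Finset.card_image_of_injective _ hu, Finset.card_univ,
    Fintype.card_fin]
  intro z hz
  obtain ⟨i, -, rfl⟩ := Finset.mem_image.1 hz
  exact hΩ i

theorem KTrans.count {k : ℕ} (hk : KTrans H Ω k) (hΩ : ∀ g ∈ H, ∀ x ∈ Ω, g • x ∈ Ω)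
    {e : G} {n c : ℕ} (he : HasType H Ω e n c) (hn : 0 < n) (hkc : k ≤ c)
    {u : Fin k → α} (hu : Function.Injective u) (huΩ : ∀ i, u i ∈ Ω)
    {S : Finset α} (hSu : S ⊆ Ω \ Finset.univ.image u)
    (hS : ∀ g ∈ H, (∀ i, g • u i = u i) → ∀ x ∈ S, g • x ∈ S) :
    ∃ q r, S.card = n * q + r ∧ r ≤ c - k := by
  obtain ⟨u', hu', hu'F⟩ : ∃ u' : Fin k → α, Function.Injective u' ∧
      ∀ i, u' i ∈ Ω.filter (fun x => e • x = x) := by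
    have h := he.2.1
    refine ⟨fun i => ((Ω.filter (fun x => e • x = x)).equivFin.symm
      (Fin.castLE (by rw [h]; exact hkc) i) : α), fun i j hij => ?_, fun i => Subtype.coe_prop _⟩
    simpa using hij
  obtain ⟨g, hg, hgu⟩ := hk u' u hu' hu (fun i => (Finset.mem_filter.1 (hu'F i)).1) huΩ
  have he' := he.conj hΩ hg
  set e' := g * e * g⁻¹
  have hfix : ∀ i, e' • u i = u i := fun i => by
    rw [← hgu i]; simp [e', mul_smul, (Finset.mem_filter.1 (hu'F i)).2]
  have hSΩ : S ⊆ Ω := hSu.trans Finset.sdiff_subset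
  obtain ⟨q, hq⟩ := dvd_card_of_minimalPeriod_eq (e' • · : α → α) (MulAction.injective e') hn
    (S.filter (fun x => ¬ e' • x = x)) (fun x hx => by
      rw [Finset.mem_filter] at hx ⊢
      exact ⟨hS e' he'.1 hfix x hx.1, fun h => hx.2 (MulAction.injective e' h)⟩)
    (fun x hx => by
      rw [Finset.mem_filter] at hx
      exact (he'.2.2 x (hSΩ hx.1)).resolve_left hx.2)
  refine ⟨q, (S.filter (fun x => e' • x = x)).card, ?_, ?_⟩
  · rw [← hq, add_comm, Finset.card_filter_add_card_filter_not]
  · have h1 : S.filter (fun x => e' • x = x) ⊆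
        (Ω.filter (fun x => e' • x = x)) \ Finset.univ.image u := by
      intro z hz
      rw [Finset.mem_filter] at hz
      have := hSu hz.1
      rw [Finset.mem_sdiff] at this ⊢
      exact ⟨Finset.mem_filter.2 ⟨this.1, hz.2⟩, this.2⟩
    refine (Finset.card_le_card h1).trans ?_
    rw [card_sdiff_image hu fun i => Finset.mem_filter.2 ⟨huΩ i, hfix i⟩, he'.2.1]

theorem KTrans.succ {k : ℕ} (hk : KTrans H Ω k) (hΩ : ∀ g ∈ H, ∀ x ∈ Ω, g • x ∈ Ω)
    (h : ∀ u : Fin k → α, Function.Injective u → (∀ i, u i ∈ Ω) →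
      ∀ S ⊆ Ω \ Finset.univ.image u, S.Nonempty →
        (∀ g ∈ H, (∀ i, g • u i = u i) → ∀ x ∈ S, g • x ∈ S) → Ω.card - k ≤ S.card) :
    KTrans H Ω (k + 1) := by
  classical
  intro u v hu hv huΩ hvΩ
  obtain ⟨g, hg, hgu⟩ := hk (fun i => u i.castSucc) (fun i => v i.castSucc)
    (fun i j hij => by simpa using hu hij) (fun i j hij => by simpa using hv hij)
    (fun i => huΩ _) (fun i => hvΩ _)
  set v' : Fin k → α := fun i => v i.castSucc
  have hv' : Function.Injective v' := fun i j hij => by simpa using hv hij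
  have hmem : ∀ z, z ∈ Ω \ Finset.univ.image v' ↔ z ∈ Ω ∧ ∀ i, v' i ≠ z := by simp
  let S := (Ω \ Finset.univ.image v').filter
    (fun z => ∃ g' ∈ H, (∀ i, g' • v' i = v' i) ∧ g' • g • u (Fin.last k) = z)
  have hlast : g • u (Fin.last k) ∈ Ω \ Finset.univ.image v' := by
    rw [hmem]
    refine ⟨hΩ g hg _ (huΩ _), fun i hi => ?_⟩
    have := hu (MulAction.injective g ((hgu i).trans hi))
    exact absurd this (Fin.castSucc_lt_last i).ne
  have hSS : S ⊆ Ω \ Finset.univ.image v' := Finset.filter_subset _ _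
  have hSeq : S = Ω \ Finset.univ.image v' := by
    refine Finset.eq_of_subset_of_card_le hSS ?_
    rw [card_sdiff_image hv' fun i => hvΩ _]
    refine h v' hv' (fun i => hvΩ _) S hSS ⟨_, Finset.mem_filter.2
      ⟨hlast, 1, H.one_mem, by simp, by simp⟩⟩ fun g₁ hg₁ hfix x hx => ?_
    obtain ⟨hx1, g₂, hg₂, hg₂v, rfl⟩ := Finset.mem_filter.1 hx
    rw [hmem] at hx1
    refine Finset.mem_filter.2 ⟨(hmem _).2 ⟨hΩ _ hg₁ _ hx1.1, fun i hi => hx1.2 i ?_⟩,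
      g₁ * g₂, H.mul_mem hg₁ hg₂, fun i => by rw [mul_smul, hg₂v, hfix], by rw [mul_smul]⟩
    exact MulAction.injective g₁ ((hfix i).trans hi)
  have hvlast : v (Fin.last k) ∈ S := by
    rw [hSeq, hmem]
    exact ⟨hvΩ _, fun i hi => (Fin.castSucc_lt_last i).ne (hv hi)⟩
  obtain ⟨-, g', hg', hfix, hg'v⟩ := Finset.mem_filter.1 hvlast
  refine ⟨g' * g, H.mul_mem hg' hg, fun i => ?_⟩
  induction i using Fin.lastCases with
  | last => rw [mul_smul, hg'v]
  | cast i => rw [mul_smul, hgu, hfix]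

theorem kTrans_four (hΩ : ∀ g ∈ H, ∀ x ∈ Ω, g • x ∈ Ω) (hc : Ω.card = 12)
    (hmov : ∀ x ∈ Ω, ∃ g ∈ H, g • x ≠ x) {e₁ e₂ e₃ e₄ : G} (h₁ : HasType H Ω e₁ 11 1)
    (h₂ : HasType H Ω e₂ 5 2) (h₃ : HasType H Ω e₃ 3 3) (h₄ : HasType H Ω e₄ 4 4) :
    KTrans H Ω 4 := by
  have hcard : ∀ {k : ℕ} {u : Fin k → α} {S : Finset α}, Function.Injective u →
      (∀ i, u i ∈ Ω) → S ⊆ Ω \ Finset.univ.image u → S.card ≤ 12 - k := fun hu huΩ hS => by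
    rw [← hc, ← card_sdiff_image hu huΩ]; exact Finset.card_le_card hS
  have k0 : KTrans H Ω 0 := fun u v _ _ _ _ => ⟨1, H.one_mem, fun i => i.elim0⟩
  have hne1 : ∀ S ⊆ Ω, (∀ g ∈ H, ∀ x ∈ S, g • x ∈ S) → S.card ≠ 1 := by
    intro S hS hst h1
    obtain ⟨x, rfl⟩ := Finset.card_eq_one.1 h1
    obtain ⟨g, hg, hgx⟩ := hmov x (hS (Finset.mem_singleton_self x))
    exact hgx (by simpa using hst g hg x)
  have k1 : KTrans H Ω 1 := k0.succ hΩ fun u hu huΩ S hS hne hst => by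
    obtain ⟨q, r, hq, hr⟩ := k0.count hΩ h₁ (by norm_num) (by norm_num) hu huΩ hS hst
    have h1 := hcard hu huΩ hS
    have h2 := hne.card_pos
    have hSΩ : S ⊆ Ω := hS.trans Finset.sdiff_subset
    have hst' : ∀ g ∈ H, ∀ x ∈ S, g • x ∈ S := fun g hg => hst g hg fun i => i.elim0
    have h3 := hne1 S hSΩ hst'
    have h4 := hne1 (Ω \ S) Finset.sdiff_subset fun g hg x hx => by
      rw [Finset.mem_sdiff] at hx ⊢
      refine ⟨hΩ g hg x hx.1, fun h => hx.2 ?_⟩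
      simpa using hst' g⁻¹ (H.inv_mem hg) _ h
    rw [Finset.card_sdiff_of_subset hSΩ, hc] at h4
    omega
  have k2 : KTrans H Ω 2 := k1.succ hΩ fun u hu huΩ S hS hne hst => by
    obtain ⟨q, r, hq, hr⟩ := k1.count hΩ h₁ (by norm_num) (by norm_num) hu huΩ hS hst
    have h1 := hcard hu huΩ hS
    have h2 := hne.card_pos
    omega
  have k3 : KTrans H Ω 3 := k2.succ hΩ fun u hu huΩ S hS hne hst => by
    obtain ⟨q, r, hq, hr⟩ := k2.count hΩ h₂ (by norm_num) (by norm_num) hu huΩ hS hst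
    obtain ⟨q', r', hq', hr'⟩ := k2.count hΩ h₃ (by norm_num) (by norm_num) hu huΩ hS hst
    have h1 := hcard hu huΩ hS
    have h2 := hne.card_pos
    have h3 : q ≤ 3 := by omega
    interval_cases q <;> omega
  exact k3.succ hΩ fun u hu huΩ S hS hne hst => by
    obtain ⟨q, r, hq, hr⟩ := k3.count hΩ h₃ (by norm_num) (by norm_num) hu huΩ hS hst
    obtain ⟨q', r', hq', hr'⟩ := k3.count hΩ h₄ (by norm_num) (by norm_num) hu huΩ hS hst
    have h1 := hcard hu huΩ hS
    have h2 := hne.card_pos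
    have h3 : q ≤ 3 := by omega
    interval_cases q <;> omega

end

/-- The sign vector `(+, +, -, -)`. -/
def halfSigns : Fin 4 → ℤˣ := ![1, 1, -1, -1]

theorem exists_perm_halfSigns (ε : Fin 4 → ℤˣ) (h : ∏ i, ε i = 1) :
    ∃ p q : Equiv.Perm (Fin 4), ∀ i, ε i = halfSigns (p i) * halfSigns (q i) := by
  revert ε; decide +kernel

section
variable {G α : Type*} [Group G] [Finite G] [DecidableEq α] [CommRing α] [IsDomain α]
  [MulSemiringAction G α] {H : Subgroup G} {Ω : Finset α}

theorem smul_units_mul (g : G) (ε : ℤˣ) (a : α) : g • (((ε : ℤ) : α) * a) = ((ε : ℤ) : α) * g • a := by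
  rw [smul_mul']
  congr 1
  exact map_intCast (MulSemiringAction.toRingHom G α g) _

theorem exists_halfSigns_smul (h4 : KTrans H Ω 4) {ρ : G} (hρ : ρ ∈ H)
    {y : Fin 4 → α} (hy : Function.Injective fun i => y i ^ 2) (hyΩ : ∀ i, y i ^ 2 ∈ Ω)
    (hρy : ∀ i, ρ • y i = ((halfSigns i : ℤ) : α) * y i) (p : Equiv.Perm (Fin 4)) :
    ∃ g ∈ H, ∀ i, g • y i = ((halfSigns (p i) : ℤ) : α) * y i := by
  obtain ⟨g, hg, hgy⟩ := h4 (fun i => y i ^ 2) (fun i => y (p i) ^ 2) hy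
    (hy.comp p.injective) hyΩ fun i => hyΩ _
  refine ⟨g⁻¹ * ρ * g, H.mul_mem (H.mul_mem (H.inv_mem hg) hρ) hg, fun i => ?_⟩
  have h1 : ρ • g • y i = ((halfSigns (p i) : ℤ) : α) * g • y i := by
    have h2 := hgy i
    simp only [smul_pow'] at h2
    rcases sq_eq_sq_iff_eq_or_eq_neg.1 h2 with h | h
    · rw [h, hρy]
    · rw [h, smul_neg, hρy]; ring
  rw [mul_smul, mul_smul, h1, smul_units_mul, inv_smul_smul]

theorem le_card_of_kTrans_four (hc : Ω.card = 12) (h4 : KTrans H Ω 4) {ρ : G} (hρ : ρ ∈ H)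
    {y : Fin 4 → α} (hy : Function.Injective fun i => y i ^ 2) (hyΩ : ∀ i, y i ^ 2 ∈ Ω)
    (hρy : ∀ i, ρ • y i = ((halfSigns i : ℤ) : α) * y i)
    (h2 : (2 : α) ≠ 0) (hy0 : ∀ i, y i ≠ 0) (hρ2 : ∃ z : α, ρ • ρ • z ≠ z) :
    190080 ≤ Nat.card H := by
  classical
  let u : Fin 4 → α := fun i => y i ^ 2
  have horb : 11880 ≤ Nat.card (MulAction.orbit H u) := by
    have hE : Nat.card (Fin 4 ↪ Ω) = 11880 := by
      rw [Nat.card_eq_fintype_card, Fintype.card_embedding_eq]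
      simp [hc, Nat.descFactorial]
    rw [← hE]
    have : Finite (MulAction.orbit H u) := Set.finite_range _
    refine Nat.card_le_card_of_injective
      (fun v => (⟨fun i => (v i : α), ?_⟩ : MulAction.orbit H u)) ?_
    · obtain ⟨g, hg, hgu⟩ := h4 u (fun i => (v i : α)) hy
        (fun i j hij => v.injective (Subtype.ext hij)) hyΩ fun i => (v i).2
      exact ⟨⟨g, hg⟩, funext hgu⟩
    · intro v w hvw
      ext i
      exact congrFun (congrArg Subtype.val hvw) i
  have hcard1 := card_eq_card_orbit_mul_card_stabilizer H u
  set D := MulAction.stabilizer H u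
  have hDu : ∀ ε : Fin 4 → ℤˣ, ∀ g : H, (∀ i, (g : G) • y i = ((ε i : ℤ) : α) * y i) → g ∈ D := by
    intro ε g hg
    refine funext fun i => ?_
    change (g : G) • (y i ^ 2) = y i ^ 2
    rw [smul_pow', hg i, mul_pow]
    rcases Int.units_eq_one_or (ε i) with h | h <;> simp [h]
  have hDorb : 8 ≤ Nat.card (MulAction.orbit D y) := by
    have hE : Nat.card {ε : Fin 4 → ℤˣ // ∏ i, ε i = 1} = 8 := by
      rw [Nat.card_eq_fintype_card]; decide +kernel
    rw [← hE]
    have : Finite (MulAction.orbit D y) := Set.finite_range _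
    refine Nat.card_le_card_of_injective
      (fun ε => (⟨fun i => ((ε.1 i : ℤ) : α) * y i, ?_⟩ : MulAction.orbit D y)) ?_
    · obtain ⟨p, q, hpq⟩ := exists_perm_halfSigns ε.1 ε.2
      obtain ⟨g, hg, hgy⟩ := exists_halfSigns_smul h4 hρ hy hyΩ hρy p
      obtain ⟨g', hg', hgy'⟩ := exists_halfSigns_smul h4 hρ hy hyΩ hρy q
      have key : ∀ i, (g * g') • y i = ((ε.1 i : ℤ) : α) * y i := fun i => by
        rw [mul_smul, hgy', smul_units_mul, hgy, hpq i]; push_cast; ring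
      exact ⟨⟨⟨g * g', H.mul_mem hg hg'⟩, hDu ε.1 _ key⟩, funext key⟩
    · intro ε ε' h
      ext i
      have h1 := congrFun (congrArg Subtype.val h) i
      have h3 := mul_right_cancel₀ (hy0 i) h1
      have h4 : (1 : α) ≠ -1 := fun h => h2 (by
        have : (2 : α) = 1 - -1 := by ring
        rw [this, ← h, sub_self])
      rcases Int.units_eq_one_or (ε.1 i) with h | h <;>
      rcases Int.units_eq_one_or (ε'.1 i) with h' | h' <;> simp [h, h'] at h3 ⊢
      · exact h4 h3
      · exact h4 h3.symm
  have hcard2 := card_eq_card_orbit_mul_card_stabilizer D y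
  have hDst : 2 ≤ Nat.card (MulAction.stabilizer D y) := by
    have hmem : ∀ i, (ρ * ρ) • y i = y i := fun i => by
      rw [mul_smul, hρy, smul_units_mul, hρy, ← mul_assoc]
      rcases Int.units_eq_one_or (halfSigns i) with h | h <;> simp [h]
    let r : D := ⟨⟨ρ * ρ, H.mul_mem hρ hρ⟩, hDu 1 _ (by simpa using hmem)⟩
    have hr : r ∈ MulAction.stabilizer D y := funext hmem
    have : Nontrivial (MulAction.stabilizer D y) := by
      refine ⟨⟨⟨r, hr⟩, 1, fun h => ?_⟩⟩
      have h1 : ρ * ρ = 1 := congrArg (fun s : MulAction.stabilizer D y => (s.1.1.1 : G)) h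
      obtain ⟨z, hz⟩ := hρ2
      exact hz (by rw [← mul_smul, h1, one_smul])
    exact Finite.one_lt_card
  have h1 : 11880 * (8 * 2) ≤ Nat.card H := by
    rw [hcard1, hcard2]
    gcongr
  exact h1

theorem exists_smul_eq_of_sq_mem (h4 : KTrans H Ω 4) {ρ : G} (hρ : ρ ∈ H)
    {y : Fin 4 → α} (hy : Function.Injective fun i => y i ^ 2) (hyΩ : ∀ i, y i ^ 2 ∈ Ω)
    (hc : Ω.card = 12)
    (hρy : ∀ i, ρ • y i = ((halfSigns i : ℤ) : α) * y i) {a b : α} (ha : a ^ 2 ∈ Ω)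
    (hb : b ^ 2 ∈ Ω) : ∃ g ∈ H, g • a = b := by
  have h1 : ∀ x ∈ Ω, ∀ i, ∃ g ∈ H, g • x = y i ^ 2 := by
    intro x hx i
    obtain ⟨T, hT, hTc⟩ := Finset.exists_subset_card_eq (s := Ω.erase x) (n := 3)
      (by rw [Finset.card_erase_of_mem hx, hc]; norm_num)
    let v : Fin 4 → α := Fin.cons x fun j => (T.equivFin.symm (Fin.cast hTc.symm j) : α)
    have hvT : ∀ j : Fin 3, v j.succ ∈ Ω.erase x := fun j => hT (by simp [v])
    have hv : Function.Injective v := by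
      rw [Fin.cons_injective_iff]
      refine ⟨?_, fun i j hij => by simpa using hij⟩
      rintro ⟨j, hj⟩
      exact (Finset.mem_erase.1 (hvT j)).1 hj
    have hvΩ : ∀ j, v j ∈ Ω := fun j => by
      induction j using Fin.cases with
      | zero => exact hx
      | succ j => exact Finset.mem_of_mem_erase (hvT j)
    obtain ⟨g, hg, hgv⟩ := h4 v (fun j => y (Equiv.swap 0 i j) ^ 2) hv
      (hy.comp (Equiv.injective _)) hvΩ fun j => hyΩ _
    exact ⟨g, hg, by simpa [v] using hgv 0⟩
  obtain ⟨g, hg, hga⟩ := h1 _ ha 2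
  obtain ⟨g', hg', hgb⟩ := h1 _ hb 2
  rw [smul_pow', sq_eq_sq_iff_eq_or_eq_neg] at hga hgb
  have hneg : ρ • y 2 = -y 2 := by simpa [halfSigns] using hρy 2
  have hpm : g • a = g' • b ∨ ρ • g • a = g' • b := by
    rcases hga with h | h <;> rcases hgb with h' | h' <;> rw [h, h'] <;> simp [hneg, smul_neg]
  rcases hpm with h | h
  · exact ⟨g'⁻¹ * g, H.mul_mem (H.inv_mem hg') hg, by rw [mul_smul, h, inv_smul_smul]⟩
  · exact ⟨g'⁻¹ * (ρ * g), H.mul_mem (H.inv_mem hg') (H.mul_mem hρ hg), by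
      rw [mul_smul, mul_smul, h, inv_smul_smul]⟩

end

/-- The polynomial `X ^ n + t`, where `t` is given by its coefficients. -/
noncomputable def monicPoly (R : Type*) [CommRing R] (n : ℕ) (t : List ℤ) : R[X] :=
  X ^ n + evalCoeffs t X

section
variable {R : Type*} [CommRing R]

theorem eval_monicPoly (n : ℕ) (t : List ℤ) (x : R) :
    (monicPoly R n t).eval x = x ^ n + evalCoeffs t x := by
  have := CoeffList.map_eval (evalRingHom x) t X
  simp only [coe_evalRingHom, eval_X] at this
  simp [monicPoly, this]

theorem map_monicPoly {S : Type*} [CommRing S] (φ : R →+* S) (n : ℕ) (t : List ℤ) :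
    (monicPoly R n t).map φ = monicPoly S n t := by
  have := CoeffList.map_eval (mapRingHom φ) t X
  simp only [coe_mapRingHom, map_X] at this
  simp [monicPoly, this]

theorem degree_evalCoeffs_lt (t : List ℤ) : (evalCoeffs t (X : R[X])).degree < t.length := by
  induction t with
  | nil => simp
  | cons a t ih =>
    rw [CoeffList.eval_cons]
    refine (degree_add_le _ _).trans_lt (max_lt ?_ ?_)
    · rw [← C_eq_intCast]
      refine degree_C_le.trans_lt ?_
      rw [List.length_cons]
      exact_mod_cast Nat.succ_pos _
    · rw [mul_comm, List.length_cons, Nat.cast_add, Nat.cast_one]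
      rcases subsingleton_or_nontrivial R with h | h
      · simp [Subsingleton.elim (evalCoeffs t (X : R[X]) * X) 0]
      · rw [degree_mul_X]
        exact WithBot.add_lt_add_right (by simp) ih

theorem monic_monicPoly {n : ℕ} {t : List ℤ} (h : t.length ≤ n) : (monicPoly R n t).Monic :=
  monic_X_pow_add ((degree_evalCoeffs_lt t).trans_le (by exact_mod_cast h))

theorem natDegree_monicPoly [Nontrivial R] {n : ℕ} {t : List ℤ} (h : t.length ≤ n) :
    (monicPoly R n t).natDegree = n := by
  have hlt := (degree_evalCoeffs_lt (R := R) t).trans_le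
    (show (t.length : WithBot ℕ) ≤ n by exact_mod_cast h)
  refine natDegree_eq_of_degree_eq_some ?_
  rw [monicPoly, degree_add_eq_left_of_degree_lt] <;> simp [hlt]

theorem card_le_of_forall_root [IsDomain R] {n : ℕ} {t : List ℤ} (h : t.length ≤ n)
    (S : Finset R) (hS : ∀ x ∈ S, x ^ n + evalCoeffs t x = 0) : S.card ≤ n := by
  rw [← natDegree_monicPoly (R := R) h]
  refine card_le_degree_of_subset_roots (fun x hx => ?_)
  rw [mem_roots (monic_monicPoly h).ne_zero, IsRoot, eval_monicPoly]
  exact hS x hx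

end

section
variable {E : Type} [Field E] [NumberField E] {n : ℕ} {t : List ℤ}

theorem exists_map_eq_of_isIntegral (s : Multiset E) (hs : ∀ a ∈ s, IsIntegral ℤ a) :
    ∃ M : Multiset (𝓞 E), M.map (algebraMap (𝓞 E) E) = s := by
  induction s using Multiset.induction with
  | empty => exact ⟨0, rfl⟩
  | cons a s ih =>
    obtain ⟨M, rfl⟩ := ih fun b hb => hs b (Multiset.mem_cons_of_mem hb)
    obtain ⟨b, rfl⟩ := (IsIntegralClosure.isIntegral_iff (A := 𝓞 E)).1
      (hs a (Multiset.mem_cons_self a _))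
    exact ⟨b ::ₘ M, Multiset.map_cons _ _ _⟩

/-- A monic integer polynomial splitting over a number field splits over its ring of integers. -/
theorem exists_multiset_prod_eq (ht : t.length ≤ n)
    (h : ((monicPoly ℚ n t).map (algebraMap ℚ E)).Splits) :
    ∃ M : Multiset (𝓞 E), monicPoly (𝓞 E) n t = (M.map fun a => X - C a).prod := by
  rw [map_monicPoly] at h
  have hm := monic_monicPoly (R := E) ht
  have hint : ∀ a ∈ (monicPoly E n t).roots, IsIntegral ℤ a := by
    intro a ha
    refine ⟨monicPoly ℤ n t, monic_monicPoly ht, ?_⟩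
    rw [← eval_map, map_monicPoly]
    exact (mem_roots'.1 ha).2
  obtain ⟨M, hM⟩ := exists_map_eq_of_isIntegral _ hint
  refine ⟨M, map_injective (algebraMap (𝓞 E) E) (FaithfulSMul.algebraMap_injective _ _) ?_⟩
  rw [map_monicPoly, Polynomial.map_multiset_prod, Multiset.map_map, h.eq_prod_roots_of_monic hm,
    ← hM, Multiset.map_map]
  simp

theorem exists_root_of_map_root (ht : t.length ≤ n)
    (h : ((monicPoly ℚ n t).map (algebraMap ℚ E)).Splits) {k : Type*} [Field k] (π : 𝓞 E →+* k)
    {z : k} (hz : z ^ n + evalCoeffs t z = 0) :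
    ∃ r : 𝓞 E, r ^ n + evalCoeffs t r = 0 ∧ π r = z := by
  obtain ⟨M, hM⟩ := exists_multiset_prod_eq ht h
  have h1 := congrArg (fun p => (p.map π).eval z) hM
  simp only [map_monicPoly, eval_monicPoly, hz, Polynomial.map_multiset_prod, Multiset.map_map,
    eval_multiset_prod] at h1
  obtain ⟨a, ha, haz⟩ : ∃ a ∈ M, z - π a = 0 := by
    have := Multiset.prod_eq_zero_iff.1 h1.symm
    simpa using this
  refine ⟨a, ?_, (sub_eq_zero.1 haz).symm⟩
  rw [← eval_monicPoly, hM, eval_multiset_prod, Multiset.map_map]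
  refine Multiset.prod_eq_zero (Multiset.mem_map.2 ⟨a, ha, by simp⟩)

theorem eq_of_map_eq {k : Type*} [Field k] (π : 𝓞 E →+* k) {x x' : 𝓞 E}
    (hx : x ^ n + evalCoeffs t x = 0) (hx' : x' ^ n + evalCoeffs t x' = 0)
    (hd : ((monicPoly k n t).derivative).eval (π x) ≠ 0) (h : π x = π x') : x = x' := by
  obtain ⟨c, hc⟩ := binomExpansion (monicPoly (𝓞 E) n t) x (x' - x)
  rw [add_sub_cancel, eval_monicPoly, eval_monicPoly, hx, hx'] at hc
  have h1 : (x' - x) * ((monicPoly (𝓞 E) n t).derivative.eval x + c * (x' - x)) = 0 := by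
    linear_combination -hc
  rcases mul_eq_zero.1 h1 with h2 | h2
  · exact (sub_eq_zero.1 h2).symm
  · refine absurd ?_ hd
    have h3 := congrArg π h2
    rw [map_add, map_mul, map_sub, h, sub_self, mul_zero, add_zero, map_zero,
      ← eval_map_apply, ← derivative_map, map_monicPoly, h] at h3
    rwa [h]

end

/-- Coefficients of the derivative. -/
def CoeffList.deriv : List ℤ → List ℤ
  | [] => []
  | _ :: l => CoeffList.add l (0 :: CoeffList.deriv l)

theorem derivative_evalCoeffs {R : Type*} [CommRing R] (l : List ℤ) :
    derivative (evalCoeffs l (X : R[X])) = evalCoeffs (CoeffList.deriv l) X := by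
  induction l with
  | nil => simp [CoeffList.deriv]
  | cons a l ih => simp [CoeffList.deriv, ih]

/-- Coefficients of the derivative of `X ^ n + t`. -/
def CoeffList.derivMonic (n : ℕ) (t : List ℤ) : List ℤ :=
  CoeffList.add (CoeffList.deriv t) (List.replicate (n - 1) 0 ++ [(n : ℤ)])

theorem evalCoeffs_append {R : Type*} [CommRing R] (l m : List ℤ) (x : R) :
    evalCoeffs (l ++ m) x = evalCoeffs l x + x ^ l.length * evalCoeffs m x := by
  induction l with
  | nil => simp
  | cons a l ih => simp [ih, pow_succ]; ring

theorem evalCoeffs_replicate_zero {R : Type*} [CommRing R] (n : ℕ) (x : R) :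
    evalCoeffs (List.replicate n 0) x = 0 := by
  induction n with
  | zero => rfl
  | succ n ih => simp [List.replicate_succ, ih]

theorem derivative_monicPoly {R : Type*} [CommRing R] (n : ℕ) (t : List ℤ) :
    derivative (monicPoly R n t) = evalCoeffs (CoeffList.derivMonic n t) X := by
  rw [monicPoly, derivative_add, derivative_evalCoeffs, CoeffList.derivMonic, CoeffList.eval_add,
    evalCoeffs_append, evalCoeffs_replicate_zero, derivative_X_pow]
  simp; ring

theorem eval_evalCoeffs_X {R : Type*} [CommRing R] (l : List ℤ) (x : R) :
    (evalCoeffs l (X : R[X])).eval x = evalCoeffs l x := by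
  simpa using CoeffList.map_eval (evalRingHom x) l X

namespace CoeffList

/-- Sum of the absolute values of the coefficients. -/
def norm (l : List ℤ) : ℕ := l.foldr (fun c r => c.natAbs + r) 0

theorem norm_add_le (a b : List ℤ) : norm (add a b) ≤ norm a + norm b := by
  induction a generalizing b with
  | nil => simp [add]
  | cons a as ih =>
    cases b with
    | nil => simp [add]
    | cons b bs =>
      have := ih bs
      have h := Int.natAbs_add_le a b
      simp only [add, norm, List.foldr_cons] at this ⊢
      omega

theorem norm_smul (c : ℤ) (a : List ℤ) : norm (smul c a) = c.natAbs * norm a := by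
  induction a with
  | nil => simp [smul, norm]
  | cons a as ih =>
    simp only [smul, norm, List.map_cons, List.foldr_cons, Int.natAbs_mul] at ih ⊢
    rw [ih]; ring

theorem norm_mul_le (a b : List ℤ) : norm (mul a b) ≤ norm a * norm b := by
  induction a with
  | nil => simp [mul, norm]
  | cons a as ih =>
    refine (norm_add_le _ _).trans ?_
    rw [norm_smul]
    have h1 : norm (0 :: mul as b) = norm (mul as b) := by simp [norm]
    have h2 : norm (a :: as) = a.natAbs + norm as := rfl
    rw [h1, h2, add_mul]
    omega

/-- A polynomial with coefficients small compared to `N` vanishes if it does so at `N`. -/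
theorem eval_eq_zero_of_norm_lt {N : ℕ} {l : List ℤ} (hl : norm l < N)
    (h : evalCoeffs l (N : ℤ) = 0) {K : Type*} [CommRing K] (x : K) : evalCoeffs l x = 0 := by
  induction l with
  | nil => rfl
  | cons c l ih =>
    have h2 : norm (c :: l) = c.natAbs + norm l := rfl
    rw [eval_cons, Int.cast_id] at h
    have hdvd : (N : ℤ) ∣ c := ⟨-evalCoeffs l (N : ℤ), by linear_combination h⟩
    have hc : c = 0 := Int.eq_zero_of_abs_lt_dvd hdvd (by rw [Int.abs_eq_natAbs]; omega)
    subst hc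
    have hN : N ≠ 0 := by omega
    have : evalCoeffs l (N : ℤ) = 0 := by simpa [hN] using h
    simp [ih (by omega) this]

/-- Value at `2 ^ K`. -/
def pack (K : ℕ) (l : List ℤ) : ℤ := l.foldr (fun c r => c + 2 ^ K * r) 0

/-- A list of `n` balanced digits of `v` in base `2 ^ K`. -/
def unpack (K : ℕ) : ℕ → ℤ → List ℤ
  | 0, _ => []
  | n + 1, v => (fun d => d :: unpack K n ((v - d) / 2 ^ K)) (Int.bmod v (2 ^ K))

end CoeffList

/-- Expressions in polynomials given by their coefficients. -/
inductive PolyExpr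
  | atom (l : List ℤ)
  | add (a b : PolyExpr)
  | mul (a b : PolyExpr)

namespace PolyExpr
open CoeffList

def toList : PolyExpr → List ℤ
  | atom l => l
  | add a b => CoeffList.add a.toList b.toList
  | mul a b => CoeffList.mul a.toList b.toList

/-- An upper bound for the norm. -/
def bound : PolyExpr → ℕ
  | atom l => norm l
  | add a b => a.bound + b.bound
  | mul a b => a.bound * b.bound

/-- The value at `2 ^ K`. -/
def packed (K : ℕ) : PolyExpr → ℤ
  | atom l => pack K l
  | add a b => a.packed K + b.packed K
  | mul a b => a.packed K * b.packed K

def eval {R : Type*} [CommRing R] (x : R) : PolyExpr → R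
  | atom l => evalCoeffs l x
  | add a b => a.eval x + b.eval x
  | mul a b => a.eval x * b.eval x

theorem norm_toList_le (e : PolyExpr) : norm e.toList ≤ e.bound := by
  induction e with
  | atom l => exact le_rfl
  | add a b iha ihb => exact (norm_add_le _ _).trans (Nat.add_le_add iha ihb)
  | mul a b iha ihb => exact (norm_mul_le _ _).trans (Nat.mul_le_mul iha ihb)

theorem eval_eq {R : Type*} [CommRing R] (x : R) (e : PolyExpr) :
    e.eval x = evalCoeffs e.toList x := by
  induction e with
  | atom l => rfl
  | add a b iha ihb => simp [eval, toList, iha, ihb]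
  | mul a b iha ihb => simp [eval, toList, iha, ihb]

theorem packed_eq (K : ℕ) (e : PolyExpr) :
    e.packed K = evalCoeffs e.toList (((2 ^ K : ℕ) : ℤ)) := by
  rw [← eval_eq]
  induction e with
  | atom l =>
    simp only [packed, eval]
    induction l with
    | nil => rfl
    | cons c l ih => rw [CoeffList.eval_cons, ← ih]; simp [pack]
  | add a b iha ihb => simp [eval, packed, iha, ihb]
  | mul a b iha ihb => simp [eval, packed, iha, ihb]

/-- Test for divisibility by `X ^ n + t`, comparing values at `2 ^ K`; `m` bounds the length of
the quotient. -/
def isZeroMod (K m n : ℕ) (t : List ℤ) (e : PolyExpr) : Bool :=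
  (fun (f : List ℤ) => (fun q => (Nat.ble (e.bound + norm q * norm f + 1) (2 ^ K)) &&
      (e.packed K - pack K q * pack K f == 0))
    (unpack K m (e.packed K / pack K f))) (CoeffList.add t (List.replicate n 0 ++ [1]))

theorem eval_eq_zero {K m n : ℕ} {t : List ℤ} {e : PolyExpr} (h : e.isZeroMod K m n t = true)
    {R : Type*} [CommRing R] {x : R} (hx : x ^ n + evalCoeffs t x = 0) : e.eval x = 0 := by
  simp only [isZeroMod, Bool.and_eq_true, Nat.ble_eq, beq_iff_eq] at h
  set f := CoeffList.add t (List.replicate n 0 ++ [1]) with hf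
  set q := unpack K m (e.packed K / pack K f)
  have hfx : evalCoeffs f x = 0 := by
    rw [hf, CoeffList.eval_add, evalCoeffs_append, evalCoeffs_replicate_zero]
    simp only [List.length_replicate, CoeffList.eval_cons, CoeffList.eval_nil]
    linear_combination hx + x ^ n * (Int.cast_one (R := R))
  let e' := add e (mul (atom q) (mul (atom [-1]) (atom f)))
  have h1 : CoeffList.norm e'.toList < 2 ^ K := by
    refine (norm_toList_le e').trans_lt ?_
    have : e'.bound = e.bound + norm q * (1 * norm f) := rfl
    rw [this, one_mul]
    omega
  have h2 := eval_eq_zero_of_norm_lt h1 (by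
    rw [← packed_eq]
    have : e'.packed K = e.packed K + pack K q * (pack K [-1] * pack K f) := rfl
    rw [this, ← h.2]
    simp [pack]
    ring) x
  rw [← eval_eq] at h2
  simpa [e', eval, hfx] using h2

end PolyExpr

/-- The polynomial `f` is `X ^ 24 + fTail`. -/
def fTail : List ℤ :=
  [793881, 39870468, 1029399030, -484796664, 138870369, 569477304, -9212940, 149602464,
   61713630, -30696732, -4044304, -705672, 2194852, 64152, -214038, 0, 51997, 0, -4774, 0, 495,
   0, -22, 0]

/-- The polynomial `g` is `X ^ 48 + gTail`, that is `f(X ^ 2)`. -/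
def gTail : List ℤ :=
  [793881, 0, 39870468, 0, 1029399030, 0, -484796664, 0, 138870369, 0, 569477304, 0, -9212940,
   0, 149602464, 0, 61713630, 0, -30696732, 0, -4044304, 0, -705672, 0, 2194852, 0, 64152, 0,
   -214038, 0, 0, 0, 51997, 0, 0, 0, -4774, 0, 0, 0, 495, 0, 0, 0, -22, 0, 0, 0]

/-- Together with `bCoeffs`: `4 f = A ^ 2 + 11 B ^ 2`. -/
def aCoeffs : List ℤ :=
  [1243, 64152, -15114, 0, 17754, 0, 4664, 0, -957, 0, -22, 0, 2]

/-- Together with `aCoeffs`: `4 f = A ^ 2 + 11 B ^ 2`. -/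
def bCoeffs : List ℤ :=
  [385, 0, 4686, 0, 4884, 0, -1804, 0, -165, 0, 22]

/-- Coefficients, as a polynomial in `Y ^ 2`, of the part of the adjacency form odd in `y`. -/
def evenPart : List (List ℤ) := [
  [119787822, 1721398635, -2305959678, 496557864, -739632465, 1114373700, 2905428042,
   353113695, 12966723, 196252925, -50455548, 5398701, 729729, 4588122, 0, 131428, 0, 20097, 0,
   4125, 0, -121, 0, 21],
  [-71449290, -2702370924, -68354741862, 19667607894, -39619425186, -15927722712, 7506409482,
   -3209396256, -962869842, -2756884086, -77828652, 392530050, -34510806, -42869574, 6011874,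
   -1058508, -1227402, 176418, 117018, 0, -7722, 0, 198, 0],
  [-381327507, -5367429441, 8996788746, 38097908145, -13653165438, -5221972800, 8214551334,
   -2442468006, -1936805013, 271523274, -376123176, -371833968, 179593524, 28744947, -6527466,
   -9096450, -176418, 560109, 0, -84249, 0, 3399, 0, -264],
  [39694050, 2077674786, 45096674832, -22582915344, -362303766, 14684681484, 1801796238,
   6289830954, 1498978008, -658215558, 225328378, 7585974, 10952898, 1411344, 8365632, -176418,
   -530398, 0, 122100, 0, -5214, 0, 418, 0],
  [37841661, 2842093980, -2025455058, -4897099053, 7144135119, -1003289166, -1545421680,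
   693802989, -1138954608, -345923391, 103910202, 45476277, 5027913, -11505087, -176418,
   1536150, 0, -219516, 0, 18216, 0, -1056, 0, 33],
  [4763286, 213818616, 5676249150, -2357297316, 692440650, 3292489134, -252865800, 274153572,
   261196650, -161422470, -56271534, 5645376, 9793146, 176418, -1846020, 0, 212454, 0, -24486,
   0, 1320, 0, -66, 0],
  [3087315, -2910897, -37577034, 382239, -117494388, 42281514, 72331380, -2868426, 9261945,
   8423294, -1587762, -641718, 0, 262185, 0, -21692, 0, 3465, 0, -165, 0, 11, 0, 0]]

/-- Coefficients, as a polynomial in `Y ^ 2`, of the part of the adjacency form odd in `Y`. -/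
def oddPart : List (List ℤ) := [
  [50014503, -1898963352, -799967421, -17186994396, 5055522417, 19481839740, -1741863123,
   -1894631310, 2941858359, 160605720, 399674979, -67278948, -140893830, 7884558, 14025231,
   -3903966, -1323135, 550968, 0, -67914, 0, 3960, 0, -186],
  [53983908, 2640271788, 44887090248, -21266660646, -20015798220, -4467080178, -2225826702,
   -5270664168, 79832412, 4059554598, 716058640, -519903846, 63820878, -45163008, 3256242,
   10937916, 1620740, -176418, -3630, 0, 2112, 0, 550, 0],
  [0, -73037052, -3512658798, -84888636822, 38332455876, -4477136004, -40081993182, 813894642,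
   -6762278358, -3384723078, 1973411748, 337038240, -78858846, -92339280, -2646270, 9800208,
   176418, -1390620, 0, 118602, 0, -7326, 0, 264],
  [47632860, 2156710050, 56749789404, -23566092858, 12585483702, 29637165492, -1580234832,
   5763046806, 2595579228, -850511178, -268189482, -58923612, 88349382, -2117016, -10944252,
   176418, 1721478, 0, -141768, 0, 8514, 0, -264, 0],
  [0, 4763286, 244691766, 5647140180, -2733067656, 696263040, 2117545254, 169949340, 997467372,
   232512390, -68803020, 27961406, -10232244, 3375966, 176418, 775830, 0, -4466, 0, 10164, 0,
   -330, 0, 44],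
  [-4763286, -232342506, -5658783768, 2582759520, -694734084, -2587522806, -823284, -708141852,
   -243986094, 105850800, 5731770, 3881196, -5942838, -176418, 272910, 0, -82302, 0, 3696, 0,
   -330, 0, 0, 0]]

/-- Cofactor in the norm identity of the adjacency form. -/
def kappaCoeffs : List ℤ :=
  [0, 20495625777, -260709638310, -6416146771254, 3325573683630, 712751889564, -4477475785068,
   -2132330807376, -1064328735492, -843698303613, -257234027292, 112158149818, 69521041260,
   -7430862648, -26995658778, 52871676, 2623688496, -136902304, -463802922, 12909732, 25227774,
   -1312608, -1940598, 49324]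

/-- The roots of `g` modulo 1270747. -/
def rootsMod : List ℤ :=
  [6584, 30585, 53318, 70704, 96757, 99297, 138631, 173791, 180857, 291818, 304576, 362181,
   372380, 381065, 391827, 433037, 457025, 460234, 484788, 507728, 548869, 580767, 599874,
   621856, 1264163, 1240162, 1217429, 1200043, 1173990, 1171450, 1132116, 1096956, 1089890,
   978929, 966171, 908566, 898367, 889682, 878920, 837710, 813722, 810513, 785959, 763019,
   721878, 689980, 670873, 648891]

/-- Rows of the adjacency relation between the roots of `g`, as binary numbers. -/
def adjTable : List ℕ :=
  [8693018001826, 8892070232069, 3335583490306, 78931331915776, 73016625430816, 17602062062609,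
   72190381146496, 193609006055489, 140806345721429, 5912597268736, 4984347517216,
   140756232180224, 3992210130976, 158408345388044, 35193391420484, 52863691129364,
   184796555772944, 26457495569984, 167151690322004, 78065359186336, 77655693150466,
   72295037413666, 202311615911429, 76044543639586, 70375757572096, 193514130904664,
   75733192083616, 137443658146, 6052150143106, 184804139074124, 6878394427426, 8797195081244,
   61599855415304, 73156178305186, 74084428056706, 61649968956509, 75076565442946,
   43997855748689, 167212809716249, 149542510007369, 17609645363789, 175948705566749,
   35254510814729, 1003416387586, 1413082423456, 6773738160256, 94585225304, 3024231934336]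

/-- Value of a polynomial in two variables, given by its coefficients with respect to the second
variable. -/
def evalCoeffs₂ {K : Type*} [CommRing K] (l : List (List ℤ)) (x y : K) : K :=
  l.foldr (fun c r => evalCoeffs c x + y * r) 0

theorem CoeffList.eval₂_cons {K : Type*} [CommRing K] (c : List ℤ) (l : List (List ℤ)) (x y : K) :
    evalCoeffs₂ (c :: l) x y = evalCoeffs c x + y * evalCoeffs₂ l x y := rfl

namespace PolyExpr

def add₂ : List PolyExpr → List PolyExpr → List PolyExpr
  | [], b => b
  | a :: as, [] => a :: as
  | a :: as, b :: bs => add a b :: add₂ as bs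

def mul₂ : List PolyExpr → List PolyExpr → List PolyExpr
  | [], _ => []
  | a :: as, b => add₂ (b.map (mul a)) (atom [] :: mul₂ as b)

section
variable {K : Type*} [CommRing K]

/-- Value of a polynomial in two variables, given by its coefficients with respect to the second
variable. -/
def eval₂ (x y : K) (l : List PolyExpr) : K := l.foldr (fun c r => c.eval x + y * r) 0

theorem eval₂_cons (x y : K) (c : PolyExpr) (l : List PolyExpr) :
    eval₂ x y (c :: l) = c.eval x + y * eval₂ x y l := rfl

theorem eval₂_add₂ (x y : K) (a b : List PolyExpr) :
    eval₂ x y (add₂ a b) = eval₂ x y a + eval₂ x y b := by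
  induction a generalizing b with
  | nil => simp [add₂, eval₂]
  | cons a as ih =>
    cases b with
    | nil => simp [add₂, eval₂]
    | cons b bs => simp [add₂, eval₂_cons, ih, eval]; ring

theorem eval₂_map_mul (x y : K) (a : PolyExpr) (l : List PolyExpr) :
    eval₂ x y (l.map (mul a)) = a.eval x * eval₂ x y l := by
  induction l with
  | nil => simp [eval₂]
  | cons c l ih => rw [List.map_cons, eval₂_cons, eval₂_cons, ih, eval]; ring

theorem eval₂_mul₂ (x y : K) (a b : List PolyExpr) :
    eval₂ x y (mul₂ a b) = eval₂ x y a * eval₂ x y b := by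
  induction a with
  | nil => simp [mul₂, eval₂]
  | cons a as ih =>
    rw [mul₂, eval₂_add₂, eval₂_map_mul, eval₂_cons, eval₂_cons, ih]; simp [eval]; ring

theorem eval₂_map_atom (x y : K) (l : List (List ℤ)) :
    eval₂ x y (l.map atom) = evalCoeffs₂ l x y := by
  induction l with
  | nil => rfl
  | cons a l ih => rw [List.map_cons, eval₂_cons, ih]; rfl

theorem eval₂_eq_zero {k m n : ℕ} {t : List ℤ} {l : List PolyExpr}
    (h : l.all (isZeroMod k m n t) = true) {x : K} (hx : x ^ n + evalCoeffs t x = 0) (y : K) :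
    eval₂ x y l = 0 := by
  induction l with
  | nil => rfl
  | cons a l ih =>
    simp only [List.all_cons, Bool.and_eq_true] at h
    rw [eval₂_cons, eval_eq_zero h.1 hx, ih h.2]; simp

end
end PolyExpr

namespace CoeffList
section
variable {K : Type*} [CommRing K]

/-- `a(x) b(y)` as a polynomial in two variables. -/
def prod₂ (a b : List ℤ) : List (List ℤ) := b.map fun c => smul c a

theorem eval₂_prod₂ (a b : List ℤ) (x y : K) :
    evalCoeffs₂ (prod₂ a b) x y = evalCoeffs a x * evalCoeffs b y := by
  induction b with
  | nil => simp [prod₂, evalCoeffs₂]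
  | cons c b ih =>
    have : prod₂ a (c :: b) = smul c a :: prod₂ a b := rfl
    rw [this, eval₂_cons, ih, eval_smul, eval_cons]; ring

end
end CoeffList

section
open CoeffList
variable {K : Type*} [CommRing K]

theorem map_eval₂ {L : Type*} [CommRing L] (φ : K →+* L) (l : List (List ℤ)) (x y : K) :
    φ (evalCoeffs₂ l x y) = evalCoeffs₂ l (φ x) (φ y) := by
  induction l with
  | nil => simp [evalCoeffs₂]
  | cons a as ih => simp [CoeffList.eval₂_cons, ih, CoeffList.map_eval]

/-- The form whose vanishing defines adjacency of roots of `g`. -/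
def adjForm (y z : K) : K :=
  y * evalCoeffs₂ evenPart (y ^ 2) (z ^ 2) + z * evalCoeffs₂ oddPart (y ^ 2) (z ^ 2)

/-- Vanishes if `x` and `z` lie over different square roots of `-11`. -/
def crossForm (x z : K) : K :=
  evalCoeffs bCoeffs x * evalCoeffs aCoeffs z + evalCoeffs aCoeffs x * evalCoeffs bCoeffs z

/-- Vanishes if `x` and `z` lie over the same square root of `-11`. -/
def sameForm (x z : K) : K :=
  evalCoeffs bCoeffs x * evalCoeffs aCoeffs z - evalCoeffs aCoeffs x * evalCoeffs bCoeffs z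

theorem map_adjForm {L : Type*} [CommRing L] (φ : K →+* L) (y z : K) :
    φ (adjForm y z) = adjForm (φ y) (φ z) := by
  simp [adjForm, map_eval₂]

theorem map_sameForm {L : Type*} [CommRing L] (φ : K →+* L) (y z : K) :
    φ (sameForm y z) = sameForm (φ y) (φ z) := by
  simp [sameForm, CoeffList.map_eval]

theorem adjForm_norm {y z : K} (hy : (y ^ 2) ^ 24 + evalCoeffs fTail (y ^ 2) = 0) :
    2 * (adjForm y z * adjForm y (-z)) =
      evalCoeffs kappaCoeffs (y ^ 2) * crossForm (y ^ 2) (z ^ 2) := by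
  have h1 : (PolyExpr.add₂ (PolyExpr.add₂
      ((PolyExpr.mul₂ (evenPart.map .atom) (evenPart.map .atom)).map (.mul (.atom [0, 2])))
      (.atom [] :: (PolyExpr.mul₂ (oddPart.map .atom) (oddPart.map .atom)).map (.mul (.atom [-2]))))
      ((PolyExpr.add₂ ((prod₂ bCoeffs aCoeffs).map .atom) ((prod₂ aCoeffs bCoeffs).map .atom)).map
        (.mul (.atom (smul (-1) kappaCoeffs))))).all
      (PolyExpr.isZeroMod 400 50 24 fTail) = true := by decide +kernel
  have h2 := PolyExpr.eval₂_eq_zero h1 hy (z ^ 2)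
  simp only [PolyExpr.eval₂_add₂, PolyExpr.eval₂_mul₂, PolyExpr.eval₂_map_mul,
    PolyExpr.eval₂_map_atom, PolyExpr.eval₂_cons, eval₂_prod₂, PolyExpr.eval, CoeffList.eval_nil,
    CoeffList.eval_cons, CoeffList.eval_smul] at h2
  push_cast at h2
  simp only [adjForm, crossForm, neg_sq]
  linear_combination h2

theorem sq_add_eleven_mul_sq {x : K} (hx : x ^ 24 + evalCoeffs fTail x = 0) :
    evalCoeffs aCoeffs x ^ 2 + 11 * evalCoeffs bCoeffs x ^ 2 = 0 := by
  have h1 : isZero (add (mulMod 0 24 fTail aCoeffs aCoeffs)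
      (smul 11 (mulMod 0 24 fTail bCoeffs bCoeffs))) = true := by decide +kernel
  have h2 := eval_eq_zero_of_isZero h1 x
  simp only [CoeffList.eval_add, CoeffList.eval_smul, eval_mulMod (by simp : ((0 : ℤ) : K) = 0) hx] at h2
  push_cast at h2
  linear_combination h2

theorem crossForm_mul_sameForm {x z : K} (hx : x ^ 24 + evalCoeffs fTail x = 0)
    (hz : z ^ 24 + evalCoeffs fTail z = 0) : crossForm x z * sameForm x z = 0 := by
  have h1 := sq_add_eleven_mul_sq hx
  have h2 := sq_add_eleven_mul_sq hz
  simp only [crossForm, sameForm]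
  linear_combination evalCoeffs bCoeffs x ^ 2 * h2 - evalCoeffs bCoeffs z ^ 2 * h1

/-- The tail of `f(X ^ 2)`. -/
theorem evalCoeffs_gTail (y : K) : evalCoeffs gTail y = evalCoeffs fTail (y ^ 2) := by
  simp only [gTail, fTail, eval_cons, eval_nil]
  push_cast
  ring

theorem g_root_iff (y : K) : y ^ 48 + evalCoeffs gTail y = 0 ↔
    (y ^ 2) ^ 24 + evalCoeffs fTail (y ^ 2) = 0 := by
  rw [evalCoeffs_gTail, ← pow_mul]

end

/-- Integer evaluation modulo `N`. -/
def CoeffList.evalMod (N : ℤ) (l : List ℤ) (x : ℤ) : ℤ := l.foldr (fun c r => (c + x * r) % N) 0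

theorem CoeffList.intCast_evalMod {k : Type*} [CommRing k] {N : ℤ} (hN : (N : k) = 0)
    (l : List ℤ) (x : ℤ) : ((CoeffList.evalMod N l x : ℤ) : k) = evalCoeffs l (x : k) := by
  have hmod : ∀ a : ℤ, ((a % N : ℤ) : k) = (a : k) := fun a => by
    have := congrArg (fun z : ℤ => (z : k)) (Int.emod_add_mul_ediv a N)
    simpa [hN] using this
  induction l with
  | nil => simp [evalMod]
  | cons c l ih =>
    have : evalMod N (c :: l) x = (c + x * evalMod N l x) % N := rfl
    rw [this, hmod, eval_cons, ← ih]; push_cast; rfl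

def auxPrime : ℕ := 1270747

theorem auxPrime_prime : auxPrime.Prime := by norm_num [auxPrime]

/-- The roots of `g` modulo `auxPrime`. -/
def rootMod (i : Fin 48) : ℤ := rootsMod.getD i 0

/-- Adjacency of roots of `g`. -/
def adj (i j : Fin 48) : Bool := (adjTable.getD i 0).testBit j

namespace RootCheck

def gcdOne (a : ℤ) : Bool := Nat.gcd a.natAbs auxPrime == 1

def adjRow (i : Fin 48) : Bool :=
  let x := rootMod i * rootMod i % auxPrime
  let e := evenPart.map fun l => CoeffList.evalMod auxPrime l x
  let o := oddPart.map fun l => CoeffList.evalMod auxPrime l x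
  (List.finRange 48).all fun j => adj i j ||
    gcdOne (rootMod i * CoeffList.evalMod auxPrime e (rootMod j * rootMod j % auxPrime) +
      rootMod j * CoeffList.evalMod auxPrime o (rootMod j * rootMod j % auxPrime))

def sameTable (i j : Fin 48) : Bool :=
  !adj i j || (!adj i (j + 24) &&
    gcdOne (CoeffList.evalMod auxPrime bCoeffs (rootMod i * rootMod i % auxPrime) *
        CoeffList.evalMod auxPrime aCoeffs (rootMod j * rootMod j % auxPrime) -
      CoeffList.evalMod auxPrime aCoeffs (rootMod i * rootMod i % auxPrime) *
        CoeffList.evalMod auxPrime bCoeffs (rootMod j * rootMod j % auxPrime)))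

theorem roots_check : ∀ i : Fin 48, (auxPrime : ℤ) ∣
    rootMod i ^ 48 + CoeffList.evalMod auxPrime gTail (rootMod i) := by decide +kernel

theorem neg_check : ∀ i : Fin 48, (auxPrime : ℤ) ∣ rootMod i + rootMod (i + 24) := by
  decide +kernel

theorem distinct_check : ∀ i j : Fin 48, i ≠ j → gcdOne (rootMod i - rootMod j) = true := by
  decide +kernel

theorem adj_check : ∀ i : Fin 48, adjRow i = true := by decide +kernel

theorem same_check : ∀ i j : Fin 48, sameTable i j = true := by decide +kernel

end RootCheck

section
variable {k : Type*} [Field k]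

theorem RootCheck.intCast_ne_zero (hp : ((auxPrime : ℤ) : k) = 0) {a : ℤ}
    (h : RootCheck.gcdOne a = true) : (a : k) ≠ 0 :=
  intCast_ne_zero_of_isCoprime hp (by simpa [RootCheck.gcdOne, Int.gcd] using h)

theorem intCast_eq_zero_of_dvd' {N a : ℤ} (hp : (N : k) = 0) (h : N ∣ a) : (a : k) = 0 := by
  obtain ⟨b, rfl⟩ := h
  simp [hp]

theorem intCast_emod {N : ℤ} (hN : (N : k) = 0) (a : ℤ) : ((a % N : ℤ) : k) = a := by
  have := congrArg (fun z : ℤ => (z : k)) (Int.emod_add_mul_ediv a N)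
  simpa [hN] using this

theorem rootMod_root (hp : ((auxPrime : ℤ) : k) = 0) (i : Fin 48) :
    (rootMod i : k) ^ 48 + evalCoeffs gTail (rootMod i : k) = 0 := by
  have := intCast_eq_zero_of_dvd' (k := k) hp (RootCheck.roots_check i)
  push_cast at this
  rwa [CoeffList.intCast_evalMod hp] at this

theorem evalCoeffs₂_map_evalMod {N : ℤ} (hN : (N : k) = 0) (l : List (List ℤ)) (x y : ℤ) :
    evalCoeffs (l.map fun c => CoeffList.evalMod N c x) (y : k) = evalCoeffs₂ l (x : k) y := by
  induction l with
  | nil => simp [evalCoeffs₂]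
  | cons a l ih =>
    rw [List.map_cons, CoeffList.eval_cons, CoeffList.eval₂_cons, ih,
      CoeffList.intCast_evalMod hN]

theorem adj_of_adjForm (hp : ((auxPrime : ℤ) : k) = 0) {i j : Fin 48}
    (h : adjForm (rootMod i : k) (rootMod j) = 0) : adj i j = true := by
  have h1 := RootCheck.adj_check i
  simp only [RootCheck.adjRow, List.all_eq_true, Bool.or_eq_true] at h1
  refine (h1 j (List.mem_finRange j)).resolve_right fun h2 => RootCheck.intCast_ne_zero hp h2 ?_
  push_cast
  rw [CoeffList.intCast_evalMod hp, CoeffList.intCast_evalMod hp, evalCoeffs₂_map_evalMod hp,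
    evalCoeffs₂_map_evalMod hp, intCast_emod hp, intCast_emod hp]
  push_cast
  simpa only [adjForm, sq] using h

theorem sameForm_rootMod_ne_zero (hp : ((auxPrime : ℤ) : k) = 0) {i j : Fin 48}
    (h : adj i j = true) : sameForm ((rootMod i : k) ^ 2) ((rootMod j : k) ^ 2) ≠ 0 := by
  have h1 := RootCheck.same_check i j
  simp only [RootCheck.sameTable, h, Bool.not_true, Bool.false_or, Bool.and_eq_true] at h1
  have h2 := RootCheck.intCast_ne_zero hp h1.2
  push_cast at h2
  simp only [CoeffList.intCast_evalMod hp, intCast_emod hp] at h2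
  push_cast at h2
  simp only [sameForm, sq]
  exact h2

end

theorem not_adj_add {i j : Fin 48} (h : adj i j = true) : adj i (j + 24) = false := by
  have h1 := RootCheck.same_check i j
  simp only [RootCheck.sameTable, h, Bool.not_true, Bool.false_or, Bool.and_eq_true] at h1
  simpa using h1.1

/-- A labelling of the roots of `g` compatible with the adjacency table. -/
structure RootLabelling (R : Type*) [CommRing R] where
  root : Fin 48 → R
  injective : Function.Injective root
  isRoot : ∀ i, root i ^ 48 + evalCoeffs gTail (root i) = 0
  surjective : ∀ z : R, z ^ 48 + evalCoeffs gTail z = 0 → ∃ i, root i = z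
  neg_root : ∀ i, -root i = root (i + 24)
  adj_iff : ∀ i j, adjForm (root i) (root j) = 0 ↔ adj i j = true
  sameForm_ne_zero : ∀ i j, adj i j = true → sameForm (root i ^ 2) (root j ^ 2) ≠ 0

theorem exists_rootLabelling {E : Type} [Field E] [NumberField E] [IsGalois ℚ E]
    (h : ((monicPoly ℚ 48 gTail).map (algebraMap ℚ E)).Splits) :
    Nonempty (RootLabelling (𝓞 E)) := by
  have : Fact auxPrime.Prime := ⟨auxPrime_prime⟩
  obtain ⟨k, _, π, -, hp, -⟩ := exists_frobenius E auxPrime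
  choose r hr hπ using fun i => exists_root_of_map_root (n := 48) (t := gTail) (E := E)
    (by decide) h π (rootMod_root hp i)
  have hdist : ∀ i j, π (r i) = π (r j) → i = j := fun i j hij => by
    by_contra hne
    refine RootCheck.intCast_ne_zero hp (RootCheck.distinct_check i j hne) ?_
    push_cast
    rw [← hπ, ← hπ, hij, sub_self]
  have hinj : Function.Injective r := fun i j hij => hdist i j (by rw [hij])
  have hsurj : ∀ z : 𝓞 E, z ^ 48 + evalCoeffs gTail z = 0 → ∃ i, r i = z := by
    classical
    intro z hz
    by_contra! hne
    have := card_le_of_forall_root (n := 48) (t := gTail) (by decide)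
      (insert z (Finset.univ.image r)) (by
        intro x hx
        simp only [Finset.mem_insert, Finset.mem_image, Finset.mem_univ, true_and] at hx
        obtain rfl | ⟨i, rfl⟩ := hx
        exacts [hz, hr i])
    rw [Finset.card_insert_of_notMem (by simpa using hne), Finset.card_image_of_injective _ hinj]
      at this
    simp at this
  have hneg : ∀ i, -r i = r (i + 24) := fun i => by
    obtain ⟨j, hj⟩ := hsurj (-r i) (by rw [g_root_iff, neg_sq, ← g_root_iff]; exact hr i)
    rw [← hj]
    congr 1
    apply hdist
    rw [hj, map_neg, hπ, hπ]
    have := intCast_eq_zero_of_dvd' hp (RootCheck.neg_check i)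
    push_cast at this
    linear_combination -this
  have hadj : ∀ i j, adjForm (r i) (r j) = 0 → adj i j = true := fun i j hij => by
    have := congrArg π hij
    rw [map_adjForm, hπ, hπ, map_zero] at this
    exact adj_of_adjForm hp this
  have hsame : ∀ i j, adj i j = true → sameForm (r i ^ 2) (r j ^ 2) ≠ 0 := fun i j hT h0 => by
    have := congrArg π h0
    rw [map_sameForm, map_pow, map_pow, hπ, hπ, map_zero] at this
    exact sameForm_rootMod_ne_zero hp hT this
  refine ⟨⟨r, hinj, hr, hsurj, hneg, fun i j => ⟨hadj i j, fun hT => ?_⟩, hsame⟩⟩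
  have hs := hsame i j hT
  have hc : crossForm (r i ^ 2) (r j ^ 2) = 0 :=
    (mul_eq_zero.mp (crossForm_mul_sameForm ((g_root_iff _).mp (hr i))
      ((g_root_iff _).mp (hr j)))).resolve_right hs
  have h2 := adjForm_norm (z := r j) ((g_root_iff _).mp (hr i))
  rw [hc, mul_zero] at h2
  refine (mul_eq_zero.mp ((mul_eq_zero.mp h2).resolve_left two_ne_zero)).resolve_right fun h3 => ?_
  rw [hneg] at h3
  have := hadj _ _ h3
  rw [not_adj_add hT] at this
  exact Bool.false_ne_true this

/-- The relation between two roots of `g` given by their labels. -/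
def rootColor (i j : Fin 48) : Fin 5 :=
  if i = j then 0 else if j = i + 24 then 1 else if adj i j then 2 else
    if adj i (j + 24) then 3 else 4

theorem chainProd_rootColor : chainProd rootColor [] [0, 1, 2, 8, 3, 22, 46, 4, 7, 14, 16, 31, 38,
    40, 9, 10, 12, 20, 21, 23, 33, 34, 36, 44, 45, 47, 5, 11, 13, 15, 17, 18, 29, 35, 37, 39, 41,
    42, 6, 19, 30, 43, 24, 25, 26, 27, 28, 32] = 380160 := by
  decide +kernel

namespace RootLabelling
variable {R G : Type*} [CommRing R] [Group G] [MulSemiringAction G R]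

theorem exists_smul_root (L : RootLabelling R) (σ : G) (i : Fin 48) :
    ∃ j, L.root j = σ • L.root i := by
  refine L.surjective _ ?_
  have := congrArg (MulSemiringAction.toRingHom G R σ) (L.isRoot i)
  rw [map_add, CoeffList.map_eval, map_pow, map_zero] at this
  exact this

/-- The action on labels. -/
noncomputable def labelAction (L : RootLabelling R) : G →* Equiv.Perm (Fin 48) :=
  letI : MulAction G (Fin 48) :=
    { smul := fun σ i => (L.exists_smul_root σ i).choose
      one_smul := fun i => L.injective
        ((L.exists_smul_root (1 : G) i).choose_spec.trans (one_smul _ _))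
      mul_smul := fun σ τ i => L.injective (by
        refine (L.exists_smul_root (σ * τ) i).choose_spec.trans ?_
        refine Eq.trans ?_ (L.exists_smul_root σ _).choose_spec.symm
        rw [mul_smul]
        exact congrArg (σ • ·) (L.exists_smul_root τ i).choose_spec.symm) }
  MulAction.toPermHom G (Fin 48)

theorem root_labelAction (L : RootLabelling R) (σ : G) (i : Fin 48) :
    L.root (L.labelAction σ i) = σ • L.root i :=
  (L.exists_smul_root σ i).choose_spec

theorem rootColor_labelAction (L : RootLabelling R) (σ : G) (i j : Fin 48) :
    rootColor (L.labelAction σ i) (L.labelAction σ j) = rootColor i j := by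
  have hadd : ∀ i, L.labelAction σ i + 24 = L.labelAction σ (i + 24) := fun i => L.injective (by
    rw [← L.neg_root, L.root_labelAction, L.root_labelAction, ← L.neg_root, smul_neg])
  have hadj : ∀ i j, adj (L.labelAction σ i) (L.labelAction σ j) = adj i j := fun i j => by
    rw [Bool.eq_iff_iff, ← L.adj_iff, ← L.adj_iff, L.root_labelAction, L.root_labelAction]
    have := map_adjForm (MulSemiringAction.toRingHom G R σ) (L.root i) (L.root j)
    simp only [MulSemiringAction.toRingHom_apply] at this
    rw [← this, smul_eq_zero_iff_eq]
  simp only [rootColor, hadd, hadj, (L.labelAction σ).injective.eq_iff]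

theorem card_le (L : RootLabelling R)
    (h : ∀ σ : G, (∀ i, σ • L.root i = L.root i) → σ = 1) : Nat.card G ≤ 380160 := by
  have hinj : Function.Injective (L.labelAction (G := G)) := by
    rw [injective_iff_map_eq_one]
    intro σ hσ
    refine h σ fun i => ?_
    rw [← L.root_labelAction, hσ, Equiv.Perm.one_apply]
  rw [Nat.card_congr (MonoidHom.ofInjective hinj).toEquiv, ← chainProd_rootColor]
  refine card_le_chainProd rootColor _ [] _ ?_ (by simp) (by decide)
  rintro _ ⟨σ, rfl⟩ i j
  exact L.rootColor_labelAction σ i j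

end RootLabelling

section
set_option linter.unusedSectionVars false

namespace CoeffList
section
variable {K : Type*} [CommRing K]

/-- Check that `z ^ e + c(z)` vanishes at the roots `z` of `X ^ n + t` modulo `N`. -/
def powCheck (N : ℤ) (n : ℕ) (t : List ℤ) (e : ℕ) (c : List ℤ) : Bool :=
  isZero (rem N n t (add (powMod N n t [0, 1] (e.log2 + 1) e) c))

/-- Check that `U` is the inverse of `X ^ e + c` modulo `X ^ n + t` and `N`. -/
def powUnitCheck (N : ℤ) (n : ℕ) (t : List ℤ) (e : ℕ) (c U : List ℤ) : Bool :=
  isZero (rem N n t (add (mul U (add (powMod N n t [0, 1] (e.log2 + 1) e) c)) [-1]))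

theorem pow_add_eq_zero {N : ℤ} {n : ℕ} {t : List ℤ} {e : ℕ} {c : List ℤ}
    (h : powCheck N n t e c = true) (hN : (N : K) = 0) {z : K} (hz : z ^ n + evalCoeffs t z = 0) :
    z ^ e + evalCoeffs c z = 0 := by
  have := eval_eq_zero_of_isZero h z
  rw [eval_rem hN hz, eval_add, eval_powMod hN hz _ Nat.lt_log2_self] at this
  simpa using this

theorem pow_add_ne_zero [Nontrivial K] {N : ℤ} {n : ℕ} {t : List ℤ} {e : ℕ} {c U : List ℤ}
    (h : powUnitCheck N n t e c U = true) (hN : (N : K) = 0) {z : K}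
    (hz : z ^ n + evalCoeffs t z = 0) : z ^ e + evalCoeffs c z ≠ 0 := by
  intro h0
  have := eval_eq_zero_of_isZero h z
  rw [eval_rem hN hz, eval_add, eval_mul, eval_add, eval_powMod hN hz _ Nat.lt_log2_self] at this
  simp [h0] at this

/-- Check that the product of the monic polynomials with tails `tL` and `tM` is `c` modulo `N`. -/
def prodCheck (N : ℤ) (tL tM c : List ℤ) : Bool :=
  isZero (red N (add (mul (tL ++ [1]) (tM ++ [1])) (smul (-1) c)))

theorem mul_eq_of_prodCheck {N : ℤ} {tL tM c : List ℤ} (h : prodCheck N tL tM c = true)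
    (hN : (N : K) = 0) (z : K) :
    (z ^ tL.length + evalCoeffs tL z) * (z ^ tM.length + evalCoeffs tM z) = evalCoeffs c z := by
  have := eval_eq_zero_of_isZero h z
  rw [eval_red hN, eval_add, eval_mul, eval_smul, evalCoeffs_append, evalCoeffs_append] at this
  simp only [eval_cons, eval_nil] at this
  push_cast at this
  linear_combination this

end
end CoeffList

theorem natDegree_evalCoeffs_le {R : Type*} [CommRing R] {l : List ℤ} {n : ℕ}
    (h : l.length ≤ n + 1) : (evalCoeffs l (X : R[X])).natDegree ≤ n :=
  natDegree_le_iff_coeff_eq_zero.mpr fun _ hN => coeff_eq_zero_of_degree_lt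
    ((degree_evalCoeffs_lt l).trans_le (by exact_mod_cast h.trans hN))

namespace RootLabelling
variable {R : Type*} [CommRing R] [IsDomain R] [CharZero R]

open Classical in
/-- The roots of `f`. -/
noncomputable def squares (L : RootLabelling R) : Finset R :=
  Finset.univ.image fun i => L.root i ^ 2

open Classical in
/-- The roots of `f` lying over the square root `s` of `-11`. -/
noncomputable def half (L : RootLabelling R) (s : R) : Finset R :=
  L.squares.filter fun x => evalCoeffs aCoeffs x + s * evalCoeffs bCoeffs x = 0

theorem mem_squares {L : RootLabelling R} {x : R} :
    x ∈ L.squares ↔ ∃ i, L.root i ^ 2 = x := by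
  simp [squares]

theorem mem_half {L : RootLabelling R} {s x : R} :
    x ∈ L.half s ↔ x ∈ L.squares ∧ evalCoeffs aCoeffs x + s * evalCoeffs bCoeffs x = 0 := by
  simp [half]

theorem root_sq_mem (L : RootLabelling R) (i : Fin 48) : L.root i ^ 2 ∈ L.squares := by
  simp [squares]

theorem isRoot_of_mem (L : RootLabelling R) {x : R} (hx : x ∈ L.squares) :
    x ^ 24 + evalCoeffs fTail x = 0 := by
  obtain ⟨i, rfl⟩ := mem_squares.mp hx
  exact (g_root_iff _).mp (L.isRoot i)

theorem le_card_squares (L : RootLabelling R) : 24 ≤ L.squares.card := by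
  classical
  let e : Fin 24 → R := fun i => L.root (Fin.castLE (by norm_num) i) ^ 2
  have he : Function.Injective e := fun i j hij => by
    obtain h | h := sq_eq_sq_iff_eq_or_eq_neg.mp hij
    · simpa using L.injective h
    · rw [L.neg_root] at h
      have := congrArg Fin.val (L.injective h)
      have hi := i.2
      have hj := j.2
      simp only [Fin.val_castLE, Fin.val_add] at this
      change (i : ℕ) = (j + 24) % 48 at this
      omega
  calc 24 = (Finset.univ.image e).card := by
        rw [Finset.card_image_of_injective _ he, Finset.card_univ, Fintype.card_fin]
    _ ≤ _ := Finset.card_le_card fun x hx => by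
        obtain ⟨i, -, rfl⟩ := Finset.mem_image.mp hx
        exact L.root_sq_mem _

theorem bCoeffs_ne_zero (L : RootLabelling R) [NoZeroDivisors R] {x : R} (hx : x ∈ L.squares) :
    evalCoeffs bCoeffs x ≠ 0 := by
  have h1 : ∀ i : Fin 48, ∃ j, adj i j = true := by decide +kernel
  obtain ⟨i, rfl⟩ := mem_squares.mp hx
  obtain ⟨j, hj⟩ := h1 i
  intro h0
  have h2 := sq_add_eleven_mul_sq ((g_root_iff _).mp (L.isRoot i))
  rw [h0] at h2
  have h3 : evalCoeffs aCoeffs (L.root i ^ 2) = 0 := by simpa using h2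
  exact L.sameForm_ne_zero i j hj (by simp [sameForm, h0, h3])

theorem aCoeffs_add_bCoeffs_ne_zero {s : R} (hs : s ^ 2 = -11) :
    evalCoeffs aCoeffs (0 : R) + s * evalCoeffs bCoeffs 0 ≠ 0 := fun h1 => by
  rw [aCoeffs, bCoeffs, CoeffList.eval_cons, zero_mul, CoeffList.eval_cons, zero_mul, add_zero,
    add_zero] at h1
  push_cast at h1
  have h2 : ((1243 ^ 2 + 11 * 385 ^ 2 : ℕ) : R) = 0 := by
    push_cast
    linear_combination (1243 - s * 385) * h1 + 385 ^ 2 * hs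
  exact absurd (Nat.cast_eq_zero.mp h2) (by norm_num)

theorem card_half_le {s : R} (hs : s ^ 2 = -11) (L : RootLabelling R) : (L.half s).card ≤ 12 := by
  obtain ⟨P, hP⟩ : ∃ P : R[X], P = evalCoeffs aCoeffs X + C s * evalCoeffs bCoeffs X := ⟨_, rfl⟩
  have hPx : ∀ x, P.eval x = evalCoeffs aCoeffs x + s * evalCoeffs bCoeffs x := fun x => by
    rw [hP, eval_add, eval_mul, eval_C, eval_evalCoeffs_X, eval_evalCoeffs_X]
  have hP0 : P ≠ 0 := fun h0 => aCoeffs_add_bCoeffs_ne_zero hs (by rw [← hPx, h0, eval_zero])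
  have hdeg : P.natDegree ≤ 12 := by
    rw [hP]
    exact natDegree_add_le_of_degree_le (natDegree_evalCoeffs_le (by decide))
      ((natDegree_C_mul_le _ _).trans (natDegree_evalCoeffs_le (by decide)))
  refine (card_le_degree_of_subset_roots fun x hx => ?_).trans hdeg
  rw [mem_roots hP0, IsRoot, hPx]
  exact (mem_half.mp (Finset.mem_val.mp hx)).2

theorem mem_half_or {s : R} (hs : s ^ 2 = -11) (L : RootLabelling R) {x : R}
    (hx : x ∈ L.squares) : x ∈ L.half s ∨ x ∈ L.half (-s) := by
  have h1 := sq_add_eleven_mul_sq (L.isRoot_of_mem hx)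
  have h2 : (evalCoeffs aCoeffs x + s * evalCoeffs bCoeffs x) *
      (evalCoeffs aCoeffs x + -s * evalCoeffs bCoeffs x) = 0 := by
    linear_combination h1 - evalCoeffs bCoeffs x ^ 2 * hs
  obtain h | h := mul_eq_zero.mp h2
  · exact Or.inl (mem_half.mpr ⟨hx, h⟩)
  · exact Or.inr (mem_half.mpr ⟨hx, h⟩)

theorem card_half {s : R} (hs : s ^ 2 = -11) (L : RootLabelling R) : (L.half s).card = 12 := by
  classical
  have h1 := card_half_le hs L
  have h2 := card_half_le (s := -s) (by rwa [neg_sq]) L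
  have h3 : L.squares.card ≤ (L.half s ∪ L.half (-s)).card := Finset.card_le_card fun x hx =>
    Finset.mem_union.mpr (mem_half_or hs L hx)
  have h4 := Finset.card_union_le (L.half s) (L.half (-s))
  have h5 := L.le_card_squares
  omega

section
variable {G : Type*} [Group G] [MulSemiringAction G R]

theorem smul_mem_squares (L : RootLabelling R) (σ : G) {x : R} (hx : x ∈ L.squares) :
    σ • x ∈ L.squares := by
  obtain ⟨i, rfl⟩ := mem_squares.mp hx
  rw [smul_pow', ← L.root_labelAction]
  exact L.root_sq_mem _

theorem smul_mem_half (L : RootLabelling R) (σ : G) {s x : R} (hx : x ∈ L.half s) :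
    σ • x ∈ L.half (σ • s) := by
  obtain ⟨h1, h2⟩ := mem_half.mp hx
  refine mem_half.mpr ⟨L.smul_mem_squares σ h1, ?_⟩
  have := congrArg (MulSemiringAction.toRingHom G R σ) h2
  rw [map_add, map_mul, CoeffList.map_eval, CoeffList.map_eval, map_zero] at this
  exact this

end
end RootLabelling

end

section
open CoeffList
set_option linter.unusedSectionVars false

theorem map_pow_smul_eq {R G k : Type*} [CommRing R] [Group G] [MulSemiringAction G R] [Field k]
    {π : R →+* k} {ℓ : ℕ} {σ : G} (hσ : ∀ r : R, π (σ • r) = π r ^ ℓ) (m : ℕ) (r : R) :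
    π (σ ^ m • r) = π r ^ ℓ ^ m := by
  induction m with
  | zero => simp
  | succ m ih => rw [pow_succ', mul_smul, hσ, ih, ← pow_mul, ← pow_succ]

theorem card_le_of_map_root {R k : Type*} [CommRing R] [Field k] {π : R →+* k} {T S : Finset R}
    (hπ : Set.InjOn π T) (hS : S ⊆ T) {t : List ℤ}
    (h : ∀ x ∈ S, π x ^ t.length + evalCoeffs t (π x) = 0) : S.card ≤ t.length := by
  classical
  rw [← Finset.card_image_of_injOn (hπ.mono (Finset.coe_subset.mpr hS))]
  refine card_le_of_forall_root le_rfl _ fun z hz => ?_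
  obtain ⟨x, hx, rfl⟩ := Finset.mem_image.mp hz
  exact h x hx

/-- Data certifying the cycle type of the `m`-th power of a Frobenius element at `ℓ` on the
roots of `f` over the square root of `-11` that reduces to `s`. -/
structure FrobCert where
  ℓ : ℕ
  s : ℤ
  m : ℕ
  q : ℕ
  j : ℕ
  fixTail : List ℤ
  movTail : List ℤ
  inv : List ℤ
  sepInv : List ℤ

namespace FrobCert

def check (C : FrobCert) : Bool :=
  prodCheck C.ℓ C.fixTail C.movTail
    (smul ((C.ℓ + 1) / 2 : ℕ) (add aCoeffs (smul C.s bCoeffs))) &&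
  powCheck C.ℓ C.fixTail.length C.fixTail (C.ℓ ^ C.m) [0, -1] &&
  powCheck C.ℓ C.movTail.length C.movTail ((C.ℓ ^ C.m) ^ C.q ^ (C.j + 1)) [0, -1] &&
  powUnitCheck C.ℓ C.movTail.length C.movTail ((C.ℓ ^ C.m) ^ C.q ^ C.j) [0, -1] C.inv &&
  isZero (add (mulMod C.ℓ 24 fTail C.sepInv (derivMonic 24 fTail)) [-1]) &&
  (C.s ^ 2 + 11) % C.ℓ == 0 && Int.gcd (2 * C.s) C.ℓ == 1 && C.fixTail.length + C.movTail.length == 12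

theorem injOn_squares {C : FrobCert} (hC : C.check = true) {E : Type} [Field E] [NumberField E]
    (L : RootLabelling (𝓞 E)) {k : Type*} [Field k] {π : 𝓞 E →+* k} (hℓ : ((C.ℓ : ℤ) : k) = 0) :
    Set.InjOn π (L.squares : Set (𝓞 E)) := by
  simp only [check, Bool.and_eq_true] at hC
  intro x hx x' hx' h
  have hr := L.isRoot_of_mem hx
  refine eq_of_map_eq π hr (L.isRoot_of_mem hx') (fun h0 => ?_) h
  rw [derivative_monicPoly, eval_evalCoeffs_X] at h0
  have hπ : π x ^ 24 + evalCoeffs fTail (π x) = 0 := by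
    rw [← CoeffList.map_eval, ← map_pow, ← map_add, hr, map_zero]
  have := eval_eq_zero_of_isZero hC.1.1.1.2 (π x)
  rw [CoeffList.eval_add, eval_mulMod hℓ hπ, h0] at this
  simp at this

section
variable {C : FrobCert} {E : Type} [Field E] [NumberField E] (L : RootLabelling (𝓞 E))
  {k : Type*} [Field k] {π : 𝓞 E →+* k} {s : 𝓞 E}

theorem map_root_or (hC : C.check = true) (hℓ : ((C.ℓ : ℤ) : k) = 0) (hπs : π s = C.s) {x : 𝓞 E}
    (hx : x ∈ L.half s) :
    π x ^ C.fixTail.length + evalCoeffs C.fixTail (π x) = 0 ∨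
      π x ^ C.movTail.length + evalCoeffs C.movTail (π x) = 0 := by
  simp only [check, Bool.and_eq_true] at hC
  have h1 := congrArg π (RootLabelling.mem_half.mp hx).2
  rw [map_add, map_mul, CoeffList.map_eval, CoeffList.map_eval, map_zero, hπs] at h1
  have h2 := mul_eq_of_prodCheck hC.1.1.1.1.1.1.1 hℓ (π x)
  rw [CoeffList.eval_smul, CoeffList.eval_add, CoeffList.eval_smul, h1, mul_zero] at h2
  exact mul_eq_zero.mp h2

theorem smul_eq_of_map_eq {G : Type*} [Group G] [MulSemiringAction G (𝓞 E)]
    (hC : C.check = true) (hℓ : ((C.ℓ : ℤ) : k) = 0) (hs : s ^ 2 = -11) (hπs : π s = C.s)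
    {σ : G} (hσ : ∀ r : 𝓞 E, π (σ • r) = π r ^ C.ℓ) (hpr : C.ℓ.Prime) : σ • s = s := by
  simp only [check, Bool.and_eq_true, beq_iff_eq] at hC
  have h1 : (σ • s) ^ 2 = s ^ 2 := by
    have := map_intCast (MulSemiringAction.toRingHom G (𝓞 E) σ) (-11)
    rw [← smul_pow', hs]
    simpa using this
  refine (sq_eq_sq_iff_eq_or_eq_neg.mp h1).resolve_right fun h2 => ?_
  have h3 := hσ s
  have : Fact C.ℓ.Prime := ⟨hpr⟩
  have : CharP k C.ℓ := (CharP.charP_iff_prime_eq_zero hpr).mpr (by exact_mod_cast hℓ)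
  rw [h2, map_neg, hπs] at h3
  rw [← frobenius_def (p := C.ℓ), map_intCast] at h3
  refine intCast_ne_zero_of_isCoprime hℓ hC.1.2 ?_
  push_cast
  linear_combination -h3

theorem hasType [DecidableEq (𝓞 E)] {G : Type*} [Group G] [MulSemiringAction G (𝓞 E)] (hC : C.check = true)
    (hℓ : ((C.ℓ : ℤ) : k) = 0) (hs : s ^ 2 = -11) (hπs : π s = C.s)
    {σ : G} (hσ : ∀ r : 𝓞 E, π (σ • r) = π r ^ C.ℓ) (hpr : C.ℓ.Prime) (hq : C.q.Prime) :
    HasType (MulAction.stabilizer G s) (L.half s) (σ ^ C.m) (C.q ^ (C.j + 1)) C.fixTail.length := by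
  have hinj := injOn_squares hC L hℓ (π := π)
  have hσs := smul_eq_of_map_eq hC hℓ hs hπs hσ hpr
  have hor := fun {x} => map_root_or (x := x) L hC hℓ hπs
  have hsub : L.half s ⊆ L.squares := fun x hx => (RootLabelling.mem_half.mp hx).1
  have hC' := hC
  simp only [check, Bool.and_eq_true, beq_iff_eq] at hC'
  obtain ⟨⟨⟨⟨⟨⟨⟨-, hfix⟩, hper⟩, hmov⟩, -⟩, -⟩, -⟩, h12⟩ := hC'
  have hpow : ∀ (n : ℕ) (x : 𝓞 E), π ((σ ^ C.m) ^ n • x) = π x ^ (C.ℓ ^ C.m) ^ n := fun n x => by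
    rw [← pow_mul, map_pow_smul_eq hσ, pow_mul]
  have hfixed : ∀ x ∈ L.half s, π x ^ C.fixTail.length + evalCoeffs C.fixTail (π x) = 0 →
      σ ^ C.m • x = x := fun x hx h => by
    refine hinj (L.smul_mem_squares _ (hsub hx)) (hsub hx) ?_
    have := hpow 1 x
    rw [pow_one, pow_one] at this
    rw [this]
    have := pow_add_eq_zero hfix hℓ h
    simp at this
    linear_combination this
  have hperiod : ∀ x ∈ L.half s, π x ^ C.movTail.length + evalCoeffs C.movTail (π x) = 0 →
      Function.minimalPeriod (σ ^ C.m • · : 𝓞 E → 𝓞 E) x = C.q ^ (C.j + 1) := fun x hx h => by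
    have : Fact C.q.Prime := ⟨hq⟩
    refine Function.minimalPeriod_eq_prime_pow ?_ ?_
    · rw [Function.IsPeriodicPt, Function.IsFixedPt, smul_iterate]
      intro h1
      have := hpow (C.q ^ C.j) x
      rw [show (σ ^ C.m) ^ C.q ^ C.j • x = x from h1] at this
      refine pow_add_ne_zero hmov hℓ h ?_
      rw [← this]
      simp
    · rw [Function.IsPeriodicPt, Function.IsFixedPt, smul_iterate]
      refine hinj (L.smul_mem_squares _ (hsub hx)) (hsub hx) ?_
      rw [hpow]
      have := pow_add_eq_zero hper hℓ h
      simp at this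
      linear_combination this
  refine ⟨Subgroup.pow_mem _ (MulAction.mem_stabilizer_iff.mpr hσs) _, ?_, fun x hx =>
    (hor hx).imp (hfixed x hx) (hperiod x hx)⟩
  have hne : ∀ x, σ ^ C.m • x = x →
      Function.minimalPeriod (σ ^ C.m • · : 𝓞 E → 𝓞 E) x ≠ C.q ^ (C.j + 1) := fun x hx h => by
    rw [Function.minimalPeriod_eq_one_iff_isFixedPt.mpr hx] at h
    exact (Nat.one_lt_pow (Nat.succ_ne_zero _) hq.one_lt).ne h
  have h1 : ((L.half s).filter fun x => σ ^ C.m • x = x).card ≤ C.fixTail.length := by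
    refine card_le_of_map_root hinj ((Finset.filter_subset _ _).trans hsub) fun x hx => ?_
    obtain ⟨hx, hx'⟩ := Finset.mem_filter.mp hx
    exact (hor hx).resolve_right fun h => hne x hx' (hperiod x hx h)
  have h2 : ((L.half s).filter fun x => ¬ σ ^ C.m • x = x).card ≤ C.movTail.length := by
    refine card_le_of_map_root hinj ((Finset.filter_subset _ _).trans hsub) fun x hx => ?_
    obtain ⟨hx, hx'⟩ := Finset.mem_filter.mp hx
    exact (hor hx).resolve_left fun h => hx' (hfixed x hx h)
  have h3 := Finset.card_filter_add_card_filter_not (s := L.half s) fun x => σ ^ C.m • x = x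
  rw [L.card_half hs] at h3
  exact le_antisymm h1 (by omega)

end
end FrobCert

namespace FrobCert

def elevenPos : FrobCert where
  ℓ := 47
  s := 6
  m := 1
  q := 11
  j := 0
  fixTail :=
    [4]
  movTail :=
    [27, 34, 7, 10, 40, 37, 8, 45, 45, 24, 43]
  inv :=
    [18, 27, 46, 41, 40, 40, 30, 45, 9, 21, 20]
  sepInv :=
    [24, 10, 39, 15, 41, 10, 24, 28, 13, 26, 31, 30, 2, 33, 46, 30, 21, 7, 4, 32, 3, 7, 19, 20]

def elevenNeg : FrobCert where
  ℓ := 47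
  s := -6
  m := 1
  q := 11
  j := 0
  fixTail :=
    [34]
  movTail :=
    [32, 8, 40, 32, 2, 11, 27, 31, 21, 45, 13]
  inv :=
    [20, 21, 32, 39, 9, 7, 42, 46, 29, 38, 14]
  sepInv :=
    [24, 10, 39, 15, 41, 10, 24, 28, 13, 26, 31, 30, 2, 33, 46, 30, 21, 7, 4, 32, 3, 7, 19, 20]

def fivePos : FrobCert where
  ℓ := 269
  s := 127
  m := 1
  q := 5
  j := 0
  fixTail :=
    [67, 247]
  movTail :=
    [61, 21, 191, 223, 62, 9, 190, 263, 189, 22]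
  inv :=
    [167, 256, 13, 65, 108, 106, 151, 179, 204, 220]
  sepInv :=
    [101, 189, 248, 205, 93, 13, 265, 150, 73, 13, 29, 120, 127, 149, 25, 253, 189, 35, 134,
     15, 15, 152, 77, 91]

def fiveNeg : FrobCert where
  ℓ := 269
  s := -127
  m := 1
  q := 5
  j := 0
  fixTail :=
    [84, 153]
  movTail :=
    [43, 121, 265, 214, 235, 85, 49, 262, 128, 116]
  inv :=
    [206, 65, 53, 45, 179, 31, 213, 249, 136, 28]
  sepInv :=
    [101, 189, 248, 205, 93, 13, 265, 150, 73, 13, 29, 120, 127, 149, 25, 253, 189, 35, 134,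
     15, 15, 152, 77, 91]

def threePos : FrobCert where
  ℓ := 467
  s := 108
  m := 1
  q := 3
  j := 0
  fixTail :=
    [383, 445, 45]
  movTail :=
    [226, 404, 334, 165, 292, 166, 185, 422, 422]
  inv :=
    [32, 185, 391, 220, 346, 385, 54, 107, 256]
  sepInv :=
    [46, 270, 225, 145, 361, 379, 283, 45, 122, 456, 424, 221, 186, 263, 202, 208, 316, 16,
     284, 23, 370, 19, 99, 152]

def threeNeg : FrobCert where
  ℓ := 467
  s := -108
  m := 1
  q := 3
  j := 0
  fixTail :=
    [80, 308, 115]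
  movTail :=
    [247, 384, 11, 249, 38, 21, 40, 43, 352]
  inv :=
    [243, 163, 101, 442, 150, 47, 439, 55, 281]
  sepInv :=
    [46, 270, 225, 145, 361, 379, 283, 45, 122, 456, 424, 221, 186, 263, 202, 208, 316, 16,
     284, 23, 370, 19, 99, 152]

def eight : FrobCert where
  ℓ := 59
  s := 15
  m := 2
  q := 2
  j := 1
  fixTail :=
    [19, 32, 25, 8]
  movTail :=
    [17, 20, 11, 7, 43, 40, 16, 51]
  inv :=
    [54, 0, 7, 30, 34, 41, 50, 52]
  sepInv :=
    [15, 37, 0, 38, 54, 1, 54, 2, 29, 33, 8, 6, 7, 16, 42, 23, 32, 1, 2, 38, 27, 23, 5, 46]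

def posTail : List ℤ :=
  [43, 23]

def negTail : List ℤ :=
  [32, 44]

def otherTail : List ℤ :=
  [35, 39, 14, 0, 36, 0, 50, 0, 51, 0, 1, 0]

def otherInv : List ℤ :=
  [42, 40, 10, 40, 15, 31, 29, 38, 32, 4, 36, 35]

theorem elevenPos_check : elevenPos.check = true := by decide +kernel

theorem elevenNeg_check : elevenNeg.check = true := by decide +kernel

theorem fivePos_check : fivePos.check = true := by decide +kernel

theorem fiveNeg_check : fiveNeg.check = true := by decide +kernel

theorem threePos_check : threePos.check = true := by decide +kernel

theorem threeNeg_check : threeNeg.check = true := by decide +kernel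

theorem eight_check : eight.check = true := by decide +kernel

theorem posTail_check : powCheck 59 2 posTail ((59 ^ 2 - 1) / 2) [-1] = true := by
  decide +kernel

theorem negTail_check : powCheck 59 2 negTail ((59 ^ 2 - 1) / 2) [1] = true := by
  decide +kernel

theorem posTail_negTail_check :
    prodCheck 59 posTail negTail (eight.fixTail ++ [1]) = true := by
  decide +kernel

theorem otherTail_check : prodCheck 59 [] otherTail
    (smul 30 (add aCoeffs (smul (-eight.s) bCoeffs))) = true := by
  decide +kernel

theorem otherInv_check : powUnitCheck 59 12 otherTail 59 [0, -1] otherInv = true := by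
  decide +kernel

end FrobCert

section
variable {E : Type} [Field E] [NumberField E]

theorem exists_sq_eq_neg_eleven (L : RootLabelling (𝓞 E)) : ∃ s : 𝓞 E, s ^ 2 = -11 := by
  have hx := L.root_sq_mem 0
  have h1 := sq_add_eleven_mul_sq (L.isRoot_of_mem hx)
  have h2 := L.bCoeffs_ne_zero hx
  have h3 : (algebraMap (𝓞 E) E) (evalCoeffs bCoeffs (L.root 0 ^ 2)) ≠ 0 := by
    simpa using h2
  have h4 := congrArg (algebraMap (𝓞 E) E) h1
  simp only [map_add, map_mul, map_pow, map_zero, map_ofNat] at h4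
  have h5 : (algebraMap (𝓞 E) E (evalCoeffs aCoeffs (L.root 0 ^ 2)) /
      algebraMap (𝓞 E) E (evalCoeffs bCoeffs (L.root 0 ^ 2))) ^ 2 = -11 := by
    rw [div_pow, div_eq_iff (pow_ne_zero _ h3)]
    linear_combination h4
  have h6 : IsIntegral ℤ (algebraMap (𝓞 E) E (evalCoeffs aCoeffs (L.root 0 ^ 2)) /
      algebraMap (𝓞 E) E (evalCoeffs bCoeffs (L.root 0 ^ 2))) := by
    refine IsIntegral.of_pow (n := 2) (by norm_num) ?_
    rw [h5]
    exact_mod_cast (isIntegral_algebraMap (R := ℤ) (A := E) (x := -11))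
  exact ⟨⟨_, h6⟩, RingOfIntegers.ext (by push_cast; exact h5)⟩

theorem map_eq_or_of_sq {k : Type*} [Field k] {π : 𝓞 E →+* k} {s : 𝓞 E} (hs : s ^ 2 = -11)
    {C : FrobCert} (hC : C.check = true) (hℓ : ((C.ℓ : ℤ) : k) = 0) :
    π s = C.s ∨ π s = -C.s := by
  simp only [FrobCert.check, Bool.and_eq_true, beq_iff_eq] at hC
  refine sq_eq_sq_iff_eq_or_eq_neg.mp ?_
  rw [← map_pow, hs]
  have h := intCast_eq_zero_of_dvd' hℓ (Int.dvd_of_emod_eq_zero hC.1.1.2)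
  push_cast at h
  rw [map_neg, map_ofNat]
  linear_combination -h

variable [IsGalois ℚ E] {s : 𝓞 E}

theorem exists_hasType (L : RootLabelling (𝓞 E)) [DecidableEq (𝓞 E)] (hs : s ^ 2 = -11) (P N : FrobCert)
    (hP : P.check = true) (hN : N.check = true) {ℓ n c : ℕ} (hℓ : ℓ.Prime) (hPℓ : P.ℓ = ℓ)
    (hNℓ : N.ℓ = ℓ) (hs' : N.s = -P.s) (hPq : P.q.Prime) (hNq : N.q.Prime)
    (hPn : P.q ^ (P.j + 1) = n) (hNn : N.q ^ (N.j + 1) = n)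
    (hPc : P.fixTail.length = c) (hNc : N.fixTail.length = c) :
    ∃ e : E ≃ₐ[ℚ] E, HasType (MulAction.stabilizer (E ≃ₐ[ℚ] E) s) (L.half s) e n c := by
  have : Fact ℓ.Prime := ⟨hℓ⟩
  obtain ⟨k, _, π, σ, hk, hσ⟩ := exists_frobenius E ℓ
  obtain h | h := map_eq_or_of_sq (π := π) hs hP (by rwa [hPℓ])
  · have := FrobCert.hasType L hP (by rwa [hPℓ]) hs h (by rwa [hPℓ]) (by rwa [hPℓ]) hPq
    rw [hPn, hPc] at this
    exact ⟨_, this⟩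
  · have := FrobCert.hasType L hN (by rwa [hNℓ]) hs (by rw [h, hs']; push_cast; rfl)
      (by rwa [hNℓ]) (by rwa [hNℓ]) hNq
    rw [hNn, hNc] at this
    exact ⟨_, this⟩

theorem exists_smul_eq_neg (hs : s ^ 2 = -11) : ∃ τ : E ≃ₐ[ℚ] E, τ • s = -s := by
  have : Fact (Nat.Prime 7) := ⟨by norm_num⟩
  obtain ⟨k, _, π, σ, hk, hσ⟩ := exists_frobenius E 7
  refine ⟨σ, ?_⟩
  have h1 : (σ • s) ^ 2 = s ^ 2 := by
    have := map_intCast (MulSemiringAction.toRingHom (E ≃ₐ[ℚ] E) (𝓞 E) σ) (-11)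
    rw [← smul_pow', hs]
    simpa using this
  refine (sq_eq_sq_iff_eq_or_eq_neg.mp h1).resolve_left fun h2 => ?_
  have h3 := hσ s
  have h4 : π s ^ 2 = -11 := by rw [← map_pow, hs, map_neg, map_ofNat]
  push_cast at hk
  rw [h2] at h3
  have h5 : (1332 : ℤ) * π s = 0 := by
    push_cast
    linear_combination h3 + π s * (π s ^ 4 - 11 * π s ^ 2 + 121) * h4
  obtain h6 | h6 := mul_eq_zero.mp h5
  · exact intCast_ne_zero_of_isCoprime (k := k) (n := 1332) (ℓ := 7) (by exact_mod_cast hk)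
      (by norm_num) h6
  · rw [h6] at h4
    refine intCast_ne_zero_of_isCoprime (k := k) (n := 11) (ℓ := 7) (by exact_mod_cast hk)
      (by norm_num) ?_
    push_cast
    linear_combination h4

theorem smul_ne_of_mem_half_neg {L : RootLabelling (𝓞 E)} {k : Type*} [Field k] {π : 𝓞 E →+* k}
    {σ : E ≃ₐ[ℚ] E} (h59 : ((59 : ℤ) : k) = 0) (hσ : ∀ r : 𝓞 E, π (σ • r) = π r ^ 59)
    (hπs : π s = FrobCert.eight.s) {x : 𝓞 E} (hx : x ∈ L.half (-s)) : σ • x ≠ x := fun h => by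
  have h1 := congrArg π (RootLabelling.mem_half.mp hx).2
  rw [map_add, map_mul, CoeffList.map_eval, CoeffList.map_eval, map_zero, map_neg, hπs] at h1
  have h2 := mul_eq_of_prodCheck FrobCert.otherTail_check h59 (π x)
  rw [CoeffList.eval_smul, CoeffList.eval_add, CoeffList.eval_smul] at h2
  push_cast at h2
  rw [h1, mul_zero, List.length_nil, pow_zero, CoeffList.eval_nil, add_zero, one_mul] at h2
  refine pow_add_ne_zero FrobCert.otherInv_check h59 h2 ?_
  rw [← hσ, h]
  simp

theorem sq_smul_eq {L : RootLabelling (𝓞 E)} {k : Type*} [Field k] {π : 𝓞 E →+* k}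
    {σ : E ≃ₐ[ℚ] E} (h59 : ((59 : ℤ) : k) = 0) (hσ : ∀ r : 𝓞 E, π (σ • r) = π r ^ 59)
    {y : 𝓞 E} (hy : y ^ 2 ∈ L.squares) (e : ℤˣ)
    (h : π (y ^ 2) ^ ((59 ^ 2 - 1) / 2) = (e : ℤ)) : σ ^ 2 • y = ((e : ℤ) : 𝓞 E) * y := by
  have he : ((e : ℤ) : 𝓞 E) ^ 2 = 1 := by
    exact_mod_cast congrArg (fun z : ℤ => (z : 𝓞 E)) (Int.units_coe_mul_self e ▸ sq (e : ℤ))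
  have he' : ((e : ℤ) : k) ^ 2 = 1 := by
    have := congrArg π he
    rwa [map_pow, map_intCast, map_one] at this
  have h1 : π (σ ^ 2 • y) = ((e : ℤ) : k) * π y := by
    rw [map_pow_smul_eq hσ, ← h, map_pow, ← pow_mul, ← pow_succ]
    norm_num
  have h2 : σ ^ 2 • y ^ 2 = y ^ 2 := by
    refine FrobCert.injOn_squares FrobCert.eight_check L (π := π) h59
      (L.smul_mem_squares _ hy) hy ?_
    rw [smul_pow', map_pow, h1, mul_pow, he', one_mul, map_pow]
  have h3 : (σ ^ 2 • y) ^ 2 = (((e : ℤ) : 𝓞 E) * y) ^ 2 := by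
    rw [← smul_pow', h2, mul_pow, he, one_mul]
  refine (sq_eq_sq_iff_eq_or_eq_neg.mp h3).resolve_right fun h4 => ?_
  rw [h4, map_neg, map_mul, map_intCast] at h1
  have h5 : (2 : ℤ) * (((e : ℤ) : k) * π y) = 0 := by
    push_cast
    linear_combination -h1
  have h6 := (mul_eq_zero.mp h5).resolve_left
    (intCast_ne_zero_of_isCoprime h59 (by norm_num))
  rw [mul_eq_zero] at h6
  have h7 : ((e : ℤ) : k) ≠ 0 := fun h0 => by rw [h0] at he'; simp at he'
  rw [map_pow, h6.resolve_left h7] at h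
  exact h7 (by rw [← h]; norm_num)

end

theorem injective_vec_four {α : Type*} {a b c d : α} (hab : a ≠ b) (hcd : c ≠ d) (h1 : a ≠ c)
    (h2 : a ≠ d) (h3 : b ≠ c) (h4 : b ≠ d) : Function.Injective ![a, b, c, d] := by
  intro i j hij
  fin_cases i <;> fin_cases j <;> first | rfl | (simp at hij; tauto)

section
variable {E : Type} [Field E] [NumberField E] [IsGalois ℚ E] {s : 𝓞 E}

theorem exists_pair_of_cover {α : Type*} [DecidableEq α] {S A B C : Finset α} (h : S ⊆ A ∪ B ∪ C)
    {m : ℕ} (hS : S.card = 2 + 2 + m) (hA : A.card ≤ 2) (hB : B.card ≤ 2) (hC : C.card ≤ m) :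
    (∃ a b, a ≠ b ∧ A = {a, b}) ∧ ∃ c d, c ≠ d ∧ B = {c, d} := by
  have h1 := Finset.card_le_card h
  have h2 := Finset.card_union_le (A ∪ B) C
  have h3 := Finset.card_union_le A B
  exact ⟨Finset.card_eq_two.mp (by omega), Finset.card_eq_two.mp (by omega)⟩

theorem exists_square_signs {L : RootLabelling (𝓞 E)} {k : Type*} [Field k] {π : 𝓞 E →+* k}
    (h59 : ((59 : ℤ) : k) = 0)
    (hs : s ^ 2 = -11) (hπs : π s = FrobCert.eight.s) :
    ∃ x : Fin 4 → 𝓞 E, Function.Injective x ∧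
      ∀ i, x i ∈ L.half s ∧ π (x i) ^ ((59 ^ 2 - 1) / 2) = (halfSigns i : ℤ) := by
  classical
  have hC := FrobCert.eight_check
  have hinj := FrobCert.injOn_squares hC L h59 (π := π)
  have hsub : L.half s ⊆ L.squares := fun x hx => (RootLabelling.mem_half.mp hx).1
  obtain ⟨F, hFm⟩ : ∃ F : List ℤ → Finset (𝓞 E), ∀ t x, x ∈ F t ↔
      x ∈ L.half s ∧ π x ^ t.length + evalCoeffs t (π x) = 0 :=
    ⟨fun t => (L.half s).filter fun x => π x ^ t.length + evalCoeffs t (π x) = 0,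
      fun t x => Finset.mem_filter⟩
  have hF : ∀ t, (F t).card ≤ t.length := fun t =>
    card_le_of_map_root hinj (fun x hx => hsub ((hFm t x).mp hx).1)
      fun x hx => ((hFm t x).mp hx).2
  have hcov : L.half s ⊆ F FrobCert.posTail ∪ F FrobCert.negTail ∪ F FrobCert.eight.movTail :=
    fun x hx => by
      obtain h | h := FrobCert.map_root_or L hC h59 hπs hx
      · have h1 := mul_eq_of_prodCheck FrobCert.posTail_negTail_check h59 (π x)
        rw [evalCoeffs_append, CoeffList.eval_cons, CoeffList.eval_nil] at h1
        have h2 : evalCoeffs FrobCert.eight.fixTail (π x) +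
            π x ^ FrobCert.eight.fixTail.length * ((1 : ℤ) + π x * 0) = 0 := by
          push_cast
          linear_combination h
        rw [h2] at h1
        refine Finset.mem_union_left _ (Finset.mem_union.mpr ?_)
        exact (mul_eq_zero.mp h1).imp (fun h => (hFm _ _).mpr ⟨hx, h⟩)
          (fun h => (hFm _ _).mpr ⟨hx, h⟩)
      · exact Finset.mem_union_right _ ((hFm _ _).mpr ⟨hx, h⟩)
  obtain ⟨⟨a, b, hab, hP⟩, c, d, hcd, hN⟩ := exists_pair_of_cover hcov (L.card_half hs)
    (hF FrobCert.posTail) (hF FrobCert.negTail) (hF FrobCert.eight.movTail)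
  have hpos : ∀ x ∈ F FrobCert.posTail, x ∈ L.half s ∧
      π x ^ ((59 ^ 2 - 1) / 2) = ((1 : ℤˣ) : ℤ) := fun x hx => by
    obtain ⟨h1, h2⟩ := (hFm _ _).mp hx
    have := pow_add_eq_zero FrobCert.posTail_check h59 h2
    simp only [CoeffList.eval_cons, CoeffList.eval_nil] at this
    push_cast at this ⊢
    exact ⟨h1, by linear_combination this⟩
  have hneg : ∀ x ∈ F FrobCert.negTail, x ∈ L.half s ∧
      π x ^ ((59 ^ 2 - 1) / 2) = ((-1 : ℤˣ) : ℤ) := fun x hx => by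
    obtain ⟨h1, h2⟩ := (hFm _ _).mp hx
    have := pow_add_eq_zero FrobCert.negTail_check h59 h2
    simp only [CoeffList.eval_cons, CoeffList.eval_nil] at this
    push_cast at this ⊢
    exact ⟨h1, by linear_combination this⟩
  have hdis : ∀ x ∈ F FrobCert.posTail, ∀ z ∈ F FrobCert.negTail, x ≠ z := fun x hx z hz h => by
    subst h
    have := (hpos x hx).2.symm.trans (hneg x hz).2
    push_cast at this
    refine intCast_ne_zero_of_isCoprime (n := 2) h59 (by norm_num) ?_
    push_cast
    linear_combination this
  have ha : a ∈ F FrobCert.posTail := by simp [hP]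
  have hb : b ∈ F FrobCert.posTail := by simp [hP]
  have hc : c ∈ F FrobCert.negTail := by simp [hN]
  have hd : d ∈ F FrobCert.negTail := by simp [hN]
  refine ⟨![a, b, c, d], injective_vec_four hab hcd (hdis a ha c hc) (hdis a ha d hd)
    (hdis b hb c hc) (hdis b hb d hd), fun i => ?_⟩
  fin_cases i
  exacts [hpos a ha, hpos b hb, hneg c hc, hneg d hd]

theorem exists_signs {L : RootLabelling (𝓞 E)} {k : Type*} [Field k] {π : 𝓞 E →+* k}
    {σ : E ≃ₐ[ℚ] E} (h59 : ((59 : ℤ) : k) = 0) (hσ : ∀ r : 𝓞 E, π (σ • r) = π r ^ 59)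
    (hs : s ^ 2 = -11) (hπs : π s = FrobCert.eight.s) :
    ∃ y : Fin 4 → 𝓞 E, (Function.Injective fun i => y i ^ 2) ∧ (∀ i, y i ^ 2 ∈ L.half s) ∧
      ∀ i, σ ^ 2 • y i = ((halfSigns i : ℤ) : 𝓞 E) * y i := by
  obtain ⟨x, hxi, hx⟩ := exists_square_signs (L := L) h59 hs hπs
  have hsub : L.half s ⊆ L.squares := fun x hx => (RootLabelling.mem_half.mp hx).1
  choose i hi using fun j => RootLabelling.mem_squares.mp (hsub (hx j).1)
  refine ⟨fun j => L.root (i j), fun j j' h => hxi ?_, fun j => ?_, fun j => ?_⟩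
  · simpa only [hi] using h
  · rw [hi]; exact (hx j).1
  · exact sq_smul_eq (L := L) h59 hσ (by rw [hi]; exact hsub (hx j).1) _ (by rw [hi]; exact (hx j).2)

end

section
variable {E : Type} [Field E] [NumberField E] [IsGalois ℚ E]

/-- The data extracted from a Frobenius element at `59` and a square root of `-11`. -/
theorem exists_kTrans_four [DecidableEq (𝓞 E)] (L : RootLabelling (𝓞 E)) :
    ∃ (s : 𝓞 E) (ρ : E ≃ₐ[ℚ] E) (y : Fin 4 → 𝓞 E), s ^ 2 = -11 ∧
      KTrans (MulAction.stabilizer (E ≃ₐ[ℚ] E) s) (L.half s) 4 ∧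
      ρ ∈ MulAction.stabilizer (E ≃ₐ[ℚ] E) s ∧ (∃ z : 𝓞 E, ρ • ρ • z ≠ z) ∧
      (Function.Injective fun i => y i ^ 2) ∧ (∀ i, y i ^ 2 ∈ L.half s) ∧
      ∀ i, ρ • y i = ((halfSigns i : ℤ) : 𝓞 E) * y i := by
  have : Fact (Nat.Prime 59) := ⟨by norm_num⟩
  obtain ⟨k, _, π, σ, h59, hσ⟩ := exists_frobenius E 59
  obtain ⟨s, hs, hπs⟩ : ∃ s : 𝓞 E, s ^ 2 = -11 ∧ π s = FrobCert.eight.s := by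
    obtain ⟨s, hs⟩ := exists_sq_eq_neg_eleven L
    obtain h | h := map_eq_or_of_sq (π := π) hs FrobCert.eight_check h59
    · exact ⟨s, hs, h⟩
    · exact ⟨-s, by rwa [neg_sq], by rw [map_neg, h, neg_neg]⟩
  obtain ⟨y, hy, hyΩ, hρy⟩ := exists_signs (L := L) h59 hσ hs hπs
  obtain ⟨e₁, h₁⟩ := exists_hasType L hs .elevenPos .elevenNeg FrobCert.elevenPos_check
    FrobCert.elevenNeg_check (ℓ := 47) (n := 11) (c := 1) (by norm_num) rfl rfl rfl (by decide)
    (by decide) rfl rfl rfl rfl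
  obtain ⟨e₂, h₂⟩ := exists_hasType L hs .fivePos .fiveNeg FrobCert.fivePos_check
    FrobCert.fiveNeg_check (ℓ := 269) (n := 5) (c := 2) (by norm_num) rfl rfl rfl (by decide)
    (by decide) rfl rfl rfl rfl
  obtain ⟨e₃, h₃⟩ := exists_hasType L hs .threePos .threeNeg FrobCert.threePos_check
    FrobCert.threeNeg_check (ℓ := 467) (n := 3) (c := 3) (by norm_num) rfl rfl rfl (by decide)
    (by decide) rfl rfl rfl rfl
  have h₄ : HasType (MulAction.stabilizer (E ≃ₐ[ℚ] E) s) (L.half s) (σ ^ 2) 4 4 :=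
    FrobCert.hasType L FrobCert.eight_check h59 hs hπs hσ (by decide) Nat.prime_two
  obtain ⟨τ, hτ⟩ := exists_smul_eq_neg hs
  have hσs : σ • s = s := FrobCert.smul_eq_of_map_eq FrobCert.eight_check h59 hs hπs hσ (by decide)
  have hmov : ∀ x ∈ L.half s, ∃ g ∈ MulAction.stabilizer (E ≃ₐ[ℚ] E) s, g • x ≠ x := by
    intro x hx
    have h1 : τ • x ∈ L.half (-s) := hτ ▸ L.smul_mem_half τ hx
    refine ⟨τ⁻¹ * σ * τ, ?_, fun h => smul_ne_of_mem_half_neg h59 hσ hπs h1 ?_⟩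
    · rw [MulAction.mem_stabilizer_iff, mul_smul, mul_smul, hτ, smul_neg, hσs, inv_smul_eq_iff, hτ]
    · rwa [mul_smul, mul_smul, inv_smul_eq_iff] at h
  have hΩ : ∀ g ∈ MulAction.stabilizer (E ≃ₐ[ℚ] E) s, ∀ x ∈ L.half s, g • x ∈ L.half s :=
    fun g hg x hx => by
      have := L.smul_mem_half g hx
      rwa [MulAction.mem_stabilizer_iff.mp hg] at this
  refine ⟨s, σ ^ 2, y, hs, kTrans_four hΩ (L.card_half hs) hmov h₁ h₂ h₃ h₄, h₄.1, ?_, hy, hyΩ, hρy⟩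
  by_contra! h
  have h5 : ((L.half s).filter fun x => σ ^ 2 • x = x) = L.half s := by
    refine Finset.filter_true_of_mem fun x hx => (h₄.2.2 x hx).resolve_right fun h6 => ?_
    have h7 : Function.IsPeriodicPt (σ ^ 2 • · : 𝓞 E → 𝓞 E) 2 x := h x
    have := h7.minimalPeriod_dvd
    rw [h6] at this
    norm_num at this
  have h6 := h₄.2.1
  rw [h5, L.card_half hs] at h6
  norm_num at h6

theorem root_ne_zero {y : 𝓞 E} {s : 𝓞 E} {L : RootLabelling (𝓞 E)} (hy : y ^ 2 ∈ L.half s) :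
    y ≠ 0 := by
  rintro rfl
  have h := L.isRoot_of_mem (RootLabelling.mem_half.mp hy).1
  rw [fTail] at h
  simp only [CoeffList.eval_cons] at h
  norm_num at h

theorem exists_smul_root_eq (L : RootLabelling (𝓞 E)) (i j : Fin 48) :
    ∃ g : E ≃ₐ[ℚ] E, g • L.root i = L.root j := by
  classical
  obtain ⟨s, ρ, y, hs, h4, hρ, -, hy, hyΩ, hρy⟩ := exists_kTrans_four L
  obtain ⟨τ, hτ⟩ := exists_smul_eq_neg hs
  have key : ∀ i, ∃ g : E ≃ₐ[ℚ] E, (g • L.root i) ^ 2 ∈ L.half s := fun i => by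
    obtain h | h := L.mem_half_or hs (L.root_sq_mem i)
    · exact ⟨1, by rwa [one_smul]⟩
    · refine ⟨τ, ?_⟩
      rw [← smul_pow']
      have := L.smul_mem_half τ h
      rwa [smul_neg, hτ, neg_neg] at this
  obtain ⟨a, ha⟩ := key i
  obtain ⟨b, hb⟩ := key j
  obtain ⟨g, -, hg⟩ := exists_smul_eq_of_sq_mem h4 hρ hy hyΩ (L.card_half hs) hρy ha hb
  exact ⟨b⁻¹ * g * a, by rw [mul_smul, mul_smul, hg, inv_smul_smul]⟩

theorem le_card_of_rootLabelling (L : RootLabelling (𝓞 E)) : 380160 ≤ Nat.card (E ≃ₐ[ℚ] E) := by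
  classical
  obtain ⟨s, ρ, y, hs, h4, hρ, hρ2, hy, hyΩ, hρy⟩ := exists_kTrans_four L
  obtain ⟨τ, hτ⟩ := exists_smul_eq_neg hs
  have h1 := le_card_of_kTrans_four (L.card_half hs) h4 hρ hy hyΩ hρy two_ne_zero
    (fun i => root_ne_zero (hyΩ i)) hρ2
  have h2 : (2 : ℕ) ≤ Nat.card (MulAction.orbit (E ≃ₐ[ℚ] E) s) := by
    have : Nontrivial (MulAction.orbit (E ≃ₐ[ℚ] E) s) :=
      ⟨⟨⟨s, MulAction.mem_orbit_self s⟩, ⟨-s, τ, hτ⟩, fun h => by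
        have h3 : s = -s := congrArg Subtype.val h
        have h4 : s = 0 := self_eq_neg.mp h3
        rw [h4] at hs
        norm_num at hs⟩⟩
    have : Finite (MulAction.orbit (E ≃ₐ[ℚ] E) s) :=
      Set.Finite.to_subtype (Set.finite_range _)
    exact Finite.one_lt_card
  rw [card_eq_card_orbit_mul_card_stabilizer (E ≃ₐ[ℚ] E) s]
  calc 380160 = 2 * 190080 := rfl
    _ ≤ _ := Nat.mul_le_mul h2 h1

end

theorem irreducible_of_transitive {F E : Type*} [Field F] [Field E] [Algebra F E]
    {p : F[X]} (hp : p.Monic) {n : ℕ} [NeZero n] (hn : p.natDegree = n) {r : Fin n → E}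
    (hr : Function.Injective r) (h0 : ∀ i, aeval (r i) p = 0)
    (ht : ∀ i, ∃ σ : E ≃ₐ[F] E, σ (r 0) = r i) : Irreducible p := by
  classical
  have hint : IsIntegral F (r 0) := ⟨p, hp, h0 0⟩
  have hle : p.natDegree ≤ (minpoly F (r 0)).natDegree := by
    have := card_le_degree_of_subset_roots (p := (minpoly F (r 0)).map (algebraMap F E))
      (Z := Finset.univ.image r) (fun x hx => by
        obtain ⟨i, -, rfl⟩ := Finset.mem_image.mp (Finset.mem_val.mp hx)
        obtain ⟨σ, hσ⟩ := ht i
        rw [mem_roots (map_monic_ne_zero (minpoly.monic hint)), IsRoot.def, ← eval₂_eq_eval_map,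
          ← aeval_def, ← hσ, ← AlgEquiv.coe_toAlgHom, aeval_algHom_apply, minpoly.aeval, map_zero])
    rw [Finset.card_image_of_injective _ hr, Finset.card_univ, Fintype.card_fin,
      natDegree_map] at this
    exact hn.trans_le this
  rw [eq_of_monic_of_dvd_of_natDegree_le (minpoly.monic hint) hp (minpoly.dvd F _ (h0 0)) hle]
  exact minpoly.irreducible hint

theorem eq_one_of_forall_smul_root {E : Type} [Field E] [NumberField E]
    [(monicPoly ℚ 48 gTail).IsSplittingField ℚ E] (L : RootLabelling (𝓞 E)) {σ : E ≃ₐ[ℚ] E}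
    (hσ : ∀ i, σ • L.root i = L.root i) : σ = 1 := by
  refine AlgEquiv.ext fun x => ?_
  have := AlgHom.ext_of_adjoin_eq_top (φ₁ := (σ : E →ₐ[ℚ] E)) (φ₂ := AlgHom.id ℚ E)
    (IsSplittingField.adjoin_rootSet E (monicPoly ℚ 48 gTail)) fun x hx => by
      have h0 := (mem_rootSet.mp hx).2
      rw [aeval_def, eval₂_eq_eval_map, map_monicPoly, eval_monicPoly] at h0
      have hx' : IsIntegral ℤ x := ⟨monicPoly ℤ 48 gTail, monic_monicPoly (by decide), by
        rw [eval₂_eq_eval_map, map_monicPoly, eval_monicPoly, h0]⟩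
      obtain ⟨z, rfl⟩ : ∃ z : 𝓞 E, algebraMap (𝓞 E) E z = x := ⟨⟨x, hx'⟩, rfl⟩
      obtain ⟨i, rfl⟩ := L.surjective z (RingOfIntegers.coe_injective (by
        rw [map_add, map_pow, CoeffList.map_eval, map_zero]
        exact h0))
      exact congrArg (algebraMap (𝓞 E) E) (hσ i)
  exact DFunLike.congr_fun this x

theorem irreducible_and_card_aut {E : Type} [Field E] [CharZero E] [inst : Algebra ℚ E]
    [(monicPoly ℚ 48 gTail).IsSplittingField ℚ E] :
    Irreducible (monicPoly ℚ 48 gTail) ∧ Nat.card (E ≃ₐ[ℚ] E) = 380160 := by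
  obtain rfl : inst = DivisionRing.toRatAlgebra := Subsingleton.elim _ _
  have hlen : gTail.length ≤ 48 := by decide
  have : NumberField E :=
    { to_finiteDimensional := IsSplittingField.finiteDimensional _ (monicPoly ℚ 48 gTail) }
  have : Normal ℚ E := Normal.of_isSplittingField (monicPoly ℚ 48 gTail)
  have : IsGalois ℚ E := ⟨⟩
  obtain ⟨L⟩ := exists_rootLabelling (IsSplittingField.splits E (monicPoly ℚ 48 gTail))
  refine ⟨irreducible_of_transitive (E := E) (r := fun i => algebraMap (𝓞 E) E (L.root i))
    (monic_monicPoly hlen) (natDegree_monicPoly hlen)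
    (RingOfIntegers.coe_injective.comp L.injective) (fun i => ?_) fun i => ?_,
    le_antisymm (L.card_le fun σ hσ => eq_one_of_forall_smul_root L hσ)
      (le_card_of_rootLabelling L)⟩
  · have := congrArg (algebraMap (𝓞 E) E) (L.isRoot i)
    rw [map_add, CoeffList.map_eval, map_pow, map_zero] at this
    rw [aeval_def, eval₂_eq_eval_map, map_monicPoly, eval_monicPoly, this]
  · obtain ⟨σ, hσ⟩ := exists_smul_root_eq L 0 i
    exact ⟨σ, congrArg (algebraMap (𝓞 E) E) hσ⟩

theorem gal_monicPoly : Irreducible (monicPoly ℚ 48 gTail) ∧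
    Nat.card (monicPoly ℚ 48 gTail).Gal = 380160 :=
  @irreducible_and_card_aut _ _ _ _ (IsSplittingField.splittingField (monicPoly ℚ 48 gTail))

end

theorem span_pow_lt_natDegree_eq_top {R A : Type*} [CommRing R] [Nontrivial R] [CommRing A]
    [Algebra R A] {a : A} {ν : R[X]} (hν : ν.Monic) (ha : aeval a ν = 0)
    (h : Algebra.adjoin R {a} = ⊤) :
    Submodule.span R (Set.range fun i : Fin ν.natDegree => a ^ (i : ℕ)) = ⊤ := by
  have := Submodule.span_range_natDegree_eq_adjoin (x := a) hν ha
  rw [h] at this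
  rw [← Algebra.top_toSubmodule, ← this]
  congr 1
  ext y
  simp [Fin.exists_iff]

section
variable {E : Type*} [Field E] [CharZero E]

theorem minpoly_int_eq_of_rat {n : ℕ} {t : List ℤ} (ht : t.length ≤ n) {x : E}
    (hx : minpoly ℚ x = monicPoly ℚ n t) (h0 : x ^ n + evalCoeffs t x = 0) :
    minpoly ℤ x = monicPoly ℤ n t := by
  have hint : IsIntegral ℤ x := ⟨monicPoly ℤ n t, monic_monicPoly ht, by
    rw [eval₂_eq_eval_map, map_monicPoly, eval_monicPoly, h0]⟩
  refine Polynomial.map_injective (algebraMap ℤ ℚ) Int.cast_injective ?_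
  rw [map_monicPoly, ← hx, minpoly.isIntegrallyClosed_eq_field_fractions' ℚ hint]

/-- An element `α` whose reduction modulo a prime `ℓ` generates `𝔽_ℓ[X] / (X ^ n + t)` has
degree `n`. -/
theorem minpoly_eq_of_generates {n : ℕ} {t T a w : List ℤ} (ht : t.length ≤ n)
    (hT : T.length ≤ n) (c : ℤ) (ℓ : ℕ) [Fact ℓ.Prime] {x α : E}
    (hx : minpoly ℚ x = monicPoly ℚ n t) (hα : c * α = evalCoeffs a x)
    (h0 : α ^ n + evalCoeffs T α = 0)
    (hw : CoeffList.isZero (CoeffList.red ℓ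
      (CoeffList.add (CoeffList.compMod ℓ n t w a) [0, -1])) = true) :
    minpoly ℚ α = monicPoly ℚ n T := by
  have hint : IsIntegral ℤ α := ⟨monicPoly ℤ n T, monic_monicPoly hT, by
    rw [eval₂_eq_eval_map, map_monicPoly, eval_monicPoly, h0]⟩
  have hx0 : x ^ n + evalCoeffs t x = 0 := by
    have := minpoly.aeval ℚ x
    rwa [hx, aeval_def, eval₂_eq_eval_map, map_monicPoly, eval_monicPoly] at this
  have hxint : IsIntegral ℤ x := ⟨monicPoly ℤ n t, monic_monicPoly ht, by
    rw [eval₂_eq_eval_map, map_monicPoly, eval_monicPoly, hx0]⟩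
  have hdvd : minpoly ℚ α ∣ monicPoly ℚ n T := minpoly.dvd ℚ _ (by
    rw [aeval_def, eval₂_eq_eval_map, map_monicPoly, eval_monicPoly, h0])
  symm
  refine eq_of_monic_of_dvd_of_natDegree_le (minpoly.monic hint.tower_top)
    (monic_monicPoly hT) hdvd ?_
  rw [natDegree_monicPoly hT, minpoly.isIntegrallyClosed_eq_field_fractions' ℚ hint,
    (minpoly.monic hint).natDegree_map]
  set μ := minpoly ℤ α with hμ
  have hμm : μ.Monic := minpoly.monic hint
  -- the homogenised minimal polynomial kills `c α`
  have h1 : aeval x ((scaleRoots μ c).comp (evalCoeffs a X)) = 0 := by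
    have h3 := scaleRoots_aeval_eq_zero (p := μ) (a := α) (r := c) (minpoly.aeval ℤ α)
    rw [eq_intCast, hα] at h3
    rw [aeval_comp, ← h3]
    exact congrArg (fun z => aeval z (scaleRoots μ c))
      ((CoeffList.map_eval (aeval x : ℤ[X] →ₐ[ℤ] E).toRingHom a X).trans (by simp))
  have h2 : monicPoly ℤ n t ∣ (scaleRoots μ c).comp (evalCoeffs a X) := by
    rw [← minpoly_int_eq_of_rat ht hx hx0]
    exact minpoly.isIntegrallyClosed_dvd hxint h1
  let Q := monicPoly (ZMod ℓ) n t
  have hQ : Q.Monic := monic_monicPoly ht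
  let r := AdjoinRoot.root Q
  have hr : r ^ n + evalCoeffs t r = 0 := by
    have := AdjoinRoot.eval₂_root Q
    rwa [eval₂_eq_eval_map, map_monicPoly, eval_monicPoly] at this
  let ν := (scaleRoots μ c).map (Int.castRingHom (ZMod ℓ))
  have hs : (scaleRoots μ c).Monic := (monic_scaleRoots_iff c).mpr hμm
  have hν : ν.Monic := hs.map _
  have hνd : ν.natDegree = μ.natDegree := by
    rw [hs.natDegree_map, natDegree_scaleRoots]
  have hν0 : aeval (evalCoeffs a r) ν = 0 := by
    obtain ⟨q, hq⟩ := h2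
    have h3 := congrArg (aeval r) hq
    rw [map_mul, aeval_comp] at h3
    have h4 : aeval r (monicPoly ℤ n t) = 0 := by
      rw [aeval_def, eval₂_eq_eval_map, map_monicPoly, eval_monicPoly, hr]
    have h5 : aeval r (evalCoeffs a X : ℤ[X]) = evalCoeffs a r :=
      (CoeffList.map_eval (aeval r : ℤ[X] →ₐ[ℤ] AdjoinRoot Q).toRingHom a X).trans (by simp)
    rw [h4, zero_mul, h5] at h3
    rw [← h3, aeval_def, aeval_def, eval₂_map]
    congr 1
  have hN : (((ℓ : ℕ) : ℤ) : AdjoinRoot Q) = 0 := by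
    rw [Int.cast_natCast, ← map_natCast (algebraMap (ZMod ℓ) (AdjoinRoot Q)),
      ZMod.natCast_self, map_zero]
  have hgen : Algebra.adjoin (ZMod ℓ) {evalCoeffs a r} = ⊤ := by
    rw [eq_top_iff, ← AdjoinRoot.adjoinRoot_eq_top (f := Q), Algebra.adjoin_le_iff,
      Set.singleton_subset_iff]
    have h6 := CoeffList.eval_eq_zero_of_isZero hw r
    rw [CoeffList.eval_red hN, CoeffList.eval_add, CoeffList.eval_compMod hN hr] at h6
    have h7 : r = evalCoeffs w (evalCoeffs a r) := by
      simp only [CoeffList.eval_cons, CoeffList.eval_nil] at h6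
      push_cast at h6
      linear_combination -h6
    have h8 : evalCoeffs w (evalCoeffs a r) =
        ((evalCoeffs w ⟨_, Algebra.self_mem_adjoin_singleton (ZMod ℓ) (evalCoeffs a r)⟩ :
          Algebra.adjoin (ZMod ℓ) {evalCoeffs a r}) : AdjoinRoot Q) :=
      (CoeffList.map_eval (Algebra.adjoin (ZMod ℓ) {evalCoeffs a r}).val.toRingHom w
        ⟨_, Algebra.self_mem_adjoin_singleton (ZMod ℓ) (evalCoeffs a r)⟩).symm
    exact Set.mem_of_eq_of_mem (h7.trans h8) (Subtype.property _)
  have hfin : Module.finrank (ZMod ℓ) (AdjoinRoot Q) = n := by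
    rw [(AdjoinRoot.powerBasis' hQ).finrank, AdjoinRoot.powerBasis'_dim, natDegree_monicPoly ht]
  rw [← hfin, ← hνd, ← finrank_top, ← span_pow_lt_natDegree_eq_top hν hν0 hgen]
  exact (finrank_range_le_card (R := ZMod ℓ)
    fun i : Fin ν.natDegree => evalCoeffs a r ^ (i : ℕ)).trans_eq (Fintype.card_fin _)
end

section
variable {S : Type*} [CommRing S] [Algebra.IsIntegral ℤ S] {p : ℕ} {θ : S}
  {m H : ℤ[X]}

theorem exists_eq_C_mul_of_map_eq_zero {P : ℤ[X]} (h : P.map (Int.castRingHom (ZMod p)) = 0) :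
    ∃ D, P = C (p : ℤ) * D := by
  change C (p : ℤ) ∣ P
  rw [C_dvd_iff_dvd_coeff]
  intro i
  have := congrArg (fun q => coeff q i) h
  simpa [ZMod.intCast_zmod_eq_zero_iff_dvd] using this

/-- If `H` is a non-unit divisor of `m` modulo `p`, then some prime contains `p` and `H(θ)`. -/
theorem exists_prime_mem_aeval [Fact p.Prime] (hm : ∀ P : ℤ[X], aeval θ P = 0 → m ∣ P)
    (hH : ¬ IsUnit (H.map (Int.castRingHom (ZMod p))))
    (hd : H.map (Int.castRingHom (ZMod p)) ∣ m.map (Int.castRingHom (ZMod p))) :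
    ∃ Q : Ideal S, Q.IsPrime ∧ (p : S) ∈ Q ∧ aeval θ H ∈ Q := by
  let φ : ℤ[X] →+* S := (aeval θ : ℤ[X] →ₐ[ℤ] S).toRingHom
  let I : Ideal ℤ[X] := Ideal.span {C (p : ℤ), H, m}
  have hker : RingHom.ker φ ≤ I := fun P hP =>
    Ideal.mem_of_dvd _ (hm P hP) (Ideal.subset_span (by simp))
  have hint : φ.IsIntegral := fun s => by
    obtain ⟨q, hq, hs⟩ := Algebra.IsIntegral.isIntegral (R := ℤ) s
    refine ⟨q.map C, hq.map _, ?_⟩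
    rw [eval₂_map, ← hs]
    congr 1
    exact RingHom.ext_int _ _
  have hI : I ≠ ⊤ := by
    intro h
    have h1 : (1 : ℤ[X]) ∈ I := h ▸ Submodule.mem_top
    have h2 : I ≤ Ideal.comap (mapRingHom (Int.castRingHom (ZMod p)))
        (Ideal.span {H.map (Int.castRingHom (ZMod p))}) := by
      refine Ideal.span_le.mpr ?_
      rintro P (rfl | rfl | rfl)
      · simp
      · exact Ideal.subset_span rfl
      · exact Ideal.mem_span_singleton.mpr hd
    have h3 := h2 h1
    rw [Ideal.mem_comap, map_one, Ideal.mem_span_singleton] at h3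
    exact hH (isUnit_of_dvd_one h3)
  have hJ : I.map φ ≠ ⊤ := fun h => hI ((Ideal.map_eq_top_iff_of_ker_le φ hker hint).mp h)
  obtain ⟨Q, hQ, hle⟩ := Ideal.exists_le_maximal _ hJ
  refine ⟨Q, hQ.isPrime, hle ?_, hle (Ideal.mem_map_of_mem φ (Ideal.subset_span (by simp)))⟩
  have : φ (C (p : ℤ)) = p := by simp [φ]
  rw [← this]
  exact Ideal.mem_map_of_mem φ (Ideal.subset_span (by simp))

/-- A polynomial whose value lies in `Q ∋ p, H(θ)` is divisible by `H` modulo `p`, if `H` is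
irreducible modulo `p`. -/
theorem dvd_map_of_aeval_mem {Q : Ideal S} (hQ : Q.IsPrime) (hp : (p : S) ∈ Q)
    [Fact p.Prime]
    (hθ : aeval θ H ∈ Q) (hH : Irreducible (H.map (Int.castRingHom (ZMod p)))) {P : ℤ[X]}
    (hP : aeval θ P ∈ Q) : H.map (Int.castRingHom (ZMod p)) ∣ P.map (Int.castRingHom (ZMod p)) := by
  by_contra h
  obtain ⟨a, b, hab⟩ := hH.coprime_iff_not_dvd.mpr h
  obtain ⟨a, rfl⟩ := map_surjective (Int.castRingHom (ZMod p)) ZMod.intCast_surjective a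
  obtain ⟨b, rfl⟩ := map_surjective (Int.castRingHom (ZMod p)) ZMod.intCast_surjective b
  obtain ⟨D, hD⟩ := exists_eq_C_mul_of_map_eq_zero (p := p) (P := a * H + b * P - 1) (by
    simp only [Polynomial.map_sub, Polynomial.map_add, Polynomial.map_mul, Polynomial.map_one]
    exact sub_eq_zero_of_eq hab)
  refine hQ.ne_top ((Ideal.eq_top_iff_one _).mpr ?_)
  have h1 := congrArg (aeval θ) hD
  simp only [map_sub, map_add, map_mul, map_one, aeval_C, algebraMap_int_eq,
    Int.coe_castRingHom, Int.cast_natCast] at h1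
  have h2 : (1 : S) = aeval θ a * aeval θ H + aeval θ b * aeval θ P - p * aeval θ D := by
    linear_combination -h1
  rw [h2]
  exact Q.sub_mem (Q.add_mem (Q.mul_mem_left _ hθ) (Q.mul_mem_left _ hP)) (Q.mul_mem_right _ hp)

variable [IsDomain S] [CharZero S]

/-- Dedekind's criterion: if `H ^ e` divides `m` exactly in the sense that `m = H ^ e W + p C`
with `C` prime to `H` modulo `p`, then `B(θ) ∈ p S` only if `H ^ e` divides `B` modulo `p`. -/
theorem pow_dvd_map_of_aeval_eq_mul [Fact p.Prime] (hm : ∀ P : ℤ[X], aeval θ P = 0 → m ∣ P)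
    (hθ : aeval θ m = 0) (hH : Irreducible (H.map (Int.castRingHom (ZMod p)))) {W K : ℤ[X]} {e : ℕ}
    (hmW : m = H ^ e * W + C (p : ℤ) * K)
    (hK : e ≤ 1 ∨ ¬ H.map (Int.castRingHom (ZMod p)) ∣ K.map (Int.castRingHom (ZMod p)))
    {B : ℤ[X]} {γ : S} (hB : aeval θ B = p * γ) :
    H.map (Int.castRingHom (ZMod p)) ^ e ∣ B.map (Int.castRingHom (ZMod p)) := by
  rcases Nat.eq_zero_or_pos e with rfl | he
  · simp
  have hp0 : (p : S) ≠ 0 := Nat.cast_ne_zero.mpr (Fact.out : p.Prime).ne_zero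
  have hpmap : (C (p : ℤ)).map (Int.castRingHom (ZMod p)) = 0 := by simp
  obtain ⟨Q, hQ, hpQ, hHQ⟩ := exists_prime_mem_aeval hm hH.not_isUnit (by
    rw [hmW, Polynomial.map_add, Polynomial.map_mul, Polynomial.map_mul, hpmap, zero_mul, add_zero,
      Polynomial.map_pow]
    exact (dvd_pow_self _ he.ne').mul_right _)
  suffices ∀ j ≤ e, H.map (Int.castRingHom (ZMod p)) ^ j ∣ B.map (Int.castRingHom (ZMod p)) from
    this e le_rfl
  intro j
  induction j with
  | zero => simp
  | succ j ih =>
    intro hj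
    obtain ⟨b, hb⟩ := ih (by omega)
    obtain ⟨b, rfl⟩ := map_surjective (Int.castRingHom (ZMod p)) ZMod.intCast_surjective b
    obtain ⟨D, hD⟩ := exists_eq_C_mul_of_map_eq_zero (p := p) (P := B - H ^ j * b) (by
      simp only [Polynomial.map_sub, Polynomial.map_mul, Polynomial.map_pow]
      exact sub_eq_zero_of_eq hb)
    suffices hbQ : aeval θ b ∈ Q by
      rw [hb, pow_succ]
      exact mul_dvd_mul_left _ (dvd_map_of_aeval_mem hQ hpQ hHQ hH hbQ)
    have h1 := congrArg (aeval θ) hD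
    have h2 := hθ
    rw [hmW] at h2
    simp only [map_sub, map_add, map_mul, map_pow, aeval_C, hB, algebraMap_int_eq,
      Int.coe_castRingHom, Int.cast_natCast] at h1 h2
    have h3 : aeval θ H ^ (e - 1) * aeval θ b =
        p * (aeval θ H ^ (e - 1 - j) * (γ - aeval θ D)) := by
      rw [show e - 1 = (e - 1 - j) + j by omega, pow_add, Nat.add_sub_cancel]
      linear_combination (-aeval θ H ^ (e - 1 - j)) * h1
    by_cases he1 : e ≤ 1
    · obtain rfl : e = 1 := by omega
      rw [Nat.sub_self, pow_zero, one_mul] at h3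
      rw [h3]
      exact Q.mul_mem_right _ hpQ
    · have hKQ : aeval θ K ∉ Q := fun h =>
        (hK.resolve_left he1) (dvd_map_of_aeval_mem hQ hpQ hHQ hH h)
      have hH0 : aeval θ H ^ (e - 1) ≠ 0 := by
        intro h
        rw [show e = e - 1 + 1 by omega, pow_succ, h, zero_mul, zero_mul, zero_add] at h2
        exact hKQ ((mul_eq_zero.mp h2).resolve_left hp0 ▸ Q.zero_mem)
      have h4 : aeval θ K * aeval θ b =
          - (aeval θ H * (aeval θ W * (aeval θ H ^ (e - 1 - j) * (γ - aeval θ D)))) := by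
        refine mul_left_cancel₀ hH0 ?_
        have h5 : aeval θ H ^ e = aeval θ H ^ (e - 1) * aeval θ H := by
          rw [← pow_succ, Nat.sub_add_cancel he]
        rw [h5] at h2
        linear_combination aeval θ K * h3 + (aeval θ H ^ (e - 1 - j) * (γ - aeval θ D)) * h2
      refine (hQ.mem_or_mem (x := aeval θ K) ?_).resolve_left hKQ
      rw [h4]
      exact Q.neg_mem (Q.mul_mem_right _ hHQ)
end

section
variable {F : Type*} [Field F] [NumberField F]

theorem discr_rat_eq_discr_int {ι : Type*} [Fintype ι] [DecidableEq ι] (v : ι → 𝓞 F) :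
    Algebra.discr ℚ (fun i => (v i : F)) = (Algebra.discr ℤ v : ℤ) := by
  rw [Algebra.discr_def, Algebra.discr_def, ← eq_intCast (Int.castRingHom ℚ), RingHom.map_det]
  congr 1
  ext i j
  rw [RingHom.mapMatrix_apply, Matrix.map_apply, Algebra.traceMatrix_apply,
    Algebra.traceMatrix_apply, Algebra.traceForm_apply, Algebra.traceForm_apply, eq_intCast,
    Algebra.coe_trace_int]
  rfl

/-- The discriminant of a family is the field discriminant times the square of an index, which is
prime to every `p` modulo which the family is linearly independent. -/
theorem exists_discr_eq_sq_mul {n : ℕ} (hn : Module.finrank ℚ F = n) (v : Fin n → 𝓞 F) :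
    ∃ M : ℤ, Algebra.discr ℤ v = M ^ 2 * discr F ∧ ∀ p : ℕ, p.Prime →
      (∀ (z : Fin n → ℤ) (γ : 𝓞 F), ∑ i, (z i : 𝓞 F) * v i = p * γ → ∀ i, (p : ℤ) ∣ z i) →
      ¬ (p : ℤ) ∣ M := by
  let e : Module.Free.ChooseBasisIndex ℤ (𝓞 F) ≃ Fin n := Fintype.equivFinOfCardEq (by
    rw [← Module.finrank_eq_card_basis (RingOfIntegers.basis F), RingOfIntegers.rank, hn])
  let b := (RingOfIntegers.basis F).reindex e
  let A : Matrix (Fin n) (Fin n) ℤ := b.toMatrix v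
  have hb : ∀ j, v j = ∑ i, (A i j : 𝓞 F) * b i := fun j => by
    rw [← b.sum_toMatrix_smul_self v j]
    simp [A, zsmul_eq_mul]
  refine ⟨A.det, ?_, fun p hp h hdvd => ?_⟩
  · rw [← discr_eq_discr F b, ← Algebra.discr_of_matrix_vecMul]
    congr 1
    ext j
    rw [hb j]
    simp [Matrix.vecMul, dotProduct, mul_comm]
  · have : Fact p.Prime := ⟨hp⟩
    have h0 : (A.map (Int.castRingHom (ZMod p))).det = 0 := by
      rw [← RingHom.mapMatrix_apply, ← RingHom.map_det, eq_intCast,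
        ZMod.intCast_zmod_eq_zero_iff_dvd]
      exact hdvd
    obtain ⟨z, hz, hz0⟩ := Matrix.exists_mulVec_eq_zero_iff.mpr h0
    choose w hw using fun i => ZMod.intCast_surjective (z i)
    have h1 : ∀ i, (p : ℤ) ∣ ∑ j, A i j * w j := fun i => by
      rw [← ZMod.intCast_zmod_eq_zero_iff_dvd]
      have := congrFun hz0 i
      simp only [Matrix.mulVec, dotProduct, Matrix.map_apply, eq_intCast, ← hw] at this
      push_cast
      exact this
    choose c hc using h1
    refine hz (funext fun i => ?_)
    rw [← hw i, Pi.zero_apply, ZMod.intCast_zmod_eq_zero_iff_dvd]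
    refine h w (∑ i, (c i : 𝓞 F) * b i) ?_ i
    calc ∑ j, (w j : 𝓞 F) * v j = ∑ j, ∑ i, (w j : 𝓞 F) * ((A i j : 𝓞 F) * b i) := by
          simp_rw [← Finset.mul_sum, ← hb]
      _ = ∑ i, ((∑ j, A i j * w j : ℤ) : 𝓞 F) * b i := by
          rw [Finset.sum_comm]
          refine Finset.sum_congr rfl fun i _ => ?_
          push_cast
          rw [Finset.sum_mul]
          exact Finset.sum_congr rfl fun j _ => by ring
      _ = p * ∑ i, (c i : 𝓞 F) * b i := by
          rw [Finset.mul_sum]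
          refine Finset.sum_congr rfl fun i _ => ?_
          rw [hc i]; push_cast; ring

/-- The power basis generated by an element of full degree. -/
noncomputable def powerBasisOfFinrank {n : ℕ} (hn : Module.finrank ℚ F = n) {t : List ℤ}
    (ht : t.length ≤ n) {x : F} (hx : minpoly ℚ x = monicPoly ℚ n t) : PowerBasis ℚ F :=
  have hd : (minpoly ℚ x).natDegree = n := by rw [hx, natDegree_monicPoly ht]
  have hli : LinearIndependent ℚ fun i : Fin n => x ^ (i : ℕ) := hd ▸ linearIndependent_pow x
  have : Nonempty (Fin n) := ⟨⟨0, hn ▸ Module.finrank_pos⟩⟩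
  { gen := x
    dim := n
    basis := basisOfLinearIndependentOfCardEqFinrank hli (by simp [hn])
    basis_eq_pow := fun i => by simp }

theorem norm_eq_of_minpoly_eq {n : ℕ} (hn : Module.finrank ℚ F = n) {t : List ℤ}
    (ht : t.length ≤ n) {x : F} (hx : minpoly ℚ x = monicPoly ℚ n t) :
    Algebra.norm ℚ x = (-1) ^ n * (t.headD 0 + (0 : ℚ) ^ n) := by
  have h := Algebra.PowerBasis.norm_gen_eq_coeff_zero_minpoly (powerBasisOfFinrank hn ht hx)
  change Algebra.norm ℚ x = (-1) ^ n * (minpoly ℚ x).coeff 0 at h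
  rw [h, hx, coeff_zero_eq_eval_zero, eval_monicPoly]
  cases t <;> simp [add_comm]

theorem discr_pow_eq_norm {n : ℕ} (hn : Module.finrank ℚ F = n) {t : List ℤ}
    (ht : t.length ≤ n) {x : F} (hx : minpoly ℚ x = monicPoly ℚ n t) :
    Algebra.discr ℚ (fun i : Fin n => x ^ (i : ℕ)) = (-1) ^ (n * (n - 1) / 2) *
      Algebra.norm ℚ (evalCoeffs (CoeffList.derivMonic n t) x) := by
  have h := Algebra.discr_powerBasis_eq_norm ℚ (powerBasisOfFinrank hn ht hx)
  rw [PowerBasis.coe_basis, hn] at h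
  refine Eq.trans h ?_
  congr 2
  change aeval x (derivative (minpoly ℚ x)) = _
  rw [hx, derivative_monicPoly, aeval_def, eval₂_eq_eval_map, ← coe_mapRingHom,
    CoeffList.map_eval, coe_mapRingHom, map_X, eval_evalCoeffs_X]

/-- Discriminant of a family of powers whose last member has been replaced. -/
theorem discr_snoc_eq {n : ℕ} (x y : F) (z : Fin (n + 1) → ℚ)
    (hy : y = ∑ i, z i • x ^ (i : ℕ)) :
    Algebra.discr ℚ (Fin.snoc (fun i : Fin n => x ^ (i : ℕ)) y : Fin (n + 1) → F) =
      z (Fin.last n) ^ 2 * Algebra.discr ℚ (fun i : Fin (n + 1) => x ^ (i : ℕ)) := by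
  have hdet : ((1 : Matrix (Fin (n + 1)) (Fin (n + 1)) ℚ).updateCol (Fin.last n) z).det =
      z (Fin.last n) := by
    rw [← Matrix.cramer_apply, Matrix.cramer_one]; rfl
  rw [← hdet, ← Algebra.discr_of_matrix_vecMul]
  congr 1
  ext j
  simp only [Matrix.vecMul, dotProduct, Matrix.map_apply, Matrix.updateCol_apply]
  refine Fin.lastCases ?_ (fun j => ?_) j
  · rw [Fin.snoc_last, hy]
    refine Finset.sum_congr rfl fun i _ => ?_
    rw [if_pos rfl, Algebra.smul_def, mul_comm]
  · rw [Fin.snoc_castSucc, Finset.sum_eq_single j.castSucc]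
    · simp [(Fin.castSucc_lt_last j).ne]
    · intro i _ hi
      simp [(Fin.castSucc_lt_last j).ne, Matrix.one_apply_ne hi]
    · simp
end

/-- Test that an element with `x ^ (p ^ d) = x` is no root of `X ^ n + t` modulo `p`: then `s`
is the inverse of `X ^ (p ^ d) - X`. -/
def CoeffList.noRootCheck (p n : ℕ) (t : List ℤ) (d : ℕ) (s : List ℤ) : Bool :=
  isZero (red p (add [-1] (mulMod p n t s
    (add [0, -1] (powMod p n t [0, 1] (p ^ d) (p ^ d))))))

section
variable {p : ℕ} [Fact p.Prime] {n : ℕ} {t : List ℤ}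

theorem intCast_adjoinRoot_eq_zero (q : (ZMod p)[X]) : (((p : ℕ) : ℤ) : AdjoinRoot q) = 0 := by
  rw [Int.cast_natCast, ← map_natCast (algebraMap (ZMod p) (AdjoinRoot q)),
      ZMod.natCast_self, map_zero]

theorem root_pow_add_eq_zero {q : (ZMod p)[X]} (h : q ∣ monicPoly (ZMod p) n t) :
    AdjoinRoot.root q ^ n + evalCoeffs t (AdjoinRoot.root q) = 0 := by
  obtain ⟨r, hr⟩ := h
  have := AdjoinRoot.eval₂_root q
  rw [← eval_monicPoly, ← map_monicPoly (AdjoinRoot.of q), hr, Polynomial.map_mul, eval_mul,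
    ← eval₂_eq_eval_map, this, zero_mul]

theorem irreducible_monicPoly (ht : t.length ≤ n) (hn : n ≠ 0) (S : List (List ℤ))
    (h : ∀ d ∈ Finset.Icc 1 (n / 2), CoeffList.noRootCheck p n t d (S.getD (d - 1) []) = true) :
    Irreducible (monicPoly (ZMod p) n t) := by
  have hm : (monicPoly (ZMod p) n t).Monic := monic_monicPoly ht
  have hd : (monicPoly (ZMod p) n t).natDegree = n := natDegree_monicPoly ht
  have h1 : monicPoly (ZMod p) n t ≠ 1 := fun h => hn (by rw [← hd, h, natDegree_one])
  refine (hm.irreducible_iff_lt_natDegree_lt h1).mpr fun q hq hqd hdvd => ?_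
  rw [hd, Finset.mem_Ioc] at hqd
  obtain ⟨r, hr, hrq⟩ := WfDvdMonoid.exists_irreducible_factor
    (not_isUnit_of_natDegree_pos q hqd.1) hq.ne_zero
  have hrd : r.natDegree ∈ Finset.Icc 1 (n / 2) :=
    Finset.mem_Icc.mpr ⟨hr.natDegree_pos, (natDegree_le_of_dvd hrq hq.ne_zero).trans hqd.2⟩
  have hc := h _ hrd
  have : Fact (Irreducible r) := ⟨hr⟩
  have hroot := root_pow_add_eq_zero (hrq.trans hdvd)
  have hp := intCast_adjoinRoot_eq_zero (p := p) r
  have h2 := CoeffList.eval_eq_zero_of_isZero hc (AdjoinRoot.root r)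
  rw [CoeffList.eval_red hp, CoeffList.eval_add, CoeffList.eval_mulMod hp hroot,
    CoeffList.eval_add, CoeffList.eval_powMod hp hroot _ Nat.lt_two_pow_self] at h2
  have h3 : AdjoinRoot.root r ^ p ^ r.natDegree - AdjoinRoot.root r = 0 := by
    have h4 := (hr.natDegree_dvd_iff_dvd_X_pow_card_pow_sub_X).mp (dvd_refl r.natDegree)
    rw [Nat.card_zmod] at h4
    have h5 := AdjoinRoot.mk_eq_zero.mpr h4
    simpa using h5
  simp only [CoeffList.eval_cons, CoeffList.eval_nil] at h2
  push_cast at h2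
  refine one_ne_zero (α := AdjoinRoot r) ?_
  linear_combination -h2 + evalCoeffs (S.getD (r.natDegree - 1) []) (AdjoinRoot.root r) * h3

/-- Coefficients of `X ^ n + t`. -/
def CoeffList.monic (n : ℕ) (t : List ℤ) : List ℤ := add t (List.replicate n 0 ++ [1])

theorem eval_monic {R : Type*} [CommRing R] (n : ℕ) (t : List ℤ) (x : R) :
    evalCoeffs (CoeffList.monic n t) x = x ^ n + evalCoeffs t x := by
  rw [CoeffList.monic, CoeffList.eval_add, evalCoeffs_append, evalCoeffs_replicate_zero]
  simp [add_comm]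

/-- Coefficients of `l ^ e`. -/
def CoeffList.pow (l : List ℤ) : ℕ → List ℤ
  | 0 => [1]
  | e + 1 => mul l (pow l e)

@[simp] theorem CoeffList.eval_pow {R : Type*} [CommRing R] (l : List ℤ) (e : ℕ) (x : R) :
    evalCoeffs (CoeffList.pow l e) x = evalCoeffs l x ^ e := by
  induction e with
  | zero => simp [CoeffList.pow]
  | succ e ih => rw [CoeffList.pow, CoeffList.eval_mul, ih, pow_succ']

theorem eval_eq_mul_eval_ediv {R : Type*} [CommRing R] {l : List ℤ} {p : ℤ}
    (h : l.all (· % p == 0) = true) (x : R) :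
    evalCoeffs l x = p * evalCoeffs (l.map (· / p)) x := by
  induction l with
  | nil => simp
  | cons c l ih =>
    simp only [List.all_cons, Bool.and_eq_true, beq_iff_eq] at h
    rw [CoeffList.eval_cons, ih h.2, List.map_cons, CoeffList.eval_cons]
    conv_lhs => rw [← Int.mul_ediv_cancel' (Int.dvd_of_emod_eq_zero h.1)]
    push_cast; ring

/-- Test for `X ^ N + T = H ^ e W + p K`, where `H = X ^ n + t` is prime to `K` if `e ≥ 2`. -/
def CoeffList.dedekindCheck (p N : ℕ) (T : List ℤ) (n : ℕ) (t : List ℤ) (e : ℕ)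
    (W s : List ℤ) : Bool :=
  (fun d => d.all (· % (p : ℤ) == 0) && (Nat.ble e 1 ||
    isZero (red p (add [-1] (mulMod p n t s (d.map (· / (p : ℤ))))))))
  (add (monic N T) (smul (-1) (mul (pow (monic n t) e) W)))

theorem exists_eq_of_dedekindCheck {N : ℕ} {T : List ℤ} {e : ℕ} {W s : List ℤ}
    (hH : Irreducible (monicPoly (ZMod p) n t))
    (h : CoeffList.dedekindCheck p N T n t e W s = true) :
    ∃ K : ℤ[X], monicPoly ℤ N T = monicPoly ℤ n t ^ e * evalCoeffs W X + C (p : ℤ) * K ∧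
      (e ≤ 1 ∨ ¬ monicPoly (ZMod p) n t ∣ K.map (Int.castRingHom (ZMod p))) := by
  simp only [CoeffList.dedekindCheck, Bool.and_eq_true, Bool.or_eq_true, Nat.ble_eq] at h
  set d := CoeffList.add (CoeffList.monic N T)
    (CoeffList.smul (-1) (CoeffList.mul (CoeffList.pow (CoeffList.monic n t) e) W)) with hd
  refine ⟨evalCoeffs (d.map (· / (p : ℤ))) X, ?_, h.2.imp_right fun h2 hdvd => ?_⟩
  · have h1 := eval_eq_mul_eval_ediv h.1 (X : ℤ[X])
    simp only [hd, CoeffList.eval_add, CoeffList.eval_smul, CoeffList.eval_mul,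
      CoeffList.eval_pow, eval_monic] at h1
    simp only [monicPoly]
    push_cast at h1
    have h2 : (C (p : ℤ) : ℤ[X]) = p := by simp
    rw [h2]
    linear_combination h1
  · have : Fact (Irreducible (monicPoly (ZMod p) n t)) := ⟨hH⟩
    set q := monicPoly (ZMod p) n t
    have hp := intCast_adjoinRoot_eq_zero (p := p) q
    have hroot : AdjoinRoot.root q ^ n + evalCoeffs t (AdjoinRoot.root q) = 0 :=
      root_pow_add_eq_zero (dvd_refl q)
    have h3 := CoeffList.eval_eq_zero_of_isZero h2 (AdjoinRoot.root q)
    rw [CoeffList.eval_red hp, CoeffList.eval_add, CoeffList.eval_mulMod hp hroot] at h3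
    have h4 := AdjoinRoot.mk_eq_zero.mpr hdvd
    have h5 : AdjoinRoot.mk q (map (Int.castRingHom (ZMod p))
        (evalCoeffs (d.map (· / (p : ℤ))) X)) =
        evalCoeffs (d.map (· / (p : ℤ))) (AdjoinRoot.root q) := by
      refine (CoeffList.map_eval ((AdjoinRoot.mk q).comp
        (mapRingHom (Int.castRingHom (ZMod p)))) _ _).trans ?_
      simp
    rw [← h5, h4] at h3
    simp at h3
end

theorem coeff_evalCoeffs {R : Type*} [CommRing R] (l : List ℤ) (i : ℕ) :
    (evalCoeffs l (X : R[X])).coeff i = (l.getD i 0 : ℤ) := by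
  induction l generalizing i with
  | nil => simp
  | cons c l ih =>
    rw [CoeffList.eval_cons, coeff_add, ← C_eq_intCast]
    cases i with
    | zero => simp
    | succ i => rw [coeff_X_mul, ih, coeff_C_succ, zero_add]; simp

theorem CoeffList.isZero_of_eval_eq_zero {p : ℕ} {l : List ℤ}
    (h : evalCoeffs l (X : (ZMod p)[X]) = 0) : isZero (red p l) = true := by
  rw [isZero, List.all_eq_true]
  intro c hc
  obtain ⟨d, hd, rfl⟩ := List.mem_map.mp hc
  obtain ⟨i, hi, rfl⟩ := List.mem_iff_getElem.mp hd
  have := coeff_evalCoeffs (R := ZMod p) l i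
  rw [h, coeff_zero, List.getD_eq_getElem _ _ hi, eq_comm, ZMod.intCast_zmod_eq_zero_iff_dvd] at this
  simpa using Int.emod_eq_zero_of_dvd this

/-- An irreducible factor `X ^ deg + tail` modulo `p` of a polynomial, with the certificates
needed to apply Dedekind's criterion to its power of exponent `exp`. -/
structure LocalFactor where
  deg : ℕ
  tail : List ℤ
  exp : ℕ
  cofactor : List ℤ
  inv : List ℤ
  noRoot : List (List ℤ)

namespace LocalFactor

def check (p N : ℕ) (T : List ℤ) (f : LocalFactor) : Bool :=
  Nat.ble f.tail.length f.deg && Nat.ble 1 f.deg &&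
  (List.range (f.deg / 2)).all (fun d =>
    CoeffList.noRootCheck p f.deg f.tail (d + 1) (f.noRoot.getD d [])) &&
  CoeffList.dedekindCheck p N T f.deg f.tail f.exp f.cofactor f.inv

def differ (p : ℕ) (f g : LocalFactor) : Bool :=
  !(CoeffList.isZero (CoeffList.red p (CoeffList.add (CoeffList.monic f.deg f.tail)
    (CoeffList.smul (-1) (CoeffList.monic g.deg g.tail)))))

noncomputable def poly (p : ℕ) (f : LocalFactor) : (ZMod p)[X] :=
  monicPoly (ZMod p) f.deg f.tail

variable {p N : ℕ} {T : List ℤ} {f g : LocalFactor}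

theorem length_le (h : f.check p N T = true) : f.tail.length ≤ f.deg := by
  simp only [check, Bool.and_eq_true, Nat.ble_eq] at h
  exact h.1.1.1

theorem monic_poly (h : f.check p N T = true) : (f.poly p).Monic :=
  monic_monicPoly (length_le h)

variable [Fact p.Prime]

theorem natDegree_poly (h : f.check p N T = true) : (f.poly p).natDegree = f.deg :=
  natDegree_monicPoly (length_le h)

theorem irreducible_poly (h : f.check p N T = true) : Irreducible (f.poly p) := by
  have h0 := length_le h
  simp only [check, Bool.and_eq_true, Nat.ble_eq, List.all_eq_true, List.mem_range] at h
  refine irreducible_monicPoly h0 (by omega) f.noRoot fun d hd => ?_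
  rw [Finset.mem_Icc] at hd
  have := h.1.2 (d - 1) (by omega)
  rwa [Nat.sub_add_cancel hd.1] at this

theorem isCoprime_pow (hf : f.check p N T = true) (hg : g.check p N T = true)
    (h : differ p f g = true) (a b : ℕ) : IsCoprime (f.poly p ^ a) (g.poly p ^ b) := by
  refine IsCoprime.pow (((irreducible_poly hf).coprime_iff_not_dvd).mpr fun hdvd => ?_)
  have h1 : f.poly p = g.poly p := eq_of_monic_of_associated (monic_poly hf) (monic_poly hg)
    ((irreducible_poly hf).associated_of_dvd (irreducible_poly hg) hdvd)
  have h2 := CoeffList.isZero_of_eval_eq_zero (p := p)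
    (l := CoeffList.add (CoeffList.monic f.deg f.tail)
      (CoeffList.smul (-1) (CoeffList.monic g.deg g.tail))) (by
    rw [CoeffList.eval_add, CoeffList.eval_smul, eval_monic, eval_monic]
    change f.poly p + _ * g.poly p = 0
    rw [h1]; push_cast; ring)
  simp [differ, h2] at h

variable {S : Type*} [CommRing S] [IsDomain S] [CharZero S] [Algebra.IsIntegral ℤ S] {θ : S}

theorem pow_dvd (hm : ∀ P : ℤ[X], aeval θ P = 0 → monicPoly ℤ N T ∣ P)
    (hθ : θ ^ N + evalCoeffs T θ = 0) (h : f.check p N T = true) {B : ℤ[X]} {γ : S}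
    (hB : aeval θ B = p * γ) :
    f.poly p ^ f.exp ∣ B.map (Int.castRingHom (ZMod p)) := by
  have hirr := irreducible_poly h
  simp only [check, Bool.and_eq_true] at h
  obtain ⟨K, hK, hK2⟩ := exists_eq_of_dedekindCheck hirr h.2
  have h1 : (monicPoly ℤ f.deg f.tail).map (Int.castRingHom (ZMod p)) = f.poly p :=
    map_monicPoly _ _ _
  rw [← h1]
  refine pow_dvd_map_of_aeval_eq_mul hm ?_ (h1 ▸ hirr) hK (hK2.imp_right fun h2 => ?_) hB
  · rw [aeval_def, eval₂_eq_eval_map, map_monicPoly, eval_monicPoly, hθ]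
  · rwa [h1]

/-- Consequence of Dedekind's criterion at all irreducible factors modulo `p`. -/
theorem prod_pow_dvd (hm : ∀ P : ℤ[X], aeval θ P = 0 → monicPoly ℤ N T ∣ P)
    (hθ : θ ^ N + evalCoeffs T θ = 0) {B : ℤ[X]} {γ : S} (hB : aeval θ B = p * γ)
    {L : List LocalFactor} (hL : ∀ f ∈ L, f.check p N T = true)
    (hd : L.Pairwise fun f g => differ p f g = true) :
    (L.map fun f : LocalFactor => f.poly p ^ f.exp).prod ∣ B.map (Int.castRingHom (ZMod p)) := by
  induction L with
  | nil => simp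
  | cons f L ih =>
    rw [List.map_cons, List.prod_cons]
    rw [List.pairwise_cons] at hd
    have hf := hL f (by simp)
    have hL' : ∀ f ∈ L, f.check p N T = true := fun g hg => hL g (by simp [hg])
    refine IsCoprime.mul_dvd ?_ (pow_dvd hm hθ hf hB) (ih hL' hd.2)
    have h1 := hd.1
    clear ih hd hL
    induction L with
    | nil => simpa using isCoprime_one_right
    | cons g L ih =>
      rw [List.map_cons, List.prod_cons]
      exact (isCoprime_pow hf (hL' g (by simp)) (h1 g (by simp)) _ _).mul_right
        (ih (fun g hg => hL' g (by simp [hg])) fun g hg => h1 g (by simp [hg]))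

theorem map_eq_zero_of_aeval_eq_mul (hm : ∀ P : ℤ[X], aeval θ P = 0 → monicPoly ℤ N T ∣ P)
    (hθ : θ ^ N + evalCoeffs T θ = 0) {B : ℤ[X]} {γ : S} (hB : aeval θ B = p * γ)
    {L : List LocalFactor} (hL : ∀ f ∈ L, f.check p N T = true)
    (hd : L.Pairwise fun f g => differ p f g = true)
    (hdeg : B.natDegree < (L.map fun f => f.exp * f.deg).sum) :
    B.map (Int.castRingHom (ZMod p)) = 0 := by
  refine eq_zero_of_dvd_of_natDegree_lt (prod_pow_dvd hm hθ hB hL hd)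
    (natDegree_map_le.trans_lt (hdeg.trans_eq ?_))
  clear hdeg hd
  induction L with
  | nil => simp
  | cons f L ih =>
    have hmon : (L.map fun f : LocalFactor => f.poly p ^ f.exp).prod.Monic :=
      by
      clear ih
      have hL' : ∀ f ∈ L, f.check p N T = true := fun f hf => hL f (by simp [hf])
      clear hL
      induction L with
      | nil => simp
      | cons f L ih =>
        rw [List.map_cons, List.prod_cons]
        exact ((monic_poly (hL' f (by simp))).pow _).mul (ih fun f hf => hL' f (by simp [hf]))
    have hf := hL f (by simp)
    rw [List.map_cons, List.map_cons, List.sum_cons, List.prod_cons,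
      ((monic_poly hf).pow _).natDegree_mul hmon, (monic_poly hf).natDegree_pow,
      natDegree_poly hf, ih fun f hf => hL f (by simp [hf])]

end LocalFactor

/-- Homogenisation: `c` times the value at `x` is `c ^ l.length` times the value of `l` at
`a(x) / c`. -/
def CoeffList.homog (N : ℤ) (n : ℕ) (t : List ℤ) (c : ℤ) (a : List ℤ) : List ℤ → List ℤ
  | [] => []
  | p :: l => add [p * c ^ l.length] (mulMod N n t a (homog N n t c a l))

theorem CoeffList.mul_eval_homog {R : Type*} [CommRing R] {N : ℤ} (hN : (N : R) = 0) {n : ℕ}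
    {t : List ℤ} {x : R} (hx : x ^ n + evalCoeffs t x = 0) {c : ℤ} {a : List ℤ} {α : R}
    (hα : c * α = evalCoeffs a x) (l : List ℤ) :
    c * evalCoeffs (homog N n t c a l) x = c ^ l.length * evalCoeffs l α := by
  induction l with
  | nil => simp [homog]
  | cons p l ih =>
    rw [homog, CoeffList.eval_add, CoeffList.eval_mulMod hN hx]
    simp only [CoeffList.eval_cons, CoeffList.eval_nil, List.length_cons, pow_succ]
    push_cast
    linear_combination evalCoeffs a x * ih - c ^ l.length * evalCoeffs l α * hα

/-- The element `coeffs(x) / den`, a root of `X ^ n + tail`. -/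
structure ScaledElement where
  den : ℤ
  coeffs : List ℤ
  tail : List ℤ

namespace ScaledElement

def check (n : ℕ) (t : List ℤ) (e : ScaledElement) : Bool :=
  !(e.den == 0) && Nat.ble e.tail.length n &&
  CoeffList.isZero (CoeffList.homog 0 n t e.den e.coeffs (CoeffList.monic n e.tail))

variable {E : Type*} [Field E]

/-- The value of a scaled element. -/
noncomputable def val (e : ScaledElement) (x : E) : E := evalCoeffs e.coeffs x / e.den

variable [CharZero E] {n : ℕ} {t : List ℤ} {e : ScaledElement} {x : E}

theorem den_mul_val (h : e.check n t = true) (x : E) : e.den * e.val x = evalCoeffs e.coeffs x := by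
  simp only [check, Bool.and_eq_true, Bool.not_eq_true', beq_eq_false_iff_ne] at h
  exact mul_div_cancel₀ _ (Int.cast_ne_zero.mpr h.1.1)

theorem val_root (h : e.check n t = true) (hx : x ^ n + evalCoeffs t x = 0) :
    e.val x ^ n + evalCoeffs e.tail (e.val x) = 0 := by
  have h1 := CoeffList.mul_eval_homog (N := 0) (by simp) hx (den_mul_val h x)
    (CoeffList.monic n e.tail)
  simp only [check, Bool.and_eq_true, Bool.not_eq_true', beq_eq_false_iff_ne] at h
  rw [CoeffList.eval_eq_zero_of_isZero h.2, mul_zero, eval_monic, eq_comm] at h1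
  exact (mul_eq_zero.mp h1).resolve_left (pow_ne_zero _ (Int.cast_ne_zero.mpr h.1.1))

theorem length_le (h : e.check n t = true) : e.tail.length ≤ n := by
  simp only [check, Bool.and_eq_true, Nat.ble_eq] at h
  exact h.1.2

theorem isIntegral_val (h : e.check n t = true) (hx : x ^ n + evalCoeffs t x = 0) :
    IsIntegral ℤ (e.val x) :=
  ⟨monicPoly ℤ n e.tail, monic_monicPoly (length_le h), by
    rw [eval₂_eq_eval_map, map_monicPoly, eval_monicPoly, val_root h hx]⟩

end ScaledElement

theorem coe_evalCoeffs {F : Type*} [Field F] (l : List ℤ) (θ : 𝓞 F) :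
    ((evalCoeffs l θ : 𝓞 F) : F) = evalCoeffs l (θ : F) :=
  CoeffList.map_eval (algebraMap (𝓞 F) F) l θ

section
variable {F : Type*} [Field F] [CharZero F] {n : ℕ} {t : List ℤ}

theorem root_of_minpoly {x : F} (hx : minpoly ℚ x = monicPoly ℚ n t) :
    x ^ n + evalCoeffs t x = 0 := by
  have := minpoly.aeval ℚ x
  rwa [hx, aeval_def, eval₂_eq_eval_map, map_monicPoly, eval_monicPoly] at this

theorem monicPoly_dvd_of_aeval_eq_zero (ht : t.length ≤ n) {θ : 𝓞 F}
    (hθ : minpoly ℚ (θ : F) = monicPoly ℚ n t) (P : ℤ[X]) (hP : aeval θ P = 0) :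
    monicPoly ℤ n t ∣ P := by
  rw [← minpoly_int_eq_of_rat ht hθ (root_of_minpoly hθ)]
  refine minpoly.isIntegrallyClosed_dvd (RingOfIntegers.isIntegral_coe θ) ?_
  have := aeval_algebraMap_apply F θ P
  rw [hP, map_zero] at this
  exact this

theorem ringOfIntegers_root {θ : 𝓞 F} (hθ : minpoly ℚ (θ : F) = monicPoly ℚ n t) :
    θ ^ n + evalCoeffs t θ = 0 := by
  have := root_of_minpoly hθ
  apply RingOfIntegers.coe_injective
  rw [map_add, map_pow, map_zero, ← this]
  exact congrArg _ (coe_evalCoeffs t θ)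
end

/-- The element `θ` of `ℚ(x)`, where `f(x) = 0`. -/
def thetaData : ScaledElement where
  den := 1485266179489269630618512691311537288254891292892923314500
  coeffs :=
    [-2112594858574761498024960389755157167796678259547446606402,
    -78340010690819269674729791862571221358298481881440949194497,
    37841710313518907460791264528616896326373062631697037279731,
    -8674871555446086845100946175879467449652848153277705362681,
    -42982017072112303737859157333855920162233494565842058060891,
    1052996050643147348626433320539374583831172419824380684308,
    -11246556939299656493090946128842172805874118498904915584688,
    -4782779926715120973699735617015636793511586722951605010647,
    2329539473235297469030448637088397824428959811104336674010,
    307291097249920121470494556226788138610954284029062806259,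
    59215012946876320985812464728567002191812961546881801626,
    -166892596885380593774346918239711651744542658631298303409,
    -5316946382881985928039430186116841647742322882216377974,
    16322080454986274190395561690078322337438941464709512358,
    131205015294747974486593572812732734302481980275161033,
    -3958522016338945013830807346685923189851194775551232451,
    -11825719958027624883447195072940498031531900352914302,
    363501179151177784791865307046131641429014955083796130,
    1316763747739024944668821934634872909090713299196563,
    -37662811138010524474832252851798635267289029544837065,
    -58321153352691322228019895653503857687671970319225,
    1673912813864162755628324280362219560580871121172666,
    2794571446621464021633222030743189746270869798835,
    -76043592383991663940976039305177837549955861811911]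
  tail :=
    [263817, 971079, 1955725, 2440625, 2259444, 1242923, 170632, -570240, -330297, 33825, 530706,
    324114, 183417, -50232, -33506, -27973, 5082, 1749, 1881, -264, 11, -11, 24, 5]

/-- The element `η`, in terms of `θ`. -/
def etaData : ScaledElement where
  den := 640151391314518837592370338097555487874282566122434357079032480844729974107595483175
  coeffs :=
    [1743994700124269262984976021719303904385017901257904930324670721894706971681941140634,
    8481199996797609958971755590637275401634367855662459661001033458620790335696696621900,
    14296305162867295213163078650762683991449748793608300806712015556452164688171622030975,
    17928845629685928315888468944192184929972287108353481672550706293942045151215939409075,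
    12442982801771883750855861761539143499479511504247140629839510351897929848237538986038,
    8810474219433017028567399496314387142844328197973117407662077449288996211250440050740,
    -4954934593879015099152717654877787661996456590627239785633586636209159169881484901166,
    -880729946306536296197504156081398179462060888691090977056037315196946179138240926213,
    -5923232691490699069715657447970388717726856438136044025566394372000606998897173784538,
    5268060815522978730915677636962977862554451733352727628642858583135106998786419371731,
    1433013116353944243715008072134489906887202978556195164393683053098917616443046364690,
    3634132646081724754322819904870038352139628042719939118163956922240851922377531373123,
    -586075048450214585121284939142456365657270963379215278392566463542043465456534788967,
    27458674864813888758511219523532977280905054682878514087301793232126145769071511665,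
    -539387649887815029246957359854245056536522776017148963934476504104520195994380683467,
    76473899588236182449652365051690100535195493843190069394703620535118443095263070083,
    -9767635766971094672154352449745141525192237172073573454731798734828421103214270607,
    35986390662331864548863581659761567011773220465756332522758971829474427450454880007,
    -4791637210916061002998721564626289153914949176528777445698592072630750837699384097,
    674708082592681263009437149433294544738546973618046862657789058883130134766853736,
    -567231433493983756069582720576119978450299871132069692340956909538810393920109635,
    313963777590024111423804743635315298239475124330726172089124100629827965607295248,
    63478722674094834319345827774961115654727574295554886885436559578087111271151972,
    16422123085169377256143613209863541089809130792086662539261980163803750971553521]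
  tail :=
    [2187, 12879, 39366, 80190, 130977, 188001, 231660, 231363, 185031, 123255, 70488, 33669,
    22086, 32502, 38907, 24486, 3267, -5214, -2607, 165, 363, 33, -25, -3]

/-- The element `ξ`, in terms of `x`. -/
def xiData : ScaledElement where
  den := 495088726496423210206170897103845762751630430964307771500
  coeffs :=
    [-5497837891842897877582147803421866953746255541883006048,
    -638591788905351193000488838408473089512462290032638962306,
    1395050094682858372639417829784676835912917021191847598115,
    -1025969021775971282395726441665018293137004418922715016522,
    164586428830475538816486199330162919228406448134008845485,
    320702982369073867209572851542412552572178223644998208896,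
    -161992873372024233200108026175237617525057588286292918480,
    151928489195261795328441732332341513416219332076444850998,
    -46212143831559633144691709467487941579582965367245908501,
    7082886184698587657687708717863559490521650301184654117,
    -4421917851809759252234786124894402115814379265195112808,
    1638528221025862161258863991584974828820912574121994582,
    116785845103551125924687012255760459188062480797680491,
    -4360804561570144571312013906211616288684532921746929,
    -85878337884092693014020499945671818848576872159188591,
    35777759207576419521296974166347391545866673215873316,
    6788117550293177195450911779502149112421377627064803,
    -2662690788763530153811119849390476933774026272676581,
    -988758343387221060127976368594522142008610307731747,
    413113904255254389596101983836028836828992874529344,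
    42671751361008114849764729829029796339043820653251,
    -17556339150021400780108210931495366365685945042234,
    -2415098207058789139668140381994532356514715259194,
    1033394964394530270739022636381089923917339122597]
  tail :=
    [121, -6292, 306614, -9284693, 299142129, -7752617136, 148477812560, -1658604448259,
    9969842199196, 14930544243351, 25403775586607, 19394173950503, 10979458778849, 3840748233707,
    1109361263813, 199682622150, 28763126095, 2422968955, 155524358, 4144932, 55737, -6941, 176,
    11]

/-- The element `v`, in terms of `x`. -/
def traceData : ScaledElement where
  den := 1485266179489269630618512691311537288254891292892923314500
  coeffs :=
    [8078838884322509980774958061183391529747329855375822383180,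
    315499425628891264934687646860572605575048568581826951836574,
    -145789162338757750608739532102231761354365067503363739753041,
    40939858058377527037256838652792858657882737483475538607027,
    173515082041724435190194542950842319049046774940774937802553,
    -2610567180239849078145619169925361037290484442287574295848,
    45245460910185106177976065593107563554064734866332443893502,
    18682731007120665521383839482909623083944833279077473486112,
    -9309797467782462641812278004250771010971257080034355813861,
    -1215616124467708751883393025730236505003745201972933828348,
    -214032117108589774652294638236855515585128644869069742193,
    664089212338801030619001948920334810908403853103302459845,
    19500098769136019884880161015155627045700516859799188886,
    -64647518279669087494147307846863082938422087536184864633,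
    -14308391098980935058656897823489147475453615212397123,
    15741578791882243450420506348701523982396291428649551795,
    1572692609912962991280993821738480357055987023961487,
    -1445301301248517179149250443104035613076553268057169361,
    -159037394826959801304009379610700479896683258863838,
    149983427134941578454597458403039105267064001289261189,
    7508603043861284460853935583232002418594331534142,
    -6666287185767090967120572065771819611340459062003290,
    -313594759237237538022249425452194951100514726425,
    303187342209116157737511639806659965797744784688911]
  tail :=
    [1115505544430997, -1850331716065386, 2266879350522384, -1266311768430951, 795161487638727,
    -353355507140724, 153236687214996, -55263852240597, 18344831848794, -4794877089783,
    1042446682233, -156783475215, 15080575863, 1200805341, -782147619, 232249600, -42970763,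
    6217013, -383702, -42394, 20053, -3201, 356, -23]

/-- The element `(v ^ 2 - ξ) / 4`, in terms of `x`. -/
def normData : ScaledElement where
  den := 1485266179489269630618512691311537288254891292892923314500
  coeffs :=
    [-1928779455124721860809207179180358292437972076807182678513,
    215579232825242943097308686624427893587289251461699900544809,
    -101742027301457285279618685652822005030445766225702469362181,
    24080763482749121324194884134940740126316237081847797424404,
    116447611246262417585974992731948362973507059082850393535980,
    -2997110177314931330676600740688866410300866058787789144961,
    30907620666840635874483549184769786722814558316705385842816,
    12865348653920337719784915770266511066025888504935184681303,
    -6319323870531318379779721800135913568783336648851974780294,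
    -846654268758877800559168957246382533051075994463023243578,
    -152265061237796498465871793688182226281693205381193100611,
    453403407262380566756142075064459334853716770711719293335,
    13796193598690484655919876582882575660988917871402285260,
    -44466452788553121835464982314677361449829908368982520351,
    -179239216772950080373600257749944029720557908367876160,
    10749505568306848412040798691844122985649570001773504916,
    17381745198788625358500436451046885536273111071008783,
    -987543495322998250111662940953152627279657168390822119,
    -1908692382047563321805543070183462103449809780553042,
    102196395509347711667411394465837179904791735334071466,
    86813244704395273991292457706794575756486166940046,
    -4542657293527932257235051485587845389538999703758097,
    -4024210635609707559506485570177704218445550087713,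
    206164135234230057690932015604203596642225937251375]
  tail :=
    [43884350512631091, 62359717581434217, 33089527946171621, 3778371589903790, -7033596444341544,
    -2977044204182994, 292452013359099, 74913368803284, -13383845504975, 1664603971888,
    4067951311545, 898152696088, 28019053921, -33013672737, -6545202565, 348347351, 468754935,
    128827193, 22880957, 2912646, 287991, 21252, 1167, 43]

/-- The element `1485266179489269630618512691311537288254891292892923314500 w` with `w ^ 2 = ξ x`, in terms of `x`. -/
def rootCoeffs : List ℤ :=
  [59062122498204851788410579790639521215860170556656915744,
  1238281417003300049511875111166499361992128748051286476203,
  -641512742093366459781743636964879710139966607314496408344,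
  314451513342939293440247136483855613165981471166467384650,
  843834417156779635059303628572758385107563420451302952340,
  -33123344911381441420051745832737696654319499528759278861,
  46328585461720076094280617929732914813488669556490044509,
  174312771336297199114852257497794113158688343941447917796,
  -51375979807292173190690316891581394376261038092273409204,
  -2239689402085936165136686185851659417230739666297086026,
  -5170514406911003680200945922376457005910232232210010378,
  3741985496419522287662764388535377708234653117388834366,
  411824871247628747665276094415013193155454857850422473,
  -293968250100325078367296193977776804082192989855860481,
  -83824696927650240760609099554601742686823942044697253,
  85016207810935307329859675764841580263223509217670397,
  7064228105234578519816417687267357778421413656176906,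
  -7419038194070108558143263696485701108289145689620199,
  -790542467769748687353098500604686889369342123165049,
  827776450128784491889190302597086344814358892455896,
  34151239841155815721949635796744919973644574662162,
  -36227473290124110094362913753117630680687712871480,
  -1676336676750719418746820852921965571617183211939,
  1755251702606174932071584349963950629766795579801]

/-- Characteristic polynomial of the different of `θ`. -/
def thetaDiffTail : List ℤ :=
  [38589977217914584689283348445412110561514905933561835543110528372238644374784095169013258086203394472889066786575636908181632581536160093453151997422675401416314971572859320563757206097661759915344714240000,
  0,
  -102190041582495297067355419268478125792113607924512383362568388535155056424949428857620547623128721844900018369828886768070729174704160547455381715906318489739084380985684721825083405199816884224,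
  -4840771649888700542854720154326525584610672118679585864726123610575788645390205577606350490695659940714021956871949885110601188929152393835898520382684001322600868262817198403527458739550208,
  24096757069264750173490831708633413455810424592702092280699034252202072667483795929193616148456031458158905968532650441581793194605981382223770230429410422140365357573948916557959285760,
  -20254230650171249721276047525803161845968943989088029489504742366159642075313486913935677357129728362573893622923438376023014622147278804176732268027066198627503612239877152957952,
  31063363462971907625685220393058925029988889988117144807527729739218719833411775680962805760168831218146675327434214445108840992751826562347404470946323975317160606639190016,
  -11343234523794740173049806771472003776779983663777066578271678633668088285717765839899022984891286748144061018211377681250499797988364913976836623046427137791144278528,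
  1497667643743825998325020175301713104558813632868661831161089845786932818030935101966876946003590736705377756021785642866148645624661408360424028357706990669312,
  79557507247198667456878865032566290191059605922674534689259750766424624419757045196710917128225815679222804055861798878792404355496945999740933732380416,
  21548992123841913382037603588510706009151568396839134648741203666942428748629973034237061126463149160615587980952458282469722594942337533427313088,
  991979118638133016268463375793350153890394773270819735082888773690707112196797134248038845056215180580671383721478494294231896831424468064,
  17759445917953720017699181447425823706563636862671544392633809312653230406539899452513666714102153224498003781726562743305680318576,
  151225174934853503403588766428495735319251732214971747708715054945685247917596516668423462774130018925838169779529981262256,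
  632251946107527669252937282314052515008397226095408816374672024774435996573599403043145701975599157321502607885736,
  630158709477452797447991606909204482113489775987231856471022262251011909369332072965079707721945739530176,
  202781406106717317401882337616039802691701442261428535347618644443925423488769620119457607201740,
  -45819165937662406361218487100221337316379155842788385643799239344760959587326276907172,
  4927747527231351238025923075605939233185275676487212453704142628253215908431,
  -359037573130712187961163671483378510401026357716567119512504037156,
  10691028066156631912499868317835006315703952192008666083,
  9936699291701442445226291986843403709099786, 3681008069369196872828757434958, -3821410572872134]

/-- Characteristic polynomial of the different of `η`. -/
def etaDiffTail : List ℤ :=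
  [12273265743618102631925757128896548255883646277426000841451641519535645277534675681880762975296340656494257622455203250666317465301752288068078119958270939136,
  0,
  -5994588298655068237302298314354555066029870286849003511002141767464189715570489948268007677018182999566712293851951951198110559953176572907452258269184,
  2314756672622155186298713752901167835729780587887137043455394443848263464053661619009363260573363169624756809976086996149936764211206536929044023296,
  1641998524734490972521264410763542932655790244071327200973650086279979849630506276227920215015452614412263205656112940098021923550173296999566336,
  -257387068606593330440174025012247758086054972208186712803592084182505954679344592521578541715239313747966600157639676156411560838950239053824,
  90724881748532734581971067208674288242754055525542211220089067509291520876141130962734604198305304416188088378377220186196242180976227584,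
  700910834611535531491322682412264391130913713059389484006597483009808141769817989272118320913256578699817594585943367087670756567040,
  258218715539225389505773975090691358125100649145951082877420075735624491596634263079055893121988573953928087382033316302277254912,
  7299756287755581075579211539288336016929254439823289950985015871836650525345265331232569085866077690383772084819422878084864,
  -124071744790201488011801264584649672815440908207789356519503569517164341806992287568898726444194580984168853068149075904,
  -2099341680016932945816541712742292489829215059533856980526093702627748437549835172414757889012077075446717675527488,
  26653954689407564396661238727634705223026227828153018361390461787128488004409939386160497955183340540301497920,
  104478257497035353187073962883057912676763908569830201493129966686362819764291788012916149573071969483712,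
  1012707184623539799838145634204714841195664461500495590673773435143992379643769364159710361707605448,
  49019445259850998627137181650482366391749454982902911214804578768648231949626689702936260936,
  -4623583920239075341477349346376280217065601559728958800726222009746298131568548584020,
  -127819034449095723283489172452338596641038269365686422179900244575487745564054,
  6975718672821165608815912043415865210436980419393449879969685504523497,
  7236681107633608070129540685490921353961295703352371784881858,
  1986588842381469740888040254310783323358379715297151, 1551469926497466430222007995386595946070,
  331470363176651999726287763, 9061738927725]

/-- Inverse of `thetaData` modulo 13. -/
def thetaInv : List ℤ :=
  [11, 8, 6, 6, 12, 12, 1, 9, 7, 1, 1, 11, 0, 9, 4, 6, 2, 11, 4, 9, 7, 10, 3, 5]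

/-- Inverse of `etaData` modulo 2. -/
def etaInv : List ℤ :=
  [0, 0, 0, 0, 1, 0, 1, 0, 0, 0, 0, 0, 1, 1, 0, 0, 0, 0, 1, 1, 1, 1, 1, 1]

/-- Inverse of `xiData` modulo 13. -/
def xiInv : List ℤ :=
  [10, 10, 8, 4, 9, 12, 9, 0, 1, 12, 5, 11, 1, 4, 5, 1, 7, 1, 1, 10, 8, 6, 2, 8]

/-- Inverse of the different of `θ` modulo 7. -/
def thetaDiffInv : List ℤ :=
  [3, 5, 3, 6, 0, 3, 6, 0, 5, 1, 0, 3, 3, 2, 1, 5, 4, 4, 0, 1, 5, 2, 1, 5]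

/-- Inverse of the different of `η` modulo 7. -/
def etaDiffInv : List ℤ :=
  [5, 3, 5, 6, 2, 6, 0, 6, 5, 1, 4, 2, 3, 2, 0, 6, 2, 0, 4, 1, 6, 1, 3, 5]

/-- Factors modulo 2 of the minimal polynomial of `θ`. -/
def thetaFactors2 : List LocalFactor :=
  [{ deg := 6, tail := [1, 0, 1, 0, 1, 1], exp := 3, cofactor := [1, 1, 0, 0, 0, 0, 1], inv :=
    [0, 1, 1, 1], noRoot := [[0, 1, 1, 0, 1], [0, 0, 1, 0, 0, 1], [1, 0, 1, 0, 1, 1]] },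
    { deg := 6, tail := [1, 1, 0, 0, 0, 0], exp := 1, cofactor := [1, 0, 1, 0, 0, 1, 0, 0, 0, 1,
    1, 0, 1, 1, 1, 1, 0, 1, 1], inv := [], noRoot := [[1, 1, 1, 1, 1], [1, 1, 0, 0, 1, 1], [0, 1,
    1, 0, 1]] }]

/-- Factors modulo 3 of the minimal polynomial of `θ`. -/
def thetaFactors3 : List LocalFactor :=
  [{ deg := 1, tail := [0], exp := 1, cofactor := [0, 1, 2, 0, 2, 1, 0, 0, 0, 0, 0, 0, 0, 1, 2,
    0, 0, 0, 0, 2, 1, 0, 2, 1], inv := [], noRoot := [] },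
    { deg := 1, tail := [2], exp := 1, cofactor := [0, 0, 2, 0, 0, 1, 0, 0, 0, 0, 0, 0, 0, 0, 2,
    0, 0, 0, 0, 0, 1, 0, 0, 1], inv := [], noRoot := [] },
    { deg := 1, tail := [1], exp := 9, cofactor := [0, 0, 1, 2, 0, 2, 1, 0, 0, 0, 0, 2, 1, 0, 2,
    1], inv := [2], noRoot := [] },
    { deg := 2, tail := [1, 0], exp := 3, cofactor := [0, 0, 1, 2, 0, 2, 1, 0, 2, 1, 0, 1, 2, 0,
    2, 1, 0, 2, 1], inv := [1], noRoot := [[0, 2]] },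
    { deg := 2, tail := [2, 1], exp := 3, cofactor := [0, 0, 2, 1, 0, 0, 0, 0, 2, 1, 0, 2, 1, 0,
    0, 0, 0, 2, 1], inv := [1], noRoot := [[1, 2]] }]

/-- Factors modulo 11 of the minimal polynomial of `θ`. -/
def thetaFactors11 : List LocalFactor :=
  [{ deg := 2, tail := [2, 5], exp := 12, cofactor := [1], inv := [3], noRoot := [[1, 7]] }]

/-- The element `(den / 3) θ η` in terms of `θ`. -/
def thetaEtaCoeffs : List ℤ :=
  [-87939, 581331566708089754328325340573101301461672633752634976774890240631568990560646723185,
  2827066665599203319657251863545758467211455951887486553667011152873596778565564888725,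
  4765435054289098404387692883587561330483249597869433602237338518817388229390539863450,
  5976281876561976105296156314730728309990762369451160557516902097980681717071979049877,
  4147660933923961250285287253846381166493170501415713543279836783965976616079179247705,
  2936824739811005676189133165438129047614776065991039135887359149762998737083479960036,
  -1651644864626338366384239218292595887332152196875746595211195545403053056627161443642,
  -293576648768845432065834718693799393154020296230363659018679105065648726379413531972,
  -1974410897163566356571885815990129572575618812712014675188798124000202332965724606121,
  1756020271840992910305225878987659287518150577784242542880952861045035666262139613675,
  477671038784648081238336024044829968962400992852065054797894351032972538814348680192,
  1211377548693908251440939968290012784046542680906646372721318974080283974125843729902,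
  -195358349483404861707094979714152121885756987793071759464188821180681155152178246245,
  9152891621604629586170406507844325760301684894292838029100597744042048589690515057,
  -179795883295938343082319119951415018845507592005716321311492168034840065331460218498,
  25491299862745394149884121683896700178398497947730023131567873511706147698421021667,
  -3255878588990364890718117483248380508397412390691191151577266244942807034404757452,
  11995463554110621516287860553253855670591073488585444174252990609824809150151626042,
  -1597212403638687000999573854875429717971649725509592481899530690876916945899794611,
  224902694197560421003145716477764848246182324539348954219263019627710044922284575,
  -189077144497994585356527573525373326150099957044023230780318969846270131306703208,
  104654592530008037141268247878438432746491708110242057363041366876609321869098408,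
  21159574224698278106448609258320371884909191431851628961812186526029037090383989,
  5474041028389792418714537736621180363269710264028887513087326721267916990517840]

/-- Certificate that `θ` lies in the primes containing `3` and `η - 1`. -/
def thetaPowCoeffs1 : List ℤ :=
  [1, 1, 1, 1, 2, 0, 0, 1, 0, 2, 1, 2, 1, 1, 1, 1, 0, 0, 0, 1, 1, 2]

/-- Certificate that `θ` lies in the primes containing `3` and `η - 2`. -/
def thetaPowCoeffs2 : List ℤ :=
  [1, 1, 0, 2, 1, 0, 2, 2, 1, 0, 2, 1, 1, 0, 0, 0, 1, 2, 2, 1, 1, 1]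

section
set_option maxRecDepth 100000

theorem thetaData_check : thetaData.check 24 fTail = true := by decide +kernel

theorem etaData_check : etaData.check 24 thetaData.tail = true := by decide +kernel

theorem xiData_check : xiData.check 24 fTail = true := by decide +kernel

theorem traceData_check : traceData.check 24 fTail = true := by decide +kernel

theorem normData_check : normData.check 24 fTail = true := by decide +kernel

theorem thetaFactors2_check : ∀ f ∈ thetaFactors2, f.check 2 24 thetaData.tail = true := by
  decide +kernel

theorem thetaFactors3_check : ∀ f ∈ thetaFactors3, f.check 3 24 thetaData.tail = true := by
  decide +kernel

theorem thetaFactors11_check : ∀ f ∈ thetaFactors11, f.check 11 24 thetaData.tail = true := by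
  decide +kernel

theorem thetaDiff_root_check : CoeffList.isZero (CoeffList.homog 0 24 thetaData.tail 1
    (CoeffList.derivMonic 24 thetaData.tail) (CoeffList.monic 24 thetaDiffTail)) = true := by
  decide +kernel

theorem etaDiff_root_check : CoeffList.isZero (CoeffList.homog 0 24 etaData.tail 1
    (CoeffList.derivMonic 24 etaData.tail) (CoeffList.monic 24 etaDiffTail)) = true := by
  decide +kernel

theorem thetaInv_check : CoeffList.isZero (CoeffList.red (13 : ℕ)
    (CoeffList.add (CoeffList.compMod (13 : ℕ) 24 fTail thetaInv thetaData.coeffs) [0, -1])) =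
    true := by decide +kernel

theorem xiInv_check : CoeffList.isZero (CoeffList.red (13 : ℕ)
    (CoeffList.add (CoeffList.compMod (13 : ℕ) 24 fTail xiInv xiData.coeffs) [0, -1])) =
    true := by decide +kernel

theorem etaInv_check : CoeffList.isZero (CoeffList.red (2 : ℕ)
    (CoeffList.add (CoeffList.compMod (2 : ℕ) 24 thetaData.tail etaInv etaData.coeffs) [0, -1])) =
    true := by decide +kernel

theorem thetaDiffInv_check : CoeffList.isZero (CoeffList.red (7 : ℕ)
    (CoeffList.add (CoeffList.compMod (7 : ℕ) 24 thetaData.tail thetaDiffInv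
      (CoeffList.derivMonic 24 thetaData.tail)) [0, -1])) = true := by decide +kernel

theorem etaDiffInv_check : CoeffList.isZero (CoeffList.red (7 : ℕ)
    (CoeffList.add (CoeffList.compMod (7 : ℕ) 24 etaData.tail etaDiffInv
      (CoeffList.derivMonic 24 etaData.tail)) [0, -1])) = true := by decide +kernel

theorem thetaEta_check : CoeffList.isZero (CoeffList.add (0 :: etaData.coeffs)
    (CoeffList.smul (-1) (CoeffList.add (CoeffList.monic 24 thetaData.tail)
      (CoeffList.smul 3 thetaEtaCoeffs)))) = true := by decide +kernel

theorem thetaPow1_check : CoeffList.isZero (CoeffList.red (3 : ℕ) (CoeffList.add [0, -1]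
    (CoeffList.mulMod (3 : ℕ) 24 thetaData.tail thetaPowCoeffs1
      (CoeffList.add thetaEtaCoeffs [0, -(etaData.den / 3)])))) = true := by decide +kernel

theorem thetaPow2_check : CoeffList.isZero (CoeffList.red (3 : ℕ) (CoeffList.add [0, 0, -1]
    (CoeffList.mulMod (3 : ℕ) 24 thetaData.tail thetaPowCoeffs2
      (CoeffList.add thetaEtaCoeffs [0, -(etaData.den / 3 * 2)])))) = true := by decide +kernel

theorem xi_check : CoeffList.isZero (CoeffList.rem 0 24 fTail (CoeffList.add
    (CoeffList.smul (thetaData.den ^ 2) (0 :: xiData.coeffs)) (CoeffList.smul (-xiData.den)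
      (CoeffList.mul rootCoeffs rootCoeffs)))) = true := by decide +kernel

theorem trace_norm_check : CoeffList.isZero (CoeffList.add
    (CoeffList.smul (xiData.den * normData.den)
      (CoeffList.mulMod 0 24 fTail traceData.coeffs traceData.coeffs))
    (CoeffList.smul (-(traceData.den ^ 2))
      (CoeffList.add (CoeffList.smul normData.den xiData.coeffs)
        (CoeffList.smul (4 * xiData.den) normData.coeffs)))) = true := by decide +kernel

end

theorem dvd_of_intCast_mem {R : Type*} [CommRing R] {Q : Ideal R} (hQ : Q ≠ ⊤) {p : ℕ}
    (hp : p.Prime) (h : (p : R) ∈ Q) {a : ℤ} (ha : (a : R) ∈ Q) : (p : ℤ) ∣ a := by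
  by_contra hpa
  obtain ⟨u, v, huv⟩ := (Nat.prime_iff_prime_int.mp hp).coprime_iff_not_dvd.mpr hpa
  refine hQ ((Ideal.eq_top_iff_one _).mpr ?_)
  have h1 := congrArg (Int.cast : ℤ → R) huv
  push_cast at h1
  rw [← h1]
  exact Q.add_mem (Q.mul_mem_left _ h) (Q.mul_mem_left _ ha)

section
variable {F : Type*} [Field F] [NumberField F]

/-- The discriminant of the powers of `θ` is the constant term of the minimal polynomial of the
different of `θ`. -/
theorem discr_pow_eq_headD (hn : Module.finrank ℚ F = 24) {t T w : List ℤ} (ht : t.length ≤ 24)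
    (hT : T.length ≤ 24) {θ : 𝓞 F} (hθ : minpoly ℚ (θ : F) = monicPoly ℚ 24 t)
    (h0 : CoeffList.isZero (CoeffList.homog 0 24 t 1 (CoeffList.derivMonic 24 t)
      (CoeffList.monic 24 T)) = true) (ℓ : ℕ) [Fact ℓ.Prime]
    (hw : CoeffList.isZero (CoeffList.red ℓ
      (CoeffList.add (CoeffList.compMod ℓ 24 t w (CoeffList.derivMonic 24 t)) [0, -1])) = true) :
    Algebra.discr ℤ (fun i : Fin 24 => θ ^ (i : ℕ)) = T.headD 0 := by
  have h1 : ((1 : ℤ) : F) * evalCoeffs (CoeffList.derivMonic 24 t) (θ : F) =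
    evalCoeffs (CoeffList.derivMonic 24 t) (θ : F) := by rw [Int.cast_one, one_mul]
  have h2 := CoeffList.mul_eval_homog (N := 0) (by simp) (root_of_minpoly hθ) h1
    (CoeffList.monic 24 T)
  rw [CoeffList.eval_eq_zero_of_isZero h0, mul_zero, Int.cast_one, one_pow, one_mul,
    eval_monic, eq_comm] at h2
  have h3 := norm_eq_of_minpoly_eq hn hT (minpoly_eq_of_generates ht hT 1 ℓ hθ h1 h2 hw)
  have h4 := discr_rat_eq_discr_int (F := F) (fun i : Fin 24 => θ ^ (i : ℕ))
  simp only [map_pow] at h4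
  rw [discr_pow_eq_norm hn ht hθ, h3] at h4
  have h5 : ((T.headD 0 : ℤ) : ℚ) = (Algebra.discr ℤ (fun i : Fin 24 => θ ^ (i : ℕ)) : ℤ) := by
    rw [← h4]; norm_num
  exact_mod_cast h5.symm

/-- A relation between powers of `θ` modulo `p` is trivial if it is shorter than the degrees of
the local factors add up to. -/
theorem dvd_of_sum_eq_mul {n : ℕ} {t : List ℤ} (ht : t.length ≤ n) {θ : 𝓞 F}
    (hθ : minpoly ℚ (θ : F) = monicPoly ℚ n t) {p : ℕ} [Fact p.Prime] {L : List LocalFactor}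
    (hL : ∀ f ∈ L, f.check p n t = true) (hd : L.Pairwise fun f g => f.differ p g = true) {k : ℕ}
    (hk : k ≤ (L.map fun f => f.exp * f.deg).sum) (hk0 : 0 < k) {z : Fin k → ℤ} {γ : 𝓞 F}
    (h : ∑ i, (z i : 𝓞 F) * θ ^ (i : ℕ) = p * γ) (i : Fin k) : (p : ℤ) ∣ z i := by
  let B : ℤ[X] := ∑ i : Fin k, C (z i) * X ^ (i : ℕ)
  have hB : aeval θ B = p * γ := by simp [B, ← h]
  have hdeg : B.natDegree < k := by
    by_cases hB0 : B = 0
    · simpa [hB0] using hk0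
    · exact (natDegree_lt_iff_degree_lt hB0).mpr (degree_sum_fin_lt z)
  have h0 := LocalFactor.map_eq_zero_of_aeval_eq_mul (monicPoly_dvd_of_aeval_eq_zero ht hθ)
    (ringOfIntegers_root hθ) hB hL hd (hdeg.trans_le hk)
  have h1 := congrArg (fun q => coeff q (i : ℕ)) h0
  have h2 : B.coeff i = z i := by
    simp [B, coeff_X_pow, Fin.val_inj]
  simpa [h2, ZMod.intCast_zmod_eq_zero_iff_dvd] using h1

/-- `θ` lies in every prime ideal containing `3` and `η - r`, for suitable certificates. -/
theorem mem_of_thetaPow {θ η : 𝓞 F} (hθ : minpoly ℚ (θ : F) = monicPoly ℚ 24 thetaData.tail)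
    (hs : evalCoeffs thetaEtaCoeffs θ = ((etaData.den / 3 : ℤ) : 𝓞 F) * (θ * η))
    {Q : Ideal (𝓞 F)} (hQ : Q.IsPrime) (h3 : ((3 : ℕ) : 𝓞 F) ∈ Q) {r u : ℤ}
    (hu : etaData.den / 3 * r = u)
    (hr : η - r ∈ Q) (k : ℕ) {A : List ℤ}
    (h : CoeffList.isZero (CoeffList.red (3 : ℕ) (CoeffList.add (List.replicate k 0 ++ [-1])
      (CoeffList.mulMod (3 : ℕ) 24 thetaData.tail A
        (CoeffList.add thetaEtaCoeffs [0, -u])))) = true) : θ ∈ Q := by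
  have h4 : (((3 : ℕ) : ℤ) : 𝓞 F ⧸ Q) = 0 := by
    rw [Int.cast_natCast, ← map_natCast (Ideal.Quotient.mk Q)]
    exact Ideal.Quotient.eq_zero_iff_mem.mpr h3
  have h5 := congrArg (Ideal.Quotient.mk Q) (ringOfIntegers_root hθ)
  have h6 := congrArg (Ideal.Quotient.mk Q) hs
  rw [map_add, map_pow, CoeffList.map_eval, map_zero] at h5
  rw [CoeffList.map_eval, map_mul, map_mul, map_intCast] at h6
  have h7 := Ideal.Quotient.eq_zero_iff_mem.mpr hr
  rw [map_sub, map_intCast] at h7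
  have h8 := CoeffList.eval_eq_zero_of_isZero h (Ideal.Quotient.mk Q θ)
  rw [CoeffList.eval_red h4, CoeffList.eval_add, CoeffList.eval_mulMod h4 h5, CoeffList.eval_add,
    h6, evalCoeffs_append, evalCoeffs_replicate_zero, ← hu] at h8
  simp only [CoeffList.eval_cons, CoeffList.eval_nil, List.length_replicate] at h8
  push_cast at h8
  have h9 : Ideal.Quotient.mk Q (θ ^ k) = 0 := by
    rw [map_pow]
    linear_combination -h8 + evalCoeffs A (Ideal.Quotient.mk Q θ) *
      ((etaData.den / 3 : ℤ) : 𝓞 F ⧸ Q) * Ideal.Quotient.mk Q θ * h7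
  exact hQ.mem_of_pow_mem k (Ideal.Quotient.eq_zero_iff_mem.mp h9)

end

/-- The arithmetic of indices: an integer `d` with `D = 2 ^ 12 * 3 ^ 24 * 11 ^ 22` equal to `d` up
to squares of suitable indices. -/
theorem abs_eq_of_index_relations {d i j b M₁ M₂ M₃ : ℤ} (hd : d ≠ 0) (hi : IsCoprime i j)
    (hi3 : ¬ (3 : ℤ) ∣ i) (hb3 : ¬ (3 : ℤ) ∣ b)
    (h1 : M₁ ^ 2 * d = 9 * i ^ 2 * (2 ^ 12 * 3 ^ 24 * 11 ^ 22))
    (h2 : M₂ ^ 2 * d = j ^ 2 * (2 ^ 12 * 3 ^ 24 * 11 ^ 22))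
    (h3 : M₃ ^ 2 * d = b ^ 2 * i ^ 2 * (2 ^ 12 * 3 ^ 24 * 11 ^ 22))
    (q2 : ¬ ((2 : ℕ) : ℤ) ∣ M₁) (q11 : ¬ ((11 : ℕ) : ℤ) ∣ M₁) (q3 : ¬ ((3 : ℕ) : ℤ) ∣ M₃) :
    |d| = 2 ^ 12 * 3 ^ 24 * 11 ^ 22 := by
  have i0 : i ≠ 0 := by rintro rfl; exact hi3 (dvd_zero _)
  obtain ⟨e, he⟩ : d ∣ 9 * (2 ^ 12 * 3 ^ 24 * 11 ^ 22) := by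
    obtain ⟨u, v, huv⟩ := hi.pow (m := 2) (n := 2)
    refine ⟨u * M₁ ^ 2 + 9 * v * M₂ ^ 2, ?_⟩
    linear_combination (-(9 * (2 ^ 12 * 3 ^ 24 * 11 ^ 22)) : ℤ) * huv - u * h1 - 9 * v * h2
  have e1 : M₁ ^ 2 = e * i ^ 2 := mul_right_cancel₀ hd (by linear_combination h1 + i ^ 2 * he)
  have e3 : 9 * M₃ ^ 2 = b ^ 2 * i ^ 2 * e :=
    mul_right_cancel₀ hd (by linear_combination 9 * h3 + b ^ 2 * i ^ 2 * he)
  have c2 : ¬ (2 : ℤ) ∣ e := fun h =>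
    q2 (Int.prime_two.dvd_of_dvd_pow (n := 2) (e1 ▸ h.mul_right _))
  have c11 : ¬ (11 : ℤ) ∣ e := fun h =>
    q11 ((Nat.prime_iff_prime_int.mp (by norm_num : Nat.Prime 11)).dvd_of_dvd_pow (n := 2)
      (e1 ▸ h.mul_right _))
  have hdvd : e ∣ 3 ^ 26 := by
    have h4 : e ∣ (2 ^ 12 * 11 ^ 22) * 3 ^ 26 := ⟨d, by linear_combination he⟩
    refine IsCoprime.dvd_of_dvd_mul_left (IsCoprime.symm ?_) h4
    exact ((Int.prime_two.coprime_iff_not_dvd.mpr c2).pow_left).mul_left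
      ((((Nat.prime_iff_prime_int.mp (by norm_num : Nat.Prime 11)).coprime_iff_not_dvd.mpr
        c11)).pow_left)
  obtain ⟨k, -, hk⟩ := (Nat.dvd_prime_pow Nat.prime_three).mp
    (show e.natAbs ∣ 3 ^ 26 by simpa using Int.natAbs_dvd_natAbs.mpr hdvd)
  have hk3 : k ≤ 2 := by
    by_contra hk3
    have h5 : (27 : ℤ) ∣ e := by
      rw [← Int.dvd_natAbs, hk]
      exact_mod_cast (pow_dvd_pow 3 (by omega : 3 ≤ k) : 3 ^ 3 ∣ 3 ^ k)
    obtain ⟨w, rfl⟩ := h5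
    exact q3 (Int.prime_three.dvd_of_dvd_pow (n := 2) ⟨b ^ 2 * i ^ 2 * w, by linarith⟩)
  have hk2 : 2 ≤ k := by
    have h5 : (9 : ℤ) ∣ e := by
      have h6 : IsCoprime (3 ^ 2 : ℤ) (b ^ 2 * i ^ 2) :=
        (((Int.prime_three.coprime_iff_not_dvd.mpr hb3).pow).mul_right
          ((Int.prime_three.coprime_iff_not_dvd.mpr hi3).pow))
      exact IsCoprime.dvd_of_dvd_mul_left (by simpa using h6) ⟨_, e3.symm⟩
    by_contra hk2
    have h7 : 9 ∣ e.natAbs := by simpa using Int.natAbs_dvd_natAbs.mpr h5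
    rw [hk] at h7
    interval_cases k <;> omega
  obtain rfl : k = 2 := by omega
  have h8 : |d| * |e| = 9 * (2 ^ 12 * 3 ^ 24 * 11 ^ 22) := by
    rw [← abs_mul, ← he]; norm_num
  have h9 : |e| = 9 := by rw [Int.abs_eq_natAbs, hk]; norm_num
  rw [h9] at h8
  linarith

theorem etaTail_root_one : 1 + evalCoeffs etaData.tail (1 : ZMod 3) = 0 := by decide +kernel

theorem etaTail_root_two : 2 ^ 24 + evalCoeffs etaData.tail (2 : ZMod 3) = 0 := by decide +kernel

theorem evalCoeffs_eq_sum {R : Type*} [CommRing R] {n : ℕ} {l : List ℤ} (h : l.length ≤ n)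
    (x : R) : evalCoeffs l x = ∑ i : Fin n, (l.getD i 0 : ℤ) * x ^ (i : ℕ) := by
  induction l generalizing n with
  | nil => simp
  | cons c l ih =>
    obtain ⟨n, rfl⟩ : ∃ m, n = m + 1 := ⟨n - 1, by simp at h; omega⟩
    rw [CoeffList.eval_cons, ih (n := n) (by simpa using h), Fin.sum_univ_succ, Finset.mul_sum]
    simp only [Fin.val_zero, Fin.val_succ, List.getD_cons_zero, List.getD_cons_succ, pow_zero,
      mul_one]
    congr 1
    exact Finset.sum_congr rfl fun i _ => by ring

section
variable {F : Type*} [Field F] [NumberField F]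

/-- A prime containing `3` and `η - r`, where `r` is `1` or `2`. -/
theorem exists_prime_eta_sub_mem {η : 𝓞 F} (hη : minpoly ℚ (η : F) = monicPoly ℚ 24 etaData.tail)
    (r : ℤ) (hr : r = 1 ∨ r = 2) :
    ∃ Q : Ideal (𝓞 F), Q.IsPrime ∧ ((3 : ℕ) : 𝓞 F) ∈ Q ∧ η - r ∈ Q := by
  have : Fact (Nat.Prime 3) := ⟨Nat.prime_three⟩
  have h1 : ¬ IsUnit ((X - C r : ℤ[X]).map (Int.castRingHom (ZMod 3))) := by
    rw [Polynomial.map_sub, map_X, map_C]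
    exact not_isUnit_X_sub_C _
  have h2 : (X - C r : ℤ[X]).map (Int.castRingHom (ZMod 3)) ∣
      (monicPoly ℤ 24 etaData.tail).map (Int.castRingHom (ZMod 3)) := by
    rw [Polynomial.map_sub, map_X, map_C, map_monicPoly, dvd_iff_isRoot, IsRoot.def,
      eval_monicPoly]
    rcases hr with rfl | rfl
    · simpa using etaTail_root_one
    · simpa using etaTail_root_two
  obtain ⟨Q, hQ, h3, h⟩ :=
    exists_prime_mem_aeval (monicPoly_dvd_of_aeval_eq_zero (by decide) hη) h1 h2
  exact ⟨Q, hQ, h3, by simpa using h⟩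

theorem dvd_of_sum_theta_eta {θ η : 𝓞 F}
    (hθ : minpoly ℚ (θ : F) = monicPoly ℚ 24 thetaData.tail)
    (hη : minpoly ℚ (η : F) = monicPoly ℚ 24 etaData.tail)
    (hs : evalCoeffs thetaEtaCoeffs θ = ((etaData.den / 3 : ℤ) : 𝓞 F) * (θ * η))
    (z : Fin 24 → ℤ) (γ : 𝓞 F)
    (h : ∑ i, (z i : 𝓞 F) * (Fin.snoc (fun i : Fin 23 => θ ^ (i : ℕ))
      (((etaData.den / 3 : ℤ) : 𝓞 F) * η) : Fin 24 → 𝓞 F) i = (3 : ℕ) * γ) (i : Fin 24) :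
    ((3 : ℕ) : ℤ) ∣ z i := by
  have : Fact (Nat.Prime 3) := ⟨Nat.prime_three⟩
  rw [Fin.sum_univ_castSucc] at h
  simp only [Fin.snoc_castSucc, Fin.snoc_last] at h
  have key (r : ℤ) (hr : r = 1 ∨ r = 2) :
      ((3 : ℕ) : ℤ) ∣ z 0 + z (Fin.last 23) * (etaData.den / 3) * r := by
    obtain ⟨Q, hQ, h3, hηr⟩ := exists_prime_eta_sub_mem hη r hr
    have hθQ : θ ∈ Q := by
      rcases hr with rfl | rfl
      · exact mem_of_thetaPow hθ hs hQ h3 (mul_one _) hηr 1 thetaPow1_check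
      · exact mem_of_thetaPow hθ hs hQ h3 rfl hηr 2 thetaPow2_check
    refine dvd_of_intCast_mem hQ.ne_top Nat.prime_three h3 ?_
    rw [Fin.sum_univ_succ] at h
    have h1 : ∑ i : Fin 22, (z i.succ.castSucc : 𝓞 F) * θ ^ (i.succ : ℕ) ∈ Q :=
      Q.sum_mem fun i _ => Q.mul_mem_left _ (by
        rw [Fin.val_succ, pow_succ]; exact Q.mul_mem_left _ hθQ)
    have h2 := Q.sub_mem (Q.sub_mem (Q.mul_mem_right γ h3) h1)
      (Q.mul_mem_left (z (Fin.last 23) * (etaData.den / 3 : ℤ)) hηr)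
    rw [← h] at h2
    convert h2 using 1
    push_cast
    simp only [Fin.val_zero, pow_zero, mul_one]
    ring
  have hlast : ((3 : ℕ) : ℤ) ∣ z (Fin.last 23) := by
    have h1 := dvd_sub (key 2 (Or.inr rfl)) (key 1 (Or.inl rfl))
    have h2 : ¬ ((3 : ℕ) : ℤ) ∣ etaData.den / 3 := by decide +kernel
    have h3 : z 0 + z (Fin.last 23) * (etaData.den / 3) * 2 -
        (z 0 + z (Fin.last 23) * (etaData.den / 3) * 1) =
        z (Fin.last 23) * (etaData.den / 3) := by ring
    rw [h3] at h1
    exact (Int.Prime.dvd_mul' Nat.prime_three h1).resolve_right h2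
  cases i using Fin.lastCases with
  | last => exact hlast
  | cast i =>
    obtain ⟨c, hc⟩ := hlast
    refine dvd_of_sum_eq_mul (by decide) hθ thetaFactors3_check (by decide +kernel)
      (by decide +kernel) (by norm_num) (z := fun i : Fin 23 => z i.castSucc)
      (γ := γ - c * (etaData.den / 3 : ℤ) * η) ?_ i
    rw [hc] at h
    push_cast at h ⊢
    linear_combination h

theorem abs_discr_of_minpoly (hn : Module.finrank ℚ F = 24) {x : F}
    (hx : minpoly ℚ x = monicPoly ℚ 24 fTail) : |discr F| = 2 ^ 12 * 3 ^ 24 * 11 ^ 22 := by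
  have : Fact (Nat.Prime 2) := ⟨Nat.prime_two⟩
  have : Fact (Nat.Prime 7) := ⟨by norm_num⟩
  have : Fact (Nat.Prime 11) := ⟨by norm_num⟩
  have : Fact (Nat.Prime 13) := ⟨by norm_num⟩
  have hx0 := root_of_minpoly hx
  let θ : 𝓞 F := ⟨thetaData.val x, ScaledElement.isIntegral_val thetaData_check hx0⟩
  have hθ : minpoly ℚ (θ : F) = monicPoly ℚ 24 thetaData.tail :=
    minpoly_eq_of_generates (by decide) (by decide) _ 13 hx
      (ScaledElement.den_mul_val thetaData_check x) (ScaledElement.val_root thetaData_check hx0)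
      thetaInv_check
  have hθ0 := root_of_minpoly hθ
  let η : 𝓞 F := ⟨etaData.val (θ : F), ScaledElement.isIntegral_val etaData_check hθ0⟩
  have hη1 : (etaData.den : F) * η = evalCoeffs etaData.coeffs (θ : F) :=
    ScaledElement.den_mul_val etaData_check (θ : F)
  have hη : minpoly ℚ (η : F) = monicPoly ℚ 24 etaData.tail :=
    minpoly_eq_of_generates (by decide) (by decide) _ 2 hθ hη1
      (ScaledElement.val_root etaData_check hθ0) etaInv_check
  have hden : etaData.den = 3 * (etaData.den / 3) := by decide +kernel
  have hs : evalCoeffs thetaEtaCoeffs θ = ((etaData.den / 3 : ℤ) : 𝓞 F) * (θ * η) := by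
    apply RingOfIntegers.coe_injective
    rw [map_mul, map_mul, map_intCast]
    refine (coe_evalCoeffs thetaEtaCoeffs θ).trans ?_
    have h := CoeffList.eval_eq_zero_of_isZero thetaEta_check (θ : F)
    simp only [CoeffList.eval_add, CoeffList.eval_smul, CoeffList.eval_cons, eval_monic, hθ0,
      ← hη1] at h
    rw [hden] at h
    push_cast at h
    linear_combination -h / 3
  have d1 := discr_pow_eq_headD hn (by decide) (by decide) hθ thetaDiff_root_check 7
    thetaDiffInv_check
  have d2 := discr_pow_eq_headD hn (by decide) (by decide) hη etaDiff_root_check 7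
    etaDiffInv_check
  have d3 : Algebra.discr ℤ (Fin.snoc (fun i : Fin 23 => θ ^ (i : ℕ))
      (((etaData.den / 3 : ℤ) : 𝓞 F) * η) : Fin 24 → 𝓞 F) =
      etaData.coeffs.getD 23 0 ^ 2 * (etaData.den / 3) ^ 2 * (2 ^ 12 * 3 ^ 24 * 11 ^ 22) := by
    have h1 := discr_snoc_eq (n := 23) (θ : F) (((etaData.den / 3 : ℤ) : F) * η)
      (fun i => (etaData.coeffs.getD i 0 : ℚ) / 3) (by
        have h2 : (etaData.coeffs).length ≤ 24 := by decide +kernel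
        rw [evalCoeffs_eq_sum h2, hden] at hη1
        refine mul_left_cancel₀ (three_ne_zero (α := F)) ?_
        rw [← mul_assoc, Finset.mul_sum]
        push_cast at hη1
        rw [hη1]
        refine Finset.sum_congr rfl fun i _ => ?_
        rw [Algebra.smul_def, map_div₀, map_intCast, map_ofNat]
        ring)
    have h2 := discr_rat_eq_discr_int (F := F) (fun i : Fin 24 => θ ^ (i : ℕ))
    have h3 := discr_rat_eq_discr_int (F := F) (Fin.snoc (fun i : Fin 23 => θ ^ (i : ℕ))
      (((etaData.den / 3 : ℤ) : 𝓞 F) * η) : Fin 24 → 𝓞 F)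
    have h4 : (fun i => ((Fin.snoc (fun i : Fin 23 => θ ^ (i : ℕ))
      (((etaData.den / 3 : ℤ) : 𝓞 F) * η) : Fin 24 → 𝓞 F) i : F)) =
      (Fin.snoc (fun i : Fin 23 => (θ : F) ^ (i : ℕ)) (((etaData.den / 3 : ℤ) : F) * η) :
        Fin 24 → F) := by
      ext i
      cases i using Fin.lastCases with
      | last => 
        rw [Fin.snoc_last, Fin.snoc_last]
        exact (map_mul (algebraMap (𝓞 F) F) _ _).trans (by rw [map_intCast])
      | cast i => 
        rw [Fin.snoc_castSucc, Fin.snoc_castSucc]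
        exact map_pow (algebraMap (𝓞 F) F) _ _
    simp only [map_pow] at h2
    rw [h4, h1, h2, d1] at h3
    have h5 : (thetaDiffTail.headD 0 : ℤ) = 9 * (etaData.den / 3) ^ 2 *
      (2 ^ 12 * 3 ^ 24 * 11 ^ 22) := by decide +kernel
    rw [h5, Fin.val_last] at h3
    push_cast at h3
    have h6 : ((Algebra.discr ℤ (Fin.snoc (fun i : Fin 23 => θ ^ (i : ℕ))
      (((etaData.den / 3 : ℤ) : 𝓞 F) * η) : Fin 24 → 𝓞 F) : ℤ) : ℚ) =
      (etaData.coeffs.getD 23 0 ^ 2 * (etaData.den / 3) ^ 2 * (2 ^ 12 * 3 ^ 24 * 11 ^ 22) : ℤ) := by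
      push_cast
      rw [← h3]
      ring
    exact_mod_cast h6
  obtain ⟨M1, e1, p1⟩ := exists_discr_eq_sq_mul hn (fun i : Fin 24 => θ ^ (i : ℕ))
  obtain ⟨M2, e2, -⟩ := exists_discr_eq_sq_mul hn (fun i : Fin 24 => η ^ (i : ℕ))
  obtain ⟨M3, e3, p3⟩ := exists_discr_eq_sq_mul hn (Fin.snoc (fun i : Fin 23 => θ ^ (i : ℕ))
      (((etaData.den / 3 : ℤ) : 𝓞 F) * η) : Fin 24 → 𝓞 F)
  have q2 := p1 2 Nat.prime_two fun z γ h i => dvd_of_sum_eq_mul (by decide) hθ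
    thetaFactors2_check (by decide +kernel) (by decide +kernel) (by norm_num) h i
  have q11 := p1 11 (by norm_num) fun z γ h i => dvd_of_sum_eq_mul (by decide) hθ
    thetaFactors11_check (by decide +kernel) (by decide +kernel) (by norm_num) h i
  have q3 := p3 3 Nat.prime_three fun z γ h i => dvd_of_sum_theta_eta hθ hη hs z γ h i
  rw [d1] at e1
  rw [d2] at e2
  rw [d3] at e3
  refine abs_eq_of_index_relations (i := etaData.den / 3) (b := etaData.coeffs.getD 23 0)
    (j := 361015211569814801559556696386234442889536710412277743061529) (discr_ne_zero F)
    (Int.isCoprime_iff_gcd_eq_one.mpr ?_) ?_ ?_ (e1.symm.trans ?_) (e2.symm.trans ?_) e3.symm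
    q2 q11 q3
  all_goals decide +kernel
end

theorem CoeffList.pow_ne_self_of_noRootCheck {k : Type*} [Field k] {p n d : ℕ} {t s : List ℤ}
    (hp : (p : k) = 0) (h : noRootCheck p n t d s = true) {x : k}
    (hx : x ^ n + evalCoeffs t x = 0) : x ^ p ^ d ≠ x := by
  intro hxd
  have hp' : (((p : ℕ) : ℤ) : k) = 0 := by rw [Int.cast_natCast, hp]
  have h2 := CoeffList.eval_eq_zero_of_isZero h x
  rw [CoeffList.eval_red hp', CoeffList.eval_add, CoeffList.eval_mulMod hp' hx,
    CoeffList.eval_add, CoeffList.eval_powMod hp' hx _ Nat.lt_two_pow_self] at h2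
  simp only [CoeffList.eval_cons, CoeffList.eval_nil] at h2
  push_cast at h2
  refine one_ne_zero (α := k) ?_
  linear_combination -h2 + evalCoeffs s x * hxd

theorem thetaData_eleven_check : CoeffList.isZero (CoeffList.red (11 : ℕ)
    (CoeffList.add (CoeffList.monic 24 thetaData.tail)
      (CoeffList.smul (-1) (CoeffList.pow (CoeffList.monic 2 [2, 5]) 12)))) = true := by
  decide +kernel

theorem thetaData_noRootCheck : CoeffList.noRootCheck 11 2 [2, 5] 1 [1, 7] = true := by
  decide +kernel

theorem Ideal.eq_of_le_of_absNorm_eq {S : Type*} [CommRing S] [IsDedekindDomain S]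
    [Module.Free ℤ S] [Module.Finite ℤ S] [CharZero S] {I J : Ideal S} (h : I ≤ J)
    (hIJ : absNorm I = absNorm J) (h0 : absNorm J ≠ 0) : I = J := by
  obtain ⟨L, rfl⟩ := Ideal.dvd_iff_le.mpr h
  rw [map_mul] at hIJ
  rw [Ideal.absNorm_eq_one_iff.mp (mul_left_cancel₀ h0 (hIJ.trans (mul_one _).symm)),
    Ideal.mul_top]

/-- In a field containing the root `θ` of `thetaData.tail`, all primes above `11` have even
residue degree, so that elements of norm `121` generate prime ideals. -/
theorem eq_span_singleton_of_absNorm {E : Type*} [Field E] [NumberField E] {θ : 𝓞 E}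
    (hθ : θ ^ 24 + evalCoeffs thetaData.tail θ = 0) {P : Ideal (𝓞 E)} [hP : P.IsMaximal]
    {π : 𝓞 E} (hπ : π ∈ P) (hN : Ideal.absNorm (Ideal.span {π}) = 121) :
    Ideal.span {π} = P := by
  have hle : Ideal.span {π} ≤ P := (Ideal.span_singleton_le_iff_mem P).mpr hπ
  have hdvd := Ideal.absNorm_dvd_absNorm_of_le hle
  rw [hN] at hdvd
  have hP0 : Ideal.absNorm P ≠ 0 := fun h => by rw [h] at hdvd; norm_num at hdvd
  have h1 : Ideal.absNorm P ≠ 1 := fun h => hP.ne_top (Ideal.absNorm_eq_one_iff.mp h)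
  have h11 : Ideal.absNorm P ≠ 11 := by
    intro h
    let _ : Field (𝓞 E ⧸ P) := Ideal.Quotient.field P
    have hf : Finite (𝓞 E ⧸ P) := Nat.finite_of_card_ne_zero (by
      rw [← Submodule.cardQuot_apply, ← Ideal.absNorm_apply]; exact hP0)
    have hc : Nat.card (𝓞 E ⧸ P) = 11 := by
      rw [← h, Ideal.absNorm_apply, Submodule.cardQuot_apply]
    have h0 : ((11 : ℕ) : 𝓞 E ⧸ P) = 0 := by
      rw [← h, ← map_natCast (Ideal.Quotient.mk P)]
      exact Ideal.Quotient.eq_zero_iff_mem.mpr (Ideal.absNorm_mem P)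
    have h2 := congrArg (Ideal.Quotient.mk P) hθ
    rw [map_add, map_pow, map_zero, CoeffList.map_eval] at h2
    have h3 := CoeffList.eval_eq_zero_of_isZero thetaData_eleven_check (Ideal.Quotient.mk P θ)
    rw [CoeffList.eval_red (by exact_mod_cast h0), CoeffList.eval_add, eval_monic, h2,
      CoeffList.eval_smul, CoeffList.eval_pow, eval_monic] at h3
    have h4 : Ideal.Quotient.mk P θ ^ 2 + evalCoeffs [2, 5] (Ideal.Quotient.mk P θ) = 0 := by
      refine pow_eq_zero_iff (n := 12) (by norm_num) |>.mp ?_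
      simpa using h3
    refine CoeffList.pow_ne_self_of_noRootCheck h0 thetaData_noRootCheck h4 ?_
    have := Fintype.ofFinite (𝓞 E ⧸ P)
    rw [pow_one]
    conv_lhs => rw [← hc, Nat.card_eq_fintype_card]
    exact FiniteField.pow_card _
  have h121 : Ideal.absNorm P = 121 := by
    have h5 : Ideal.absNorm P ∈ Nat.divisors 121 := Nat.mem_divisors.mpr ⟨hdvd, by norm_num⟩
    have h6 : Nat.divisors 121 = {1, 11, 121} := by decide +kernel
    rw [h6] at h5
    simp only [Finset.mem_insert, Finset.mem_singleton] at h5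
    tauto
  exact Ideal.eq_of_le_of_absNorm_eq hle (hN.trans h121.symm) hP0

section
variable {F K : Type*} [Field F] [NumberField F] [Field K] [NumberField K] [Algebra F K]

/-- The different of a ramified quadratic extension generated by `(ε + v) / 2`, where `ε` is a
square root of a generator of a prime ideal. -/
theorem differentIdeal_eq_span_singleton (h2 : Module.finrank F K = 2) {ξ v n : 𝓞 F} {ε ω : 𝓞 K}
    (hε : ε ^ 2 = algebraMap (𝓞 F) (𝓞 K) ξ) (hv : v ^ 2 = ξ + 4 * n)
    (hω : 2 * ω = ε + algebraMap (𝓞 F) (𝓞 K) v)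
    (hεF : ∀ a : F, algebraMap F K a ≠ algebraMap (𝓞 K) K ε) (hξ : (Ideal.span {ξ}).IsPrime) :
    differentIdeal (𝓞 F) (𝓞 K) = Ideal.span {ε} := by
  have hε0 : ε ≠ 0 := fun h => hεF 0 (by rw [h, map_zero, map_zero])
  have hξ0 : ξ ≠ 0 := fun h => hε0 (by simpa [h] using hε)
  have hωK := congrArg (algebraMap (𝓞 K) K) hω
  have hεK := congrArg (algebraMap (𝓞 K) K) hε
  rw [map_mul, map_add, map_ofNat, ← IsScalarTower.algebraMap_apply,
    IsScalarTower.algebraMap_apply (𝓞 F) F K] at hωK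
  rw [map_pow, ← IsScalarTower.algebraMap_apply, IsScalarTower.algebraMap_apply (𝓞 F) F K] at hεK
  have htop : Algebra.adjoin F {algebraMap (𝓞 K) K ω} = ⊤ := by
    have := Subalgebra.isSimpleOrder_of_finrank_prime F K (h2 ▸ Nat.prime_two)
    refine (eq_bot_or_eq_top _).resolve_left fun h => ?_
    have h3 := h ▸ Algebra.self_mem_adjoin_singleton F (algebraMap (𝓞 K) K ω)
    obtain ⟨a, ha⟩ := Algebra.mem_bot.mp h3
    refine hεF (2 * a - algebraMap (𝓞 F) F v) ?_
    rw [map_sub, map_mul, map_ofNat, ha, hωK]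
    ring
  have hdeg : (minpoly F (algebraMap (𝓞 K) K ω)).natDegree = 2 := by
    rw [← h2]
    exact (Field.primitive_element_iff_minpoly_natDegree_eq F _).mp
      (IntermediateField.adjoin_eq_top_iff.mpr htop)
  have hmin : minpoly F (algebraMap (𝓞 K) K ω) =
      X ^ 2 + (C (-algebraMap (𝓞 F) F v) * X + C (algebraMap (𝓞 F) F n)) := by
    have hd : degree (C (-algebraMap (𝓞 F) F v) * X + C (algebraMap (𝓞 F) F n)) < (2 : ℕ) :=
      degree_linear_lt
    refine (eq_of_monic_of_dvd_of_natDegree_le (minpoly.monic (IsIntegral.of_finite F _))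
      (monic_X_pow_add hd) (minpoly.dvd F _ ?_) ?_).symm
    · have h := congrArg (fun a => algebraMap F K (algebraMap (𝓞 F) F a)) hv
      simp only [map_pow, map_add, map_mul, map_ofNat] at h
      rw [map_add, map_add, map_mul, map_pow, aeval_X, aeval_C, aeval_C, map_neg]
      linear_combination hωK * (2 * algebraMap (𝓞 K) K ω -
        algebraMap F K (algebraMap (𝓞 F) F v) + algebraMap (𝓞 K) K ε) / 4 + hεK / 4 - h / 4
    · rw [hdeg]
      compute_degree
  refine le_antisymm ?_ ?_
  · rw [← Ideal.dvd_iff_le]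
    have : (Ideal.span {ξ}).IsMaximal := hξ.isMaximal (by simpa using hξ0)
    have h4 := pow_sub_one_dvd_differentIdeal_aux (𝓞 F) F K (p := Ideal.span {ξ})
      (Ideal.span {ε}) (e := 2) two_ne_zero (by simpa using hξ0)
      (by rw [Ideal.map_span, Set.image_singleton, ← hε, Ideal.span_singleton_pow])
    simpa using h4
  · rw [Ideal.span_singleton_le_iff_mem]
    have h5 := aeval_derivative_mem_differentIdeal (𝓞 F) F K ω htop
    convert h5 using 1
    apply RingOfIntegers.coe_injective
    rw [← aeval_algebraMap_apply, ← aeval_map_algebraMap F, ← derivative_map,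
      ← minpoly.isIntegrallyClosed_eq_field_fractions F K (IsIntegralClosure.isIntegral (𝓞 F) K ω),
      hmin]
    simp only [derivative_X_pow, derivative_mul, derivative_C, derivative_X,
      map_add, map_mul, map_pow, aeval_X, aeval_C, map_neg, map_one, map_natCast, map_zero]
    push_cast
    linear_combination -hωK

/-- The discriminant of a quadratic extension whose relative discriminant is generated by an
element of norm `121`. -/
theorem abs_discr_eq_mul_sq (h2 : Module.finrank F K = 2) {θ : 𝓞 F}
    (hθ : θ ^ 24 + evalCoeffs thetaData.tail θ = 0) {ξ v n : 𝓞 F} {ε : 𝓞 K}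
    (hε : ε ^ 2 = algebraMap (𝓞 F) (𝓞 K) ξ) (hv : v ^ 2 = ξ + 4 * n)
    (hεF : ∀ a : F, algebraMap F K a ≠ algebraMap (𝓞 K) K ε)
    (hN : Ideal.absNorm (Ideal.span {ξ}) = 121) : |discr K| = 11 ^ 2 * |discr F| ^ 2 := by
  have hNε : Ideal.absNorm (Ideal.span {ε}) = 121 := by
    have h := Ideal.absNorm_algebraMap (𝓞 F) (𝓞 K) (Ideal.span {ξ})
    rw [Ideal.map_span, Set.image_singleton, ← hε, ← Ideal.span_singleton_pow, map_pow, hN,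
      ← IsFractionRing.finrank_eq (𝓞 F) F (𝓞 K) K, h2] at h
    exact Nat.pow_left_injective two_ne_zero h
  have hξ : (Ideal.span {ξ}).IsPrime := by
    obtain ⟨P, hP, hle⟩ := Ideal.exists_le_maximal (Ideal.span {ξ}) (fun ht => by
      rw [ht, Ideal.absNorm_top] at hN; norm_num at hN)
    rw [eq_span_singleton_of_absNorm hθ (hle (Ideal.mem_span_singleton_self ξ)) hN]
    exact hP.isPrime
  have hint : IsIntegral (𝓞 F) ((algebraMap (𝓞 K) K ε + algebraMap (𝓞 F) K v) / 2) := by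
    refine ⟨X ^ 2 + (C (-v) * X + C n), monic_X_pow_add degree_linear_lt, ?_⟩
    have h := congrArg (algebraMap (𝓞 F) K) hv
    have h' := congrArg (algebraMap (𝓞 K) K) hε
    simp only [map_pow, map_add, map_mul, map_ofNat] at h h'
    rw [← IsScalarTower.algebraMap_apply] at h'
    simp only [eval₂_add, eval₂_mul, eval₂_pow, eval₂_X, eval₂_C, eval₂_neg, map_neg]
    linear_combination h' / 4 - h / 4
  let ω : 𝓞 K := ⟨(algebraMap (𝓞 K) K ε + algebraMap (𝓞 F) K v) / 2, isIntegral_trans _ hint⟩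
  have hω : 2 * ω = ε + algebraMap (𝓞 F) (𝓞 K) v := by
    apply RingOfIntegers.coe_injective
    rw [map_mul, map_add, map_ofNat, ← IsScalarTower.algebraMap_apply]
    exact mul_div_cancel₀ _ two_ne_zero
  have h := natAbs_discr_eq_absNorm_differentIdeal_mul_natAbs_discr_pow F (𝓞 F) K (𝓞 K)
  rw [differentIdeal_eq_span_singleton h2 hε hv hω hεF hξ, hNε, h2] at h
  rw [Int.abs_eq_natAbs, h, Int.abs_eq_natAbs]
  push_cast
  norm_num
end

section
variable {F K : Type*} [Field F] [NumberField F] [Field K] [NumberField K] [Algebra F K]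

theorem abs_discr_of_sq_eq (hF : Module.finrank ℚ F = 24) (h2 : Module.finrank F K = 2) {x : F}
    (hx : minpoly ℚ x = monicPoly ℚ 24 fTail) {y : K} (hy : y ^ 2 = algebraMap F K x)
    (hyF : ∀ a : F, algebraMap F K a ≠ y) :
    |discr K| = 11 ^ 2 * (2 ^ 12 * 3 ^ 24 * 11 ^ 22) ^ 2 := by
  have : Fact (Nat.Prime 13) := ⟨by norm_num⟩
  have hx0 := root_of_minpoly hx
  have hden {e : ScaledElement} (h : e.check 24 fTail = true) : (e.den : F) ≠ 0 := by
    simp only [ScaledElement.check, Bool.and_eq_true, Bool.not_eq_true',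
      beq_eq_false_iff_ne] at h
    exact Int.cast_ne_zero.mpr h.1.1
  let θ : 𝓞 F := ⟨thetaData.val x, ScaledElement.isIntegral_val thetaData_check hx0⟩
  let ξ : 𝓞 F := ⟨xiData.val x, ScaledElement.isIntegral_val xiData_check hx0⟩
  let v : 𝓞 F := ⟨traceData.val x, ScaledElement.isIntegral_val traceData_check hx0⟩
  let n : 𝓞 F := ⟨normData.val x, ScaledElement.isIntegral_val normData_check hx0⟩
  have hθ : θ ^ 24 + evalCoeffs thetaData.tail θ = 0 := by
    apply RingOfIntegers.coe_injective
    rw [map_add, map_pow, map_zero, ← ScaledElement.val_root thetaData_check hx0]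
    exact congrArg _ (coe_evalCoeffs _ θ)
  have hξ := ScaledElement.den_mul_val xiData_check x
  have hv := ScaledElement.den_mul_val traceData_check x
  have hn := ScaledElement.den_mul_val normData_check x
  have hvξ : v ^ 2 = ξ + 4 * n := by
    apply RingOfIntegers.coe_injective
    rw [map_add, map_pow, map_mul, map_ofNat]
    change traceData.val x ^ 2 = xiData.val x + 4 * normData.val x
    have h := CoeffList.eval_eq_zero_of_isZero trace_norm_check x
    simp only [CoeffList.eval_add, CoeffList.eval_smul,
      CoeffList.eval_mulMod (N := 0) (by simp) hx0, ← hξ, ← hv, ← hn] at h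
    push_cast at h
    refine mul_left_cancel₀ (mul_ne_zero (mul_ne_zero (hden xiData_check) (hden normData_check))
      (pow_ne_zero 2 (hden traceData_check))) ?_
    linear_combination h
  obtain ⟨w, hw⟩ : ∃ w : F, w ^ 2 = xiData.val x * x := by
    refine ⟨evalCoeffs rootCoeffs x / thetaData.den, ?_⟩
    have h := CoeffList.eval_eq_zero_of_isZero xi_check x
    rw [CoeffList.eval_rem (N := 0) (by simp) hx0] at h
    simp only [CoeffList.eval_add, CoeffList.eval_smul, CoeffList.eval_cons, CoeffList.eval_mul,
      ← hξ] at h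
    push_cast at h
    rw [div_pow, div_eq_iff (pow_ne_zero 2 (hden thetaData_check))]
    refine mul_left_cancel₀ (hden xiData_check) ?_
    linear_combination -h
  have hN : Ideal.absNorm (Ideal.span {ξ}) = 121 := by
    have h1 : minpoly ℚ (xiData.val x) = monicPoly ℚ 24 xiData.tail :=
      minpoly_eq_of_generates (by decide) (by decide) _ 13 hx hξ
        (ScaledElement.val_root xiData_check hx0) xiInv_check
    have h3 := norm_eq_of_minpoly_eq hF (by decide) h1
    have h4 : xiData.tail.headD 0 = 121 := by decide +kernel
    have h5 : (Algebra.norm ℤ ξ : ℚ) = 121 := by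
      rw [Algebra.coe_norm_int]
      refine h3.trans ?_
      rw [h4]
      norm_num
    rw [Ideal.absNorm_span_singleton, show Algebra.norm ℤ ξ = 121 by exact_mod_cast h5]
    rfl
  have hξ0 : xiData.val x ≠ 0 := fun h0 => by
    have : ξ = 0 := RingOfIntegers.coe_injective (h0.trans (map_zero _).symm)
    rw [this, Ideal.span_singleton_zero, Ideal.absNorm_bot] at hN
    norm_num at hN
  have hy0 : y ≠ 0 := fun h => hyF 0 (by rw [h, map_zero])
  have hwy : (algebraMap F K w / y) ^ 2 = algebraMap F K (xiData.val x) := by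
    rw [div_pow, ← map_pow, hw, hy, map_mul]
    exact mul_div_cancel_right₀ _ (hy ▸ pow_ne_zero 2 hy0)
  let ε : 𝓞 K := ⟨algebraMap F K w / y, IsIntegral.of_pow two_pos (by
    rw [hwy]; exact (ScaledElement.isIntegral_val xiData_check hx0).algebraMap)⟩
  have hε : ε ^ 2 = algebraMap (𝓞 F) (𝓞 K) ξ := by
    apply RingOfIntegers.coe_injective
    rw [map_pow, ← IsScalarTower.algebraMap_apply, IsScalarTower.algebraMap_apply (𝓞 F) F K]
    exact hwy
  rw [abs_discr_eq_mul_sq h2 hθ hε hvξ (fun a ha => hyF (w / a) ?_) hN,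
    abs_discr_of_minpoly hF hx]
  have ha' : algebraMap F K a = algebraMap F K w / y := ha
  have ha0 : algebraMap F K w / y ≠ 0 := fun h => by
    rw [h, zero_pow two_ne_zero, eq_comm, map_eq_zero] at hwy
    exact hξ0 hwy
  rw [map_div₀, ha', div_div_cancel₀]
  exact fun h => ha0 (by rw [h, zero_div])
end

open IntermediateField in
theorem abs_discr_of_adjoin_eq_top {K : Type*} [Field K] [NumberField K] {y : K}
    (hy : minpoly ℚ y = monicPoly ℚ 48 gTail) (htop : ℚ⟮y⟯ = ⊤) :
    |discr K| = 11 ^ 2 * (2 ^ 12 * 3 ^ 24 * 11 ^ 22) ^ 2 := by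
  have hK : Module.finrank ℚ K = 48 := by
    rw [← (Field.primitive_element_iff_minpoly_natDegree_eq ℚ y).mp htop, hy,
      natDegree_monicPoly (by decide)]
  have hroot := (g_root_iff y).mp (root_of_minpoly hy)
  have hmul := Module.finrank_mul_finrank ℚ ℚ⟮y ^ 2⟯ K
  have hint : IsIntegral ℚ (y ^ 2) := IsIntegral.of_finite ℚ _
  have hdvd : minpoly ℚ (y ^ 2) ∣ monicPoly ℚ 24 fTail := minpoly.dvd _ _ (by
    rw [aeval_def, eval₂_eq_eval_map, map_monicPoly, eval_monicPoly, hroot])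
  have hmonic : (monicPoly ℚ 24 fTail).Monic := monic_monicPoly (by decide)
  have hdeg : (monicPoly ℚ 24 fTail).natDegree = 24 := natDegree_monicPoly (by decide)
  have h24 : Module.finrank ℚ ℚ⟮y ^ 2⟯ ≤ 24 := by
    rw [adjoin.finrank hint, ← hdeg]
    exact natDegree_le_of_dvd hdvd hmonic.ne_zero
  have hx : algebraMap ℚ⟮y ^ 2⟯ K (AdjoinSimple.gen ℚ (y ^ 2)) = y ^ 2 :=
    AdjoinSimple.algebraMap_gen ℚ (y ^ 2)
  have htop' : ℚ⟮y ^ 2⟯⟮y⟯ = ⊤ := by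
    rw [eq_top_iff]
    intro z _
    have hle : ℚ⟮y⟯ ≤ (ℚ⟮y ^ 2⟯⟮y⟯).restrictScalars ℚ :=
      adjoin_simple_le_iff.mpr (mem_adjoin_simple_self _ y)
    exact hle (htop ▸ mem_top)
  have h2 : Module.finrank ℚ⟮y ^ 2⟯ K ≤ 2 := by
    rw [← (Field.primitive_element_iff_minpoly_natDegree_eq _ y).mp htop']
    have hd : minpoly ℚ⟮y ^ 2⟯ y ∣ X ^ 2 - C (AdjoinSimple.gen ℚ (y ^ 2)) :=
      minpoly.dvd _ _ (by rw [map_sub, map_pow, aeval_X, aeval_C, hx, sub_self])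
    exact (natDegree_le_of_dvd hd (X_pow_sub_C_ne_zero two_pos _)).trans_eq natDegree_X_pow_sub_C
  rw [hK] at hmul
  have hF : Module.finrank ℚ ℚ⟮y ^ 2⟯ = 24 := by nlinarith
  have hF2 : Module.finrank ℚ⟮y ^ 2⟯ K = 2 := by
    rw [hF] at hmul
    omega
  refine abs_discr_of_sq_eq hF hF2 (x := AdjoinSimple.gen ℚ (y ^ 2)) ?_ hx.symm fun a ha => ?_
  · rw [← minpoly.algebraMap_eq (algebraMap ℚ⟮y ^ 2⟯ K).injective, hx]
    refine (eq_of_monic_of_dvd_of_natDegree_le (minpoly.monic hint) hmonic hdvd ?_).symm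
    rw [hdeg, ← adjoin.finrank hint, hF]
  · have hle : ℚ⟮y⟯ ≤ ℚ⟮y ^ 2⟯ := adjoin_simple_le_iff.mpr (Set.mem_of_eq_of_mem ha.symm a.2)
    rw [htop, top_le_iff] at hle
    rw [hle, finrank_top', hK] at hF
    norm_num at hF

/-- The degree-48 polynomial `g` below is irreducible over `ℚ`, its Galois
group has order `380160` (the order of `2.M₁₂.2`), and the number field `ℚ[y]/(g)` has
discriminant of absolute value `11²·(2¹²·3²⁴·11²²)² = 2²⁴·3⁴⁸·11⁴⁶`. -/
theorem lifted_fC2_irreducible_gal_and_discr :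
    let g : Polynomial ℚ :=
      X ^ 48 - 22 * X ^ 44 + 495 * X ^ 40 - 4774 * X ^ 36 + 51997 * X ^ 32
        - 214038 * X ^ 28 + 64152 * X ^ 26 + 2194852 * X ^ 24 - 705672 * X ^ 22
        - 4044304 * X ^ 20 - 30696732 * X ^ 18 + 61713630 * X ^ 16 + 149602464 * X ^ 14
        - 9212940 * X ^ 12 + 569477304 * X ^ 10 + 138870369 * X ^ 8 - 484796664 * X ^ 6
        + 1029399030 * X ^ 4 + 39870468 * X ^ 2 + 793881
    Irreducible g ∧ Nat.card g.Gal = 380160 ∧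
      ∀ (K : Type) [Field K] [NumberField K] (y : K),
        Polynomial.aeval y g = 0 → IntermediateField.adjoin ℚ {y} = ⊤ →
        |NumberField.discr K| = 11 ^ 2 * (2 ^ 12 * 3 ^ 24 * 11 ^ 22) ^ 2 := by
  intro g
  have hg : g = monicPoly ℚ 48 gTail := by
    simp only [g, monicPoly, gTail, CoeffList.eval_cons, CoeffList.eval_nil]
    push_cast
    ring
  rw [hg]
  refine ⟨gal_monicPoly.1, gal_monicPoly.2, fun K _ _ y hy htop => ?_⟩
  exact abs_discr_of_adjoin_eq_top
    (minpoly.eq_of_irreducible_of_monic gal_monicPoly.1 hy (monic_monicPoly (by decide))).symm htop
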